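/- arXiv:1410.0430 — 2 statements merged into one kernel-verified Lean document; each statement's English description precedes it below -/
import Mathlib

section
/- There exists an absolute constant c > 0 such that for every natural number k ≥ 1, every non-bipartite 2-connected finite simple graph G with average degree at least c·k and girth g contains at least k^⌊(g-1)/2⌋ cycles of consecutive odd lengths. -/
/-- `G` contains a cycle of length `n`. -/
def HasCycleOfLength {V : Type*} (G : SimpleGraph V) (n : ℕ) : Prop :=
  ∃ (v : V) (c : G.Walk v v), c.IsCycle ∧ c.length = n

/-- `G` contains `k` cycles of consecutive odd lengths: there is an odd integer `n`
such that `G` has a cycle of length `n + 2 * i` for every `i = 0, 1, ..., k - 1`. -/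
def HasConsecutiveOddCycles {V : Type*} (G : SimpleGraph V) (k : ℕ) : Prop :=
  ∃ n : ℕ, Odd n ∧ ∀ i < k, HasCycleOfLength G (n + 2 * i)

/-- `G` is 2-connected: it has at least 3 vertices and stays connected after the
deletion of any single vertex. -/
def TwoConnected {V : Type*} [Fintype V] (G : SimpleGraph V) : Prop :=
  3 ≤ Fintype.card V ∧ ∀ v : V, (G.induce ({v}ᶜ : Set V)).Connected

namespace SimpleGraph

variable {V : Type*} {G : SimpleGraph V}

/-! ### Walks -/

lemma Walk.IsPath.append_of_inter {a b c : V} {p : G.Walk a b} {q : G.Walk b c} (hp : p.IsPath)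
    (hq : q.IsPath) (h : ∀ z ∈ p.support, z ∈ q.support → z = b) : (p.append q).IsPath := by
  rw [Walk.isPath_def, Walk.support_append]
  have hq' := hq.support_nodup
  rw [← Walk.cons_tail_support, List.nodup_cons] at hq'
  refine List.Nodup.append hp.support_nodup hq'.2 ?_
  intro z hz hz'
  have := h z hz (List.mem_of_mem_tail hz')
  exact hq'.1 (this ▸ hz')

lemma Walk.IsPath.isCycle_append_of_inter {a b : V} {p : G.Walk a b} {q : G.Walk b a}
    (hp : p.IsPath) (hq : q.IsPath) (h : ∀ z ∈ p.support, z ∈ q.support → z = a ∨ z = b)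
    (hn : 1 < p.length ∨ 1 < q.length) : (p.append q).IsCycle := by
  refine hp.isCycle_append hq ?_ hn
  intro z hz hz'
  have hp' := hp.support_nodup
  have hq' := hq.support_nodup
  rw [← Walk.cons_tail_support, List.nodup_cons] at hq' hp'
  rcases h z (List.mem_of_mem_tail hz) (List.mem_of_mem_tail hz') with rfl | rfl
  · exact hp'.1 hz
  · exact hq'.1 hz'

/-- A sequence of distinct consecutively adjacent vertices is a path. -/
lemma exists_isPath_of_injOn (h : ℕ → V) (n : ℕ) (hadj : ∀ t < n, G.Adj (h t) (h (t + 1)))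
    (hinj : ∀ s ≤ n, ∀ t ≤ n, h s = h t → s = t) :
    ∃ p : G.Walk (h 0) (h n), p.IsPath ∧ p.length = n ∧ ∀ z ∈ p.support, ∃ t ≤ n, z = h t := by
  induction n with
  | zero => exact ⟨Walk.nil, by simp, rfl, by simp⟩
  | succ n ih =>
    obtain ⟨p, hp, hl, hs⟩ := ih (fun t ht => hadj t (by omega))
      (fun s hs t ht => hinj s (by omega) t (by omega))
    refine ⟨p.concat (hadj n (by omega)), hp.concat ?_ _, by simp [hl], ?_⟩
    · intro hm
      obtain ⟨t, ht, he⟩ := hs _ hm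
      have := hinj (n + 1) le_rfl t (by omega) he
      omega
    · intro z hz
      rw [Walk.support_concat] at hz
      simp only [List.mem_append, List.mem_singleton] at hz
      rcases hz with hz | rfl
      · obtain ⟨t, ht, he⟩ := hs _ hz
        exact ⟨t, by omega, he⟩
      · exact ⟨n + 1, le_rfl, rfl⟩

/-- A vertex of a cycle splits it into two paths. -/
lemma Walk.IsCycle.exists_arcs {p q : V} {D : G.Walk p p} (hD : D.IsCycle) (hq : q ∈ D.support)
    (hpq : q ≠ p) : ∃ α β : G.Walk p q, α.IsPath ∧ β.IsPath ∧ α.length + β.length = D.length ∧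
      α.support ⊆ D.support ∧ β.support ⊆ D.support := by
  classical
  refine ⟨D.takeUntil q hq, (D.dropUntil q hq).reverse, hD.isPath_takeUntil hq, ?_, ?_, ?_, ?_⟩
  · rw [Walk.isPath_reverse_iff]
    have := hD
    rw [← D.take_spec hq] at this
    exact this.isPath_of_append_right (Walk.not_nil_of_ne hpq.symm)
  · rw [Walk.length_reverse, ← Walk.length_append, D.take_spec hq]
  · exact D.support_takeUntil_subset_support hq
  · rw [Walk.support_reverse]
    intro z hz
    exact D.support_dropUntil_subset_support hq (List.mem_reverse.1 hz)

/-- Deleting a vertex leaves a graph in which two nonempty sets are joined by a path that is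
internally disjoint from both. -/
lemma exists_isPath_between (p : V) (h : (G.induce ({p}ᶜ : Set V)).Connected) (X Z : Set V)
    (hX : ∃ a ∈ X, a ≠ p) (hZ : ∃ a ∈ Z, a ≠ p) :
    ∃ a b, ∃ Q : G.Walk a b, Q.IsPath ∧ a ∈ X ∧ b ∈ Z ∧ p ∉ Q.support ∧
      (∀ s ∈ Q.support, s ∈ X → s = a) ∧ (∀ s ∈ Q.support, s ∈ Z → s = b) := by
  classical
  have key : ∃ n, ∃ a b, ∃ Q : G.Walk a b, Q.length = n ∧ a ∈ X ∧ b ∈ Z ∧ p ∉ Q.support := by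
    obtain ⟨a, ha, hap⟩ := hX
    obtain ⟨b, hb, hbp⟩ := hZ
    obtain ⟨w⟩ := h.preconnected ⟨a, hap⟩ ⟨b, hbp⟩
    refine ⟨_, a, b, w.map (Embedding.induce _).toHom, rfl, ha, hb, ?_⟩
    intro hm
    replace hm : p ∈ (w.map (Embedding.induce ({p}ᶜ : Set V)).toHom).support := hm
    rw [Walk.support_map] at hm
    obtain ⟨z, -, hz⟩ := List.mem_map.1 hm
    exact z.2 hz
  obtain ⟨a, b, Q, hQ, ha, hb, hp⟩ := Nat.find_spec key
  have hmin : ∀ a b (Q' : G.Walk a b), a ∈ X → b ∈ Z → p ∉ Q'.support → Q.length ≤ Q'.length := by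
    intro a b Q' h1 h2 h3
    rw [hQ]
    exact Nat.find_min' key ⟨a, b, Q', rfl, h1, h2, h3⟩
  refine ⟨a, b, Q, ?_, ha, hb, hp, ?_, ?_⟩
  · have h1 := hmin a b Q.bypass ha hb (fun hm => hp (Q.support_bypass_subset_support hm))
    have : Q.bypass = Q := by
      by_contra hne
      have := Q.length_bypass_le_length
      have h2 := Q.bypass_isPath
      exact hne (Q.bypass_eq_self_of_length_le_length_bypass h1)
    rw [← this]
    exact Q.bypass_isPath
  · intro s hs hsX
    by_contra hne
    have := hmin s b (Q.dropUntil s hs) hsX hb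
      (fun hm => hp (Q.support_dropUntil_subset_support hs hm))
    have h2 := Q.length_dropUntil_lt_length hs hne
    omega
  · intro s hs hsZ
    by_contra hne
    have := hmin a s (Q.takeUntil s hs) ha hsZ
      (fun hm => hp (Q.support_takeUntil_subset_support hs hm))
    have h2 := Q.length_takeUntil_lt_length hs hne
    omega

lemma exists_odd_parity_path_of_path (hG : ∀ p : V, (G.induce ({p}ᶜ : Set V)).Connected)
    {x : V} {Y : Set V} (hY : Y.Nonempty) (col : V → ℕ) (n : ℕ)
    (ih : ∀ (p : V) (D : G.Walk p p) (P : G.Walk x p), P.length < n → D.IsCycle → Odd D.length →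
      (∀ z ∈ D.support, z ∉ Y) → (∀ z ∈ P.support, z ∉ Y) → ∃ y ∈ Y, ∃ E : G.Walk x y, E.IsPath ∧
        (∀ z ∈ E.support, z ∈ Y → z = y) ∧ Odd (E.length + col x + col y))
    {p : V} {D : G.Walk p p} {P : G.Walk x p} (hn : P.length ≤ n) (hP : P.IsPath)
    (hD : D.IsCycle) (hodd : Odd D.length) (hDY : ∀ z ∈ D.support, z ∉ Y)
    (hPY : ∀ z ∈ P.support, z ∉ Y) (hPD : ∀ z ∈ P.support, z ∈ D.support → z = p) :
    ∃ y ∈ Y, ∃ E : G.Walk x y, E.IsPath ∧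
      (∀ z ∈ E.support, z ∈ Y → z = y) ∧ Odd (E.length + col x + col y) := by
  classical
  have hX : ∃ a ∈ {z | z ∈ D.support ∧ z ≠ p}, a ≠ p := by
    refine ⟨D.snd, ⟨D.getVert_mem_support 1, ?_⟩, ?_⟩ <;>
    · exact (D.adj_snd hD.not_nil).ne'
  have hZ : ∃ a ∈ Y ∪ {z | z ∈ P.support ∧ z ≠ p}, a ≠ p := by
    obtain ⟨y, hy⟩ := hY
    exact ⟨y, Or.inl hy, fun h => hDY p D.start_mem_support (h ▸ hy)⟩
  obtain ⟨q, b, Q, hQ, ⟨hqD, hqp⟩, hb, hpQ, hQX, hQZ⟩ :=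
    exists_isPath_between p (hG p) _ _ hX hZ
  obtain ⟨α, β, hα, hβ, hαβ, hαD, hβD⟩ := hD.exists_arcs hqD hqp
  have hQD : ∀ z ∈ Q.support, z ∈ D.support → z = q := fun z hz hzD =>
    hQX z hz ⟨hzD, fun h => hpQ (h ▸ hz)⟩
  rcases hb with hbY | ⟨hbP, hbp⟩
  · have main : ∀ γ : G.Walk p q, γ.IsPath → γ.support ⊆ D.support →
        Odd (P.length + γ.length + Q.length + col x + col b) → ∃ y ∈ Y, ∃ E : G.Walk x y,
          E.IsPath ∧ (∀ z ∈ E.support, z ∈ Y → z = y) ∧ Odd (E.length + col x + col y) := by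
      intro γ hγ hγD ho
      refine ⟨b, hbY, (P.append γ).append Q, ?_, ?_, by simpa using ho⟩
      · refine (hP.append_of_inter hγ fun z h1 h2 => hPD z h1 (hγD h2)).append_of_inter hQ ?_
        intro z hz hzQ
        rcases (Walk.mem_support_append_iff _ _).1 hz with h | h
        · have := hQZ z hzQ (Or.inr ⟨h, fun h => hpQ (h ▸ hzQ)⟩)
          exact absurd (this ▸ hbY) (hPY z h)
        · exact hQD z hzQ (hγD h)
      · intro z hz hzY
        rcases (Walk.mem_support_append_iff _ _).1 hz with h | h
        · rcases (Walk.mem_support_append_iff _ _).1 h with h | h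
          · exact absurd hzY (hPY z h)
          · exact absurd hzY (hDY z (hγD h))
        · exact hQZ z h (Or.inl hzY)
    by_cases ho : Odd (P.length + α.length + Q.length + col x + col b)
    · exact main α hα hαD ho
    · refine main β hβ hβD ?_
      rw [← hαβ] at hodd
      simp only [Nat.odd_iff] at *
      omega
  · have main : ∀ γ : G.Walk p q, γ.IsPath → γ.support ⊆ D.support →
        Odd ((P.dropUntil b hbP).length + γ.length + Q.length) → ∃ y ∈ Y, ∃ E : G.Walk x y,
          E.IsPath ∧ (∀ z ∈ E.support, z ∈ Y → z = y) ∧ Odd (E.length + col x + col y) := by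
      intro γ hγ hγD ho
      have hsub := P.support_dropUntil_subset_support hbP
      have hQY : ∀ z ∈ Q.support, z ∉ Y := fun z hz hzY => by
        have := hQZ z hz (Or.inl hzY)
        exact hPY b hbP (this ▸ hzY)
      refine ih b (((P.dropUntil b hbP).append γ).append Q) (P.takeUntil b hbP) ?_ ?_
        (by simpa using ho) ?_ ?_
      · have := P.length_takeUntil_lt_length hbP hbp
        omega
      · refine Walk.IsPath.isCycle_append_of_inter
          ((hP.dropUntil hbP).append_of_inter hγ fun z h1 h2 => hPD z (hsub h1) (hγD h2)) hQ ?_ ?_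
        · intro z hz hzQ
          rcases (Walk.mem_support_append_iff _ _).1 hz with h | h
          · exact Or.inl (hQZ z hzQ (Or.inr ⟨hsub h, fun h => hpQ (h ▸ hzQ)⟩))
          · exact Or.inr (hQD z hzQ (hγD h))
        · left
          have h1 : (P.dropUntil b hbP).length ≠ 0 := fun h =>
            hbp (Walk.eq_of_length_eq_zero h)
          have h2 : γ.length ≠ 0 := fun h => hqp (Walk.eq_of_length_eq_zero h).symm
          rw [Walk.length_append]
          omega
      · intro z hz
        rcases (Walk.mem_support_append_iff _ _).1 hz with h | h
        · rcases (Walk.mem_support_append_iff _ _).1 h with h | h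
          · exact hPY z (hsub h)
          · exact hDY z (hγD h)
        · exact hQY z h
      · exact fun z hz => hPY z (P.support_takeUntil_subset_support hbP hz)
    by_cases ho : Odd ((P.dropUntil b hbP).length + α.length + Q.length)
    · exact main α hα hαD ho
    · refine main β hβ hβD ?_
      rw [← hαβ] at hodd
      simp only [Nat.odd_iff] at *
      omega

/-- In a 2-connected graph, if `x` is joined to an odd cycle by a walk that avoids `Y` together
with the cycle, then some path from `x` to `Y` that is internally disjoint from `Y` has the parity
which a given colouring `col` forbids. -/
theorem exists_odd_parity_path (hG : ∀ p : V, (G.induce ({p}ᶜ : Set V)).Connected)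
    {x : V} {Y : Set V} (hY : Y.Nonempty) (col : V → ℕ) {p : V} (D : G.Walk p p) (P : G.Walk x p)
    (hD : D.IsCycle) (hodd : Odd D.length) (hDY : ∀ z ∈ D.support, z ∉ Y)
    (hPY : ∀ z ∈ P.support, z ∉ Y) :
    ∃ y ∈ Y, ∃ E : G.Walk x y, E.IsPath ∧
      (∀ z ∈ E.support, z ∈ Y → z = y) ∧ Odd (E.length + col x + col y) := by
  classical
  induction hn : P.length using Nat.strong_induction_on generalizing p with
  | _ n ih =>
  by_cases hPD : ∀ z ∈ P.support, z ∈ D.support → z = p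
  · refine exists_odd_parity_path_of_path hG hY col n ?_ (hn ▸ P.length_bypass_le_length)
      P.bypass_isPath hD hodd hDY
      (fun z hz => hPY z (P.support_bypass_subset_support hz))
      (fun z hz => hPD z (P.support_bypass_subset_support hz))
    intro p' D' P' h1 h2 h3 h4 h5
    exact ih _ h1 D' P' h2 h3 h4 h5 rfl
  · push Not at hPD
    obtain ⟨z, hzP, hzD, hzp⟩ := hPD
    refine ih _ (hn ▸ P.length_takeUntil_lt_length hzP hzp) (D.rotate z hzD) (P.takeUntil z hzP)
      (hD.rotate hzD) (by rwa [Walk.length_rotate]) ?_ ?_ rfl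
    · intro w hw
      exact hDY w ((Walk.mem_support_rotate_iff ..).1 hw)
    · exact fun w hw => hPY w (P.support_takeUntil_subset_support hzP hw)

/-! ### Cycles with a chord -/

/-- The periodic sequence `F` winds around a cycle of length `n` in `G`. -/
structure IsCyclicSeq (G : SimpleGraph V) (F : ℤ → V) (n : ℤ) : Prop where
  eq_of_dvd : ∀ a b, n ∣ a - b → F a = F b
  dvd_of_eq : ∀ a b, F a = F b → n ∣ a - b
  adj : ∀ z, G.Adj (F z) (F (z + 1))

lemma IsCyclicSeq.neg {F : ℤ → V} {n : ℤ} (h : IsCyclicSeq G F n) :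
    IsCyclicSeq G (fun z => F (-z)) n where
  eq_of_dvd a b hab := h.eq_of_dvd _ _ (by
    rw [show -a - -b = -(a - b) by ring, dvd_neg]; exact hab)
  dvd_of_eq a b hab := by
    have := h.dvd_of_eq _ _ hab
    rwa [show -a - -b = -(a - b) by ring, dvd_neg] at this
  adj z := by
    have := (h.adj (-(z + 1))).symm
    simpa using this

/-- For each period `ℓ` that survives all the detours through the chord, `X` alternates. -/
lemma alternating_of_periodic {n r ℓ : ℤ} {X : ℤ → Prop} (hr : 2 ≤ r) (hrn : 2 * r ≤ n)
    (hl : 0 < ℓ) (hln : ℓ < n) (hX : ∃ a b, X a ∧ ¬ X b)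
    (hn : ∀ z, X z ↔ X (z + n)) (h0 : ∀ z, X z ↔ X (z + ℓ))
    (h1 : ∀ a, 0 ≤ a → a ≤ r - 1 → a ≤ ℓ - 1 → ℓ - 1 - a ≤ n - r - 1 → (X a ↔ X (r + (ℓ - 1 - a))))
    (h2 : ∀ a, 0 ≤ a → a ≤ r - 1 → a ≤ ℓ - 1 → ℓ - 1 - a ≤ n - r - 1 →
      (X (r - a) ↔ X (-(ℓ - 1 - a))))
    (h3 : ∀ b, 0 ≤ b → b ≤ ℓ - 1 → ℓ ≤ n - r → (X (-b) ↔ X (r + (ℓ - 1 - b)))) :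
    Even ℓ ∧ ∀ z, X z ↔ ¬ X (z + 1) := by
  let H : AddSubgroup ℤ :=
    { carrier := {q | ∀ z, X z ↔ X (z + q)}
      zero_mem' := by simp
      add_mem' := by
        intro a b ha hb z
        rw [ha z, hb (z + a), add_assoc]
      neg_mem' := by
        intro a ha z
        rw [ha (z + -a)]
        simp }
  have memH : ∀ q, q ∈ H ↔ ∀ z, X z ↔ X (z + q) := fun q => Iff.rfl
  obtain ⟨p, hp0, hp⟩ : ∃ p : ℤ, 0 ≤ p ∧ ∀ q, q ∈ H ↔ p ∣ q := by
    obtain ⟨g, hg⟩ := Int.subgroup_cyclic H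
    refine ⟨|g|, abs_nonneg g, fun q => ?_⟩
    rw [hg, abs_dvd, AddSubgroup.mem_closure_singleton]
    constructor
    · rintro ⟨k, rfl⟩
      exact ⟨k, by simp [mul_comm]⟩
    · rintro ⟨k, rfl⟩
      exact ⟨k, by simp [mul_comm]⟩
  have hXp : ∀ z z', p ∣ z - z' → (X z ↔ X z') := by
    intro z z' hd
    have := (memH _).1 ((hp _).2 hd) z'
    rw [this]
    simp
  have hpn : p ∣ n := (hp n).1 ((memH n).2 hn)
  have hpl : p ∣ ℓ := (hp ℓ).1 ((memH ℓ).2 h0)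
  have hppos : 0 < p := by
    rcases hp0.lt_or_eq with h | h
    · exact h
    · rw [← h, zero_dvd_iff] at hpn
      omega
  have hple : p ≤ ℓ := Int.le_of_dvd hl hpl
  have hpnl : p ≤ n - ℓ := Int.le_of_dvd (by omega) (dvd_sub hpn hpl)
  have hp1 : p ≠ 1 := by
    rintro rfl
    obtain ⟨a, b, ha, hb⟩ := hX
    exact hb ((hXp a b (one_dvd _)).1 ha)
  have hrep : ∀ c z : ℤ, ∃ a, c ≤ a ∧ a < c + p ∧ p ∣ z - a := by
    intro c z
    refine ⟨c + (z - c) % p, ?_, ?_, ?_⟩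
    · have := Int.emod_nonneg (z - c) hppos.ne'
      omega
    · have := Int.emod_lt_of_pos (z - c) hppos
      omega
    · rw [show z - (c + (z - c) % p) = (z - c) - (z - c) % p by ring]
      exact Int.dvd_self_sub_emod
  rcases lt_or_ge r p with hrp | hrp
  · exfalso
    have : p ∣ r - 1 := by
      rw [← hp, memH]
      intro z
      obtain ⟨b, hb0, hb1, hb⟩ := hrep 0 (-z)
      have e1 : X z ↔ X (-b) := hXp _ _ (by
        rw [show z - -b = -(-z - b) by ring, dvd_neg]; exact hb)
      have e2 : X (r + (ℓ - 1 - b)) ↔ X (z + (r - 1)) := hXp _ _ (by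
        rw [show r + (ℓ - 1 - b) - (z + (r - 1)) = (-z - b) + ℓ by ring]
        exact dvd_add hb hpl)
      rw [e1, h3 b hb0 (by omega) (by omega), e2]
    have := Int.le_of_dvd (by omega) this
    omega
  · obtain ⟨c, hc⟩ : ∃ c, c = max 0 (ℓ + r - n) := ⟨_, rfl⟩
    have hc0 : 0 ≤ c := by omega
    have hc1 : ℓ + r - n ≤ c := by omega
    have hc2 : c + p ≤ r := by omega
    have hc3 : c + p ≤ ℓ := by omega
    have e1 : ∀ z, X z ↔ X (r - 1 - z) := by
      intro z
      obtain ⟨a, ha0, ha1, ha⟩ := hrep c z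
      rw [hXp z a ha, h1 a (by omega) (by omega) (by omega) (by omega)]
      apply hXp
      rw [show r + (ℓ - 1 - a) - (r - 1 - z) = (z - a) + ℓ by ring]
      exact dvd_add ha hpl
    have e2 : ∀ z, X (r - z) ↔ X (z + 1) := by
      intro z
      obtain ⟨a, ha0, ha1, ha⟩ := hrep c z
      rw [hXp (r - z) (r - a) (by
        rw [show r - z - (r - a) = -(z - a) by ring, dvd_neg]; exact ha),
        h2 a (by omega) (by omega) (by omega) (by omega)]
      apply hXp
      rw [show -(ℓ - 1 - a) - (z + 1) = -((z - a) + ℓ) by ring, dvd_neg]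
      exact dvd_add ha hpl
    have hp2 : p = 2 := by
      have : p ∣ 2 := by
        rw [← hp, memH]
        intro z
        rw [e1 z, show r - 1 - z = r - (z + 1) by ring, e2, add_assoc]
        norm_num
      have := Int.le_of_dvd (by norm_num) this
      omega
    subst hp2
    refine ⟨even_iff_two_dvd.2 hpl, ?_⟩
    obtain ⟨a, b, ha, hb⟩ := hX
    have hab : ¬ 2 ∣ a - b := fun h => hb ((hXp a b h).1 ha)
    intro z
    by_cases hz : 2 ∣ z - a
    · have z1 : X z := (hXp z a hz).2 ha
      have z2 : ¬ X (z + 1) := fun h => hb ((hXp (z + 1) b (by omega)).1 h)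
      simp [z1, z2]
    · have z1 : ¬ X z := fun h => hb ((hXp z b (by omega)).1 h)
      have z2 : X (z + 1) := (hXp (z + 1) a (by omega)).2 ha
      simp [z1, z2]

lemma IsCyclicSeq.exists_path_aux {F : ℤ → V} {n r : ℤ} (hF : IsCyclicSeq G F n) (hr : 2 ≤ r)
    (hrn : 2 * r ≤ n) (hch : G.Adj (F 0) (F r)) (χ : V → Prop) (hχ : ∃ a b, χ (F a) ∧ ¬ χ (F b))
    {ℓ : ℕ} (hl : 0 < ℓ) (hln : (ℓ : ℤ) < n) :
    (∃ a b, ∃ Q : G.Walk (F a) (F b), Q.IsPath ∧ Q.length = ℓ ∧ χ (F a) ∧ ¬ χ (F b) ∧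
      ∀ z ∈ Q.support, ∃ t, z = F t) ∨ (Even ℓ ∧ ∀ z, χ (F z) ↔ ¬ χ (F (z + 1))) := by
  rw [or_iff_not_imp_left]
  intro hno
  have key : ∀ h : ℕ → ℤ, (∀ t < ℓ, G.Adj (F (h t)) (F (h (t + 1)))) →
      (∀ s ≤ ℓ, ∀ t ≤ ℓ, |h s - h t| < n) → (∀ s ≤ ℓ, ∀ t ≤ ℓ, h s = h t → s = t) →
      (χ (F (h 0)) ↔ χ (F (h ℓ))) := by
    intro h hadj hlt hinj
    obtain ⟨Q, hQ, hQl, hQs⟩ := exists_isPath_of_injOn (fun t => F (h t)) ℓ hadj (by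
      intro s hs t ht he
      have := Int.eq_zero_of_abs_lt_dvd (hF.dvd_of_eq _ _ he) (hlt s hs t ht)
      exact hinj s hs t ht (by omega))
    by_contra hne
    apply hno
    by_cases h0 : χ (F (h 0))
    · refine ⟨_, _, Q, hQ, hQl, h0, fun h1 => hne ⟨fun _ => h1, fun _ => h0⟩, ?_⟩
      intro z hz
      obtain ⟨t, -, ht⟩ := hQs z hz
      exact ⟨_, ht⟩
    · refine ⟨_, _, Q.reverse, hQ.reverse, by simpa using hQl, ?_, h0, ?_⟩
      · by_contra h1
        exact hne ⟨fun h => absurd h h0, fun h => absurd h h1⟩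
      · intro z hz
        rw [Walk.support_reverse, List.mem_reverse] at hz
        obtain ⟨t, -, ht⟩ := hQs z hz
        exact ⟨_, ht⟩
  have adj_of : ∀ a b : ℤ, b = a + 1 → G.Adj (F a) (F b) := fun a b h => h ▸ hF.adj a
  have adj_of' : ∀ a b : ℤ, a = b + 1 → G.Adj (F a) (F b) := fun a b h => h ▸ (hF.adj b).symm
  have adj_ch : ∀ a b : ℤ, a = 0 → b = r → G.Adj (F a) (F b) := by
    rintro _ _ rfl rfl; exact hch
  have adj_ch' : ∀ a b : ℤ, a = r → b = 0 → G.Adj (F a) (F b) := by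
    rintro _ _ rfl rfl; exact hch.symm
  obtain ⟨hev, halt⟩ := alternating_of_periodic (n := n) (r := r) (ℓ := ℓ) (X := fun z => χ (F z))
    hr hrn (by exact_mod_cast hl) hln hχ
    (fun z => by
      have : F z = F (z + n) := hF.eq_of_dvd _ _ ⟨-1, by ring⟩
      simp only [this])
    (fun z => by
      have := key (fun t => z + t) (fun t _ => adj_of _ _ (by push_cast; ring))
        (fun s hs t ht => by rw [abs_lt]; constructor <;> omega) (fun s hs t ht he => by omega)
      simpa using this)
    (fun a ha0 ha1 ha2 ha3 => by
      lift a to ℕ using ha0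
      have := key (fun t => if t ≤ a then (a : ℤ) - t else r + (t - a - 1))
        (fun t ht => by
          rcases lt_trichotomy t a with h | h | h
          · exact adj_of' _ _ (by grind)
          · exact adj_ch _ _ (by grind) (by grind)
          · exact adj_of _ _ (by grind))
        (fun s hs t ht => by rw [abs_lt]; constructor <;> grind)
        (fun s hs t ht he => by grind)
      convert this using 3
      · simp
      · grind)
    (fun a ha0 ha1 ha2 ha3 => by
      lift a to ℕ using ha0
      have := key (fun t => if t ≤ a then r - a + t else -(t - a - 1))
        (fun t ht => by
          rcases lt_trichotomy t a with h | h | h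
          · exact adj_of _ _ (by grind)
          · exact adj_ch' _ _ (by grind) (by grind)
          · exact adj_of' _ _ (by grind))
        (fun s hs t ht => by rw [abs_lt]; constructor <;> grind)
        (fun s hs t ht he => by grind)
      convert this using 3
      · simp
      · grind)
    (fun b hb0 hb1 hb2 => by
      lift b to ℕ using hb0
      have := key (fun t => if t ≤ b then -(b : ℤ) + t else r + (t - b - 1))
        (fun t ht => by
          rcases lt_trichotomy t b with h | h | h
          · exact adj_of _ _ (by grind)
          · exact adj_ch _ _ (by grind) (by grind)
          · exact adj_of _ _ (by grind))
        (fun s hs t ht => by rw [abs_lt]; constructor <;> grind)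
        (fun s hs t ht he => by grind)
      convert this using 3
      · simp
      · grind)
  exact ⟨by exact_mod_cast hev, halt⟩

/-- In a cycle with a chord whose vertices are coloured with two colours, both of them used, there
are paths of every length less than that of the cycle whose ends have different colours, unless the
length is even and the colours alternate along the cycle. -/
theorem IsCyclicSeq.exists_path {F : ℤ → V} {n r : ℤ} (hF : IsCyclicSeq G F n) (hr : 2 ≤ r)
    (hrn : r ≤ n - 2) (hch : G.Adj (F 0) (F r)) (χ : V → Prop) (hχ : ∃ a b, χ (F a) ∧ ¬ χ (F b))
    {ℓ : ℕ} (hl : 0 < ℓ) (hln : (ℓ : ℤ) < n) :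
    (∃ a b, ∃ Q : G.Walk (F a) (F b), Q.IsPath ∧ Q.length = ℓ ∧ χ (F a) ∧ ¬ χ (F b) ∧
      ∀ z ∈ Q.support, ∃ t, z = F t) ∨ (Even ℓ ∧ ∀ z, χ (F z) ↔ ¬ χ (F (z + 1))) := by
  rcases le_total (2 * r) n with h | h
  · exact hF.exists_path_aux hr h hch χ hχ hl hln
  · have hch' : G.Adj (F (-0)) (F (-(n - r))) := by
      rw [hF.eq_of_dvd (-(n - r)) r ⟨-1, by ring⟩]
      simpa using hch
    obtain ⟨a, b, ha, hb⟩ := hχ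
    rcases hF.neg.exists_path_aux (r := n - r) (by omega) (by omega) hch' χ
        ⟨-a, -b, by simpa using ha, by simpa using hb⟩ hl hln with
      ⟨a, b, Q, h1, h2, h3, h4, h5⟩ | ⟨h1, h2⟩
    · refine Or.inl ⟨-a, -b, Q, h1, h2, h3, h4, fun z hz => ?_⟩
      obtain ⟨t, ht⟩ := h5 z hz
      exact ⟨-t, ht⟩
    · refine Or.inr ⟨h1, fun z => ?_⟩
      have := h2 (-(z + 1))
      rw [neg_neg, show -(-(z + 1) + 1) = z by ring] at this
      tauto

/-! ### Level functions and parents -/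

/-- Each vertex `v` of positive level has a neighbour `par v` one level below. -/
structure IsLevelled (G : SimpleGraph V) (lev : V → ℕ) (par : V → V) : Prop where
  adj : ∀ v, lev v ≠ 0 → G.Adj v (par v)
  lev_par : ∀ v, lev v ≠ 0 → lev (par v) + 1 = lev v

lemma exists_isLevelled_dist (G : SimpleGraph V) (u : V) : ∃ par, IsLevelled G (G.dist u) par := by
  have : ∀ v, ∃ w, G.dist u v ≠ 0 → G.Adj v w ∧ G.dist u w + 1 = G.dist u v := by
    intro v
    by_cases hv : G.dist u v = 0
    · exact ⟨v, fun h => absurd hv h⟩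
    · have hr : G.Reachable u v := Reachable.of_dist_ne_zero hv
      obtain ⟨p, hp⟩ := hr.exists_walk_length_eq_dist
      have hnil : ¬ p.Nil := by
        intro h
        rw [← Walk.length_eq_zero_iff] at h
        omega
      refine ⟨p.penultimate, fun _ => ⟨(p.adj_penultimate hnil).symm, ?_⟩⟩
      have h1 : G.dist u p.penultimate ≤ p.dropLast.length := dist_le _
      have h2 : G.dist u v ≤ G.dist u p.penultimate + 1 := by
        have := (p.adj_penultimate hnil)
        obtain ⟨q, hq⟩ := p.dropLast.reachable.exists_walk_length_eq_dist
        calc G.dist u v ≤ (q.concat this).length := dist_le _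
          _ = _ := by simp [hq]
      have h4 : p.dropLast.length + 1 = p.length := by
        simp only [Walk.length_dropLast]
        omega
      omega
  choose par hpar using this
  exact ⟨par, fun v hv => (hpar v hv).1, fun v hv => (hpar v hv).2⟩

namespace IsLevelled

variable {lev : V → ℕ} {par : V → V}

lemma lev_iterate (h : IsLevelled G lev par) {v : V} {s : ℕ} (hs : s ≤ lev v) :
    lev (par^[s] v) + s = lev v := by
  induction s with
  | zero => rfl
  | succ s ih =>
    have := ih (by omega)
    rw [Function.iterate_succ_apply']
    have := h.lev_par (par^[s] v) (by omega)
    omega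

lemma exists_path (h : IsLevelled G lev par) {v : V} {s : ℕ} (hs : s ≤ lev v) :
    ∃ p : G.Walk v (par^[s] v), p.IsPath ∧ p.length = s ∧
      ∀ z ∈ p.support, ∃ r ≤ s, z = par^[r] v := by
  refine exists_isPath_of_injOn (fun t => par^[t] v) s ?_ ?_
  · intro t ht
    have := h.lev_iterate (show t ≤ lev v by omega)
    simp only [Function.iterate_succ_apply']
    exact h.adj _ (by omega)
  · intro a ha b hb hab
    have h1 := h.lev_iterate (show a ≤ lev v by omega)
    have h2 := h.lev_iterate (show b ≤ lev v by omega)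
    have := congrArg lev hab
    change lev (par^[a] v) = lev (par^[b] v) at this
    omega

lemma exists_path_of_meet (h : IsLevelled G lev par) {a b : V} {j : ℕ} (hab : lev a = lev b)
    (hj : j ≤ lev a) (he : par^[j] a = par^[j] b) (hne : ∀ r < j, par^[r] a ≠ par^[r] b) :
    ∃ p : G.Walk a b, p.IsPath ∧ p.length = 2 * j ∧
      ∀ z ∈ p.support, ∃ r ≤ j, z = par^[r] a ∨ z = par^[r] b := by
  obtain ⟨p, hp, hpl, hps⟩ := h.exists_path hj
  obtain ⟨q, hq, hql, hqs⟩ := h.exists_path (hab ▸ hj)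
  refine ⟨p.append ((q.copy rfl he.symm).reverse), hp.append_of_inter ?_ ?_, ?_, ?_⟩
  · rw [Walk.isPath_reverse_iff]
    simpa using hq
  · intro z hz hz'
    obtain ⟨r, hr, hzr⟩ := hps z hz
    obtain ⟨r', hr', hzr'⟩ := hqs z (by simpa using hz')
    have h1 := h.lev_iterate (hr.trans hj)
    have h2 := h.lev_iterate (hr'.trans (hab ▸ hj))
    have h3 := congrArg lev hzr
    have h4 := congrArg lev hzr'
    obtain rfl : r = r' := by omega
    rcases hr.lt_or_eq with h5 | h5
    · exact absurd (hzr.symm.trans hzr') (hne r h5)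
    · rw [hzr, h5]
  · simp [hpl, hql]
    omega
  · intro z hz
    rw [Walk.mem_support_append_iff] at hz
    rcases hz with hz | hz
    · obtain ⟨r, hr, hzr⟩ := hps z hz
      exact ⟨r, hr, Or.inl hzr⟩
    · obtain ⟨r, hr, hzr⟩ := hqs z (by simpa using hz)
      exact ⟨r, hr, Or.inr hzr⟩

lemma iterate_eq_of_le {a b : V} {r s : ℕ} (hrs : r ≤ s) (he : par^[r] a = par^[r] b) :
    par^[s] a = par^[s] b := by
  obtain ⟨t, rfl⟩ := Nat.exists_eq_add_of_le' hrs
  rw [Function.iterate_add_apply, Function.iterate_add_apply, he]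

/-- A path above a level is closed up by the tree paths from its ends. -/
lemma hasCycleOfLength (h : IsLevelled G lev par) {a b : V} {j : ℕ} (hab : lev a = lev b)
    (hj : j ≤ lev a) (he : par^[j] a = par^[j] b) (hne : ∀ r < j, par^[r] a ≠ par^[r] b)
    (hab' : a ≠ b) (Q : G.Walk a b) (hQ : Q.IsPath) (hlev : ∀ z ∈ Q.support, lev a ≤ lev z) :
    HasCycleOfLength G (Q.length + 2 * j) := by
  obtain ⟨p, hp, hpl, hps⟩ := h.exists_path_of_meet hab hj he hne
  have hj0 : j ≠ 0 := by
    rintro rfl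
    exact hab' he
  refine ⟨a, Q.append p.reverse, hQ.isCycle_append_of_inter (hp.reverse) ?_ ?_, by simp [hpl]⟩
  · intro z hz hz'
    obtain ⟨r, hr, hzr⟩ := hps z (by simpa using hz')
    have h0 := hlev z hz
    rcases hzr with hzr | hzr
    · have := h.lev_iterate (hr.trans hj)
      rw [← hzr] at this
      obtain rfl : r = 0 := by omega
      exact Or.inl hzr
    · have := h.lev_iterate (hr.trans (hab ▸ hj))
      rw [← hzr] at this
      obtain rfl : r = 0 := by omega
      exact Or.inr hzr
  · right
    simp [hpl]
    omega

/-- Two vertices with a common ancestor have a first common ancestor. -/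
lemma exists_first_meet {a b : V} {m : ℕ} (he : par^[m] a = par^[m] b) :
    ∃ j ≤ m, par^[j] a = par^[j] b ∧ ∀ r < j, par^[r] a ≠ par^[r] b := by
  classical
  exact ⟨Nat.find ⟨m, he⟩, Nat.find_min' _ he, Nat.find_spec (⟨m, he⟩ : ∃ m, par^[m] a = par^[m] b),
    fun r hr => Nat.find_min _ hr⟩

end IsLevelled

lemma Reachable.iterate_par_eq {par : V → V} {u v : V} (huv : G.Reachable u v)
    (h : IsLevelled G (G.dist u) par) : par^[G.dist u v] v = u := by
  have h1 := h.lev_iterate (v := v) le_rfl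
  obtain ⟨p, -⟩ := h.exists_path (v := v) le_rfl
  have h2 : G.Reachable u (par^[G.dist u v] v) := huv.trans ⟨p⟩
  exact ((h2.dist_eq_zero_iff).1 (by omega)).symm

/-! ### The Moore bound -/

lemma _root_.HasCycleOfLength.mono {K : SimpleGraph V} (hKG : K ≤ G) {n : ℕ}
    (h : HasCycleOfLength K n) : HasCycleOfLength G n := by
  obtain ⟨v, c, hc, hn⟩ := h
  exact ⟨v, c.mapLe hKG, hc.mapLe hKG, by simpa using hn⟩

/-- The edges of `G` with both ends in `Z`. -/
def within (G : SimpleGraph V) (Z : Finset V) : SimpleGraph V where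
  Adj a b := G.Adj a b ∧ a ∈ Z ∧ b ∈ Z
  symm := ⟨fun _ _ h => ⟨h.1.symm, h.2.2, h.2.1⟩⟩
  loopless := ⟨fun _ h => h.1.ne rfl⟩

lemma within_le (G : SimpleGraph V) (Z : Finset V) : G.within Z ≤ G := fun _ _ h => h.1

lemma IsLevelled.par_unique {par : V → V} {r w a : V} {d : ℕ}
    (h : IsLevelled G (G.dist r) par) (hcyc : ∀ m, HasCycleOfLength G m → 2 * d < m)
    (hw : G.Reachable r w) (haw : G.Adj a w) (hlev : G.dist r a + 1 = G.dist r w)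
    (hd : G.dist r w ≤ d) : a = par w := by
  by_contra hne
  have hl := h.lev_par w (by omega)
  have hadj := h.adj w (by omega)
  have ha : G.Reachable r a := hw.trans haw.symm.reachable
  have hp : G.Reachable r (par w) := hw.trans hadj.reachable
  have h1 := ha.iterate_par_eq h
  have h2 := hp.iterate_par_eq h
  have h3 : G.dist r a = G.dist r (par w) := by omega
  rw [← h3] at h2
  obtain ⟨j, hj, hje, hjm⟩ := IsLevelled.exists_first_meet (h1.trans h2.symm)
  have := hcyc _ (h.hasCycleOfLength h3 hj hje hjm hne (Walk.cons haw (Walk.cons hadj Walk.nil))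
    (by simp [haw.ne, hadj.ne, hne]) (by simp; omega))
  simp at this
  omega

lemma IsLevelled.not_adj {par : V → V} {r a b : V} {d : ℕ}
    (h : IsLevelled G (G.dist r) par) (hcyc : ∀ m, HasCycleOfLength G m → 2 * d < m)
    (ha : G.Reachable r a) (hlev : G.dist r a = G.dist r b)
    (hd : G.dist r a < d) : ¬ G.Adj a b := by
  intro hab
  have hb : G.Reachable r b := ha.trans hab.reachable
  have h1 := ha.iterate_par_eq h
  have h2 := hb.iterate_par_eq h
  rw [← hlev] at h2
  obtain ⟨j, hj, hje, hjm⟩ := IsLevelled.exists_first_meet (h1.trans h2.symm)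
  have := hcyc _ (h.hasCycleOfLength hlev hj hje hjm hab.ne (Walk.cons hab Walk.nil)
    (by simp [hab.ne]) (by simp; omega))
  simp at this
  omega

open Finset Classical in
/-- A graph of minimum degree at least `q + 1` without cycles of length at most `2 * d`
has at least `q ^ d` vertices. -/
lemma pow_le_card_of_le_degree {Z : Finset V} (hZ : Z.Nonempty) {q d : ℕ}
    (hdeg : ∀ v ∈ Z, q + 1 ≤ #{w ∈ Z | G.Adj v w})
    (hcyc : ∀ m, HasCycleOfLength G m → 2 * d < m) : q ^ d ≤ #Z := by
  obtain ⟨r, hr⟩ := hZ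
  set K := G.within Z with hK
  have hKcyc : ∀ m, HasCycleOfLength K m → 2 * d < m := fun m hm =>
    hcyc m (hm.mono (within_le G Z))
  obtain ⟨par, hpar⟩ := exists_isLevelled_dist K r
  let S : ℕ → Finset V := fun j => {v ∈ Z | K.Reachable r v ∧ K.dist r v = j}
  have key : ∀ j ≤ d, q ^ j ≤ #(S j) := by
    intro j
    induction j with
    | zero =>
      intro _
      rw [pow_zero, Nat.one_le_iff_ne_zero, Finset.card_ne_zero]
      exact ⟨r, by simp [S, hr]⟩
    | succ j ih =>
      intro hj
      have h1 : ∀ w ∈ S (j + 1), par w ∈ S j := by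
        intro w hw
        simp only [S, mem_filter] at hw ⊢
        have hl := hpar.lev_par w (by omega)
        have ha := hpar.adj w (by omega)
        exact ⟨ha.2.2, hw.2.1.trans ha.reachable, by omega⟩
      have h2 : ∀ v ∈ S j, q ≤ #{w ∈ S (j + 1) | par w = v} := by
        intro v hv
        simp only [S, mem_filter] at hv
        have hsub : ({w ∈ Z | G.Adj v w} : Finset V) ⊆
            insert (par v) {w ∈ S (j + 1) | par w = v} := by
          intro w hw
          simp only [mem_filter] at hw
          have hvw : K.Adj v w := ⟨hw.2, hv.1, hw.1⟩
          have hwr : K.Reachable r w := hv.2.1.trans hvw.reachable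
          simp only [mem_insert, mem_filter, S]
          have hle1 : K.dist r w ≤ K.dist r v + 1 := by
            obtain ⟨p, hp⟩ := hv.2.1.exists_walk_length_eq_dist
            calc K.dist r w ≤ (p.concat hvw).length := dist_le _
              _ = _ := by simp [hp]
          have hle2 : K.dist r v ≤ K.dist r w + 1 := by
            obtain ⟨p, hp⟩ := hwr.exists_walk_length_eq_dist
            calc K.dist r v ≤ (p.concat hvw.symm).length := dist_le _
              _ = _ := by simp [hp]
          rcases lt_trichotomy (K.dist r w) (K.dist r v) with hlt | heq | hgt
          · left
            exact hpar.par_unique hKcyc hv.2.1 hvw.symm (by omega) (by omega)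
          · exact absurd hvw (hpar.not_adj hKcyc hv.2.1 heq.symm (by omega))
          · right
            refine ⟨⟨hw.1, hwr, by omega⟩, ?_⟩
            exact (hpar.par_unique hKcyc hwr hvw (by omega) (by omega)).symm
        have := (hdeg v hv.1).trans ((card_le_card hsub).trans (card_insert_le _ _))
        omega
      rw [card_eq_sum_card_fiberwise (f := par) (t := S j) h1, pow_succ]
      calc q ^ j * q ≤ #(S j) * q := Nat.mul_le_mul_right _ (ih (by omega))
        _ = ∑ v ∈ S j, q := by simp
        _ ≤ _ := sum_le_sum h2
  exact (key d le_rfl).trans (card_le_card (filter_subset _ _))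

/-! ### Subgraphs of large minimum degree -/

open Finset Classical in
/-- A set of vertices spanning many edges contains a subset spanning a graph of large
minimum degree. -/
lemma exists_subset_le_degree (G : SimpleGraph V) {S : Finset V} (hS : S.Nonempty) {t : ℕ}
    (he : 2 * t * #S ≤ ∑ v ∈ S, #{w ∈ S | G.Adj v w}) :
    ∃ Z ⊆ S, Z.Nonempty ∧ ∀ v ∈ Z, t ≤ #{w ∈ Z | G.Adj v w} := by
  induction hn : #S using Nat.strong_induction_on generalizing S with
  | _ n ih =>
  by_cases hall : ∀ v ∈ S, t ≤ #{w ∈ S | G.Adj v w}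
  · exact ⟨S, Subset.rfl, hS, hall⟩
  push Not at hall
  obtain ⟨v, hv, hvt⟩ := hall
  have hdeg : ∀ w ∈ S.erase v, #{z ∈ S | G.Adj w z} =
      #{z ∈ S.erase v | G.Adj w z} + if G.Adj v w then 1 else 0 := by
    intro w hw
    rw [← insert_erase hv, filter_insert, erase_insert_eq_erase, erase_idem]
    by_cases h : G.Adj v w
    · rw [if_pos h.symm, if_pos h, card_insert_of_notMem (by simp)]
    · rw [if_neg (fun h' => h h'.symm), if_neg h, add_zero]
  have hsum : ∑ w ∈ S.erase v, (if G.Adj v w then 1 else 0) = #{w ∈ S | G.Adj v w} := by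
    rw [← card_filter]
    congr 1
    ext w
    simp only [mem_filter, mem_erase]
    exact ⟨fun h => ⟨h.1.2, h.2⟩, fun h => ⟨⟨h.2.ne', h.1⟩, h.2⟩⟩
  rw [← add_sum_erase _ _ hv, sum_congr rfl hdeg, sum_add_distrib, hsum] at he
  have hcard := card_erase_add_one hv
  have he' : 2 * t * #(S.erase v) ≤ ∑ w ∈ S.erase v, #{z ∈ S.erase v | G.Adj w z} := by
    rw [← hcard, mul_add, mul_one] at he
    omega
  have hne : (S.erase v).Nonempty := by
    rw [nonempty_iff_ne_empty]
    intro h0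
    rw [← hcard] at he
    simp only [h0, sum_empty, card_empty] at he
    omega
  obtain ⟨Z, hZ, hZ'⟩ := ih _ (by omega) hne he' rfl
  exact ⟨Z, hZ.trans (erase_subset _ _), hZ'⟩

open Finset Classical in
lemma exists_subset_le_degree_of_cover [Fintype V] [Nonempty V] {ι : Type*} [Fintype ι] [Nonempty ι]
    (K : ι → SimpleGraph V) (hK : ∀ a b, G.Adj a b → ∃ i, (K i).Adj a b) {t : ℕ}
    (he : t * Fintype.card ι * Fintype.card V ≤ Nat.card G.edgeSet) :
    ∃ i, ∃ Z : Finset V, Z.Nonempty ∧ ∀ v ∈ Z, t ≤ #{w ∈ Z | (K i).Adj v w} := by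
  suffices h : ∃ i, 2 * t * #(univ : Finset V) ≤ ∑ v, #{w | (K i).Adj v w} by
    obtain ⟨i, hi⟩ := h
    obtain ⟨Z, -, hZ⟩ := (K i).exists_subset_le_degree univ_nonempty hi
    exact ⟨i, Z, hZ⟩
  have h1 : ∑ v, #{w | G.Adj v w} = 2 * Nat.card G.edgeSet := by
    rw [Nat.card_eq_fintype_card, ← edgeFinset_card, ← sum_degrees_eq_twice_card_edges]
    refine sum_congr rfl fun v _ => ?_
    rw [← card_neighborFinset_eq_degree, neighborFinset_eq_filter]
  have h2 : ∑ v, #{w | G.Adj v w} ≤ ∑ i, ∑ v, #{w | (K i).Adj v w} := by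
    rw [sum_comm]
    refine sum_le_sum fun v _ => ?_
    refine (card_le_card ?_).trans card_biUnion_le
    intro w hw
    simp only [mem_filter, mem_univ, true_and, mem_biUnion] at hw ⊢
    exact hK v w hw
  by_contra! hcon
  have h3 : ∑ i, ∑ v, #{w | (K i).Adj v w} < ∑ i : ι, 2 * t * #(univ : Finset V) :=
    sum_lt_sum_of_nonempty univ_nonempty fun i _ => hcon i
  simp only [sum_const, smul_eq_mul, card_univ] at h3
  nlinarith

/-! ### Long cycles with a chord -/

/-- `p 0, …, p n` is a path of `G`. -/
structure IsSeqPath (G : SimpleGraph V) (p : ℕ → V) (n : ℕ) : Prop where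
  adj : ∀ t < n, G.Adj (p t) (p (t + 1))
  inj : ∀ s ≤ n, ∀ t ≤ n, p s = p t → s = t

/-- The sequence `p` with its first `s` terms reversed. -/
def rotateSeq (p : ℕ → V) (s : ℕ) : ℕ → V := fun i => if i < s then p (s - 1 - i) else p i

lemma IsSeqPath.rotate {p : ℕ → V} {n s : ℕ} (hp : IsSeqPath G p n) (hsn : s ≤ n)
    (hadj : G.Adj (p 0) (p s)) : IsSeqPath G (rotateSeq p s) n where
  adj t ht := by
    unfold rotateSeq
    by_cases h1 : t + 1 < s
    · rw [if_pos (by omega), if_pos h1]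
      have := (hp.adj (s - 1 - (t + 1)) (by omega)).symm
      rwa [show s - 1 - (t + 1) + 1 = s - 1 - t by omega] at this
    · rw [if_neg h1]
      by_cases h2 : t < s
      · rw [if_pos h2, show s - 1 - t = 0 by omega, show t + 1 = s by omega]
        exact hadj
      · rw [if_neg h2]
        exact hp.adj t ht
  inj a ha b hb hab := by
    unfold rotateSeq at hab
    split_ifs at hab with h1 h2 h2
    · have := hp.inj _ (by omega) _ (by omega) hab
      omega
    · have := hp.inj _ (by omega) _ (by omega) hab
      omega
    · have := hp.inj _ (by omega) _ (by omega) hab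
      omega
    · exact hp.inj _ ha _ hb hab

/-- The sequences obtained from `p` by rotations with pivots of index at most `r`. -/
inductive IsRotation (G : SimpleGraph V) (r : ℕ) (p : ℕ → V) : (ℕ → V) → Prop
  | refl : IsRotation G r p p
  | step {q : ℕ → V} {s : ℕ} : IsRotation G r p q → s ≤ r → G.Adj (q 0) (q s) →
      IsRotation G r p (rotateSeq q s)

lemma IsRotation.isSeqPath {p q : ℕ → V} {n r : ℕ} (h : IsRotation G r p q) (hrn : r ≤ n)
    (hp : IsSeqPath G p n) : IsSeqPath G q n := by
  induction h with
  | refl => exact hp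
  | step _ hs hadj ih => exact ih.rotate (hs.trans hrn) hadj

lemma IsRotation.mem_image {p q : ℕ → V} {r : ℕ} (h : IsRotation G r p q) :
    ∀ i ≤ r, ∃ j ≤ r, q i = p j := by
  induction h with
  | refl => exact fun i hi => ⟨i, hi, rfl⟩
  | step _ hs _ ih =>
    intro i hi
    unfold rotateSeq
    split_ifs
    · exact ih _ (by omega)
    · exact ih i hi

/-- Consecutive vertices of a rotation of `p` are consecutive in `p` unless both of them are
starting vertices of rotations or `p`-neighbours of such. -/
lemma IsRotation.consecutive {p q : ℕ → V} {r : ℕ} {T : V → Prop}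
    (hT : ∀ q, IsRotation G r p q → T (q 0) ∧
      ∀ i < r, (q 0 = p i → T (p (i + 1))) ∧ (q 0 = p (i + 1) → T (p i)))
    (h : IsRotation G r p q) : ∀ i < r,
      (∃ j < r, (q i = p j ∧ q (i + 1) = p (j + 1)) ∨ (q i = p (j + 1) ∧ q (i + 1) = p j)) ∨
      (T (q i) ∧ T (q (i + 1))) := by
  induction h with
  | refl => exact fun i hi => Or.inl ⟨i, hi, Or.inl ⟨rfl, rfl⟩⟩
  | @step q s hq hs hadj ih =>
    intro i hi
    have hs0 : s ≠ 0 := by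
      rintro rfl
      exact hadj.ne rfl
    by_cases h1 : i + 1 < s
    · have := ih (s - 1 - (i + 1)) (by omega)
      rw [show s - 1 - (i + 1) + 1 = s - 1 - i by omega] at this
      unfold rotateSeq
      rw [if_pos (by omega), if_pos h1]
      rcases this with ⟨j, hj, h | h⟩ | h
      · exact Or.inl ⟨j, hj, Or.inr h.symm⟩
      · exact Or.inl ⟨j, hj, Or.inl h.symm⟩
      · exact Or.inr h.symm
    · by_cases h2 : i < s
      · right
        have hnew := hT _ (hq.step hs hadj)
        have hold := hT _ hq
        have hcons := ih (s - 1) (by omega)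
        unfold rotateSeq at hnew ⊢
        rw [if_pos (by omega), show s - 1 - 0 = s - 1 by omega] at hnew
        rw [show s - 1 + 1 = s by omega] at hcons
        rw [if_pos h2, if_neg h1, show s - 1 - i = 0 by omega, show i + 1 = s by omega]
        refine ⟨hold.1, ?_⟩
        rcases hcons with ⟨j, hj, h | h⟩ | h
        · rw [h.2]
          exact (hnew.2 j hj).1 h.1
        · rw [h.2]
          exact (hnew.2 j hj).2 h.1
        · exact h.2
      · unfold rotateSeq
        rw [if_neg h1, if_neg h2]
        exact ih i hi

lemma IsRotation.neighbor {p q : ℕ → V} {r s : ℕ} {T : V → Prop}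
    (hT : ∀ q, IsRotation G r p q → T (q 0) ∧
      ∀ i < r, (q 0 = p i → T (p (i + 1))) ∧ (q 0 = p (i + 1) → T (p i)))
    (h : IsRotation G r p q) (hs : s ≤ r) (hadj : G.Adj (q 0) (q s)) : T (q s) := by
  have hs0 : s ≠ 0 := by
    rintro rfl
    exact hadj.ne rfl
  have hnew := hT _ (h.step hs hadj)
  have hcons := h.consecutive hT (s - 1) (by omega)
  unfold rotateSeq at hnew
  rw [if_pos (by omega), show s - 1 - 0 = s - 1 by omega] at hnew
  rw [show s - 1 + 1 = s by omega] at hcons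
  rcases hcons with ⟨j, hj, h | h⟩ | h
  · rw [h.2]
    exact (hnew.2 j hj).1 h.1
  · rw [h.2]
    exact (hnew.2 j hj).2 h.1
  · exact h.2

lemma IsSeqPath.isCyclicSeq {p : ℕ → V} {r : ℕ} (hp : IsSeqPath G p r)
    (h : G.Adj (p r) (p 0)) : IsCyclicSeq G (fun z : ℤ => p (z % (r + 1)).toNat) (r + 1) := by
  have hpos : (0 : ℤ) < r + 1 := by positivity
  have h0 : ∀ z : ℤ, 0 ≤ z % (r + 1) := fun z => Int.emod_nonneg z hpos.ne'
  have h1 : ∀ z : ℤ, z % (r + 1) < r + 1 := fun z => Int.emod_lt_of_pos z hpos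
  refine ⟨fun a b hab => ?_, fun a b hab => ?_, fun z => ?_⟩
  · have : b % (r + 1) = a % (r + 1) := Int.modEq_iff_dvd.2 hab
    simp only [this]
  · have := hp.inj _ (by have := h1 a; have := h0 a; omega) _
      (by have := h1 b; have := h0 b; omega) hab
    have ha := h0 a
    have hb := h0 b
    exact Int.ModEq.dvd (show b % (r + 1) = a % (r + 1) by omega)
  · have ha := h0 z
    have hb := h1 z
    have hz : (z + 1) % (r + 1) = (z % (r + 1) + 1) % (r + 1) := by
      rw [Int.emod_add_emod]
    by_cases hzr : z % (r + 1) = r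
    · rw [hzr, Int.emod_self] at hz
      rw [hz, hzr]
      exact h
    · rw [Int.emod_eq_of_lt (a := z % (r + 1) + 1) (by omega) (by omega)] at hz
      rw [hz, show (z % (r + 1) + 1).toNat = (z % (r + 1)).toNat + 1 by omega]
      exact hp.adj _ (by omega)

lemma IsSeqPath.cons {p : ℕ → V} {n : ℕ} {w : V} (hp : IsSeqPath G p n) (hw : G.Adj w (p 0))
    (hnot : ∀ i ≤ n, p i ≠ w) :
    IsSeqPath G (fun i => if i = 0 then w else p (i - 1)) (n + 1) where
  adj t ht := by
    rcases t with _ | t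
    · simpa using hw
    · simpa using hp.adj t (by omega)
  inj a ha b hb hab := by
    rcases a with _ | a <;> rcases b with _ | b
    · rfl
    · exact absurd (by simpa using hab.symm) (hnot b (by omega))
    · exact absurd (by simpa using hab) (hnot a (by omega))
    · have := hp.inj a (by omega) b (by omega) (by simpa using hab)
      omega

open Finset Classical in
/-- A graph of large minimum degree without short cycles contains a long cycle with a chord. -/
lemma exists_isCyclicSeq [Finite V] {Z : Finset V} (hZ : Z.Nonempty) {k d : ℕ} (hk : 1 ≤ k)
    (hd : 1 ≤ d) (hdeg : ∀ v ∈ Z, 24 * k ≤ #{w ∈ Z | G.Adj v w})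
    (hcyc : ∀ m, HasCycleOfLength G m → 2 * d < m) :
    ∃ (F : ℤ → V) (n r : ℤ), IsCyclicSeq G F n ∧ 2 ≤ r ∧ r ≤ n - 2 ∧ G.Adj (F 0) (F r) ∧
      2 * (k : ℤ) ^ d < n ∧ ∀ z, F z ∈ Z := by
  have := Fintype.ofFinite V
  set K := G.within Z with hK
  have hKdeg : ∀ v ∈ Z, 24 * k ≤ #{w | K.Adj v w} := by
    intro v hv
    refine (hdeg v hv).trans (card_le_card ?_)
    intro w hw
    simp only [mem_filter] at hw
    simp only [mem_filter, mem_univ, true_and]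
    exact ⟨hw.2, hv, hw.1⟩
  have hKcyc : ∀ m, HasCycleOfLength K m → 2 * d < m := fun m hm =>
    hcyc m (hm.mono (within_le G Z))
  -- a longest path
  let P : ℕ → Prop := fun n => ∃ p, IsSeqPath K p n ∧ p 0 ∈ Z
  have hPb : ∀ n, P n → n ≤ Fintype.card V := by
    rintro n ⟨p, hp, -⟩
    have : #((range (n + 1)).image p) = n + 1 := by
      rw [card_image_of_injOn, card_range]
      intro a ha b hb hab
      simp only [coe_range, Set.mem_Iio] at ha hb
      exact hp.inj a (by omega) b (by omega) hab
    have h2 := card_le_univ ((range (n + 1)).image p)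
    omega
  have hP0 : P 0 := by
    obtain ⟨v, hv⟩ := hZ
    exact ⟨fun _ => v, ⟨fun t ht => by omega, fun s hs t ht _ => by omega⟩, hv⟩
  obtain ⟨n, ⟨p₀, hp₀, hp₀Z⟩, hnmax⟩ : ∃ n, P n ∧ ∀ m, P m → m ≤ n :=
    ⟨Nat.findGreatest P (Fintype.card V), Nat.findGreatest_spec (hPb 0 hP0) hP0,
      fun m hm => Nat.le_findGreatest (hPb m hm) hm⟩
  have hnbr : ∀ p, IsSeqPath K p n → ∀ w, K.Adj (p 0) w → ∃ i ≤ n, p i = w := by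
    intro p hp w hw
    by_contra! hcon
    have := hnmax (n + 1) ⟨_, hp.cons hw.symm hcon, by simpa using hw.2.2⟩
    omega
  -- with a furthest neighbour of the starting vertex
  let R : ℕ → Prop := fun r => ∃ p, IsSeqPath K p n ∧ K.Adj (p 0) (p r)
  have hR : ∃ r ≤ n, R r := by
    have : (univ.filter fun w => K.Adj (p₀ 0) w).Nonempty := by
      rw [← card_pos]
      have := hKdeg _ hp₀Z
      omega
    obtain ⟨w, hw⟩ := this
    simp only [mem_filter, mem_univ, true_and] at hw
    obtain ⟨i, hi, rfl⟩ := hnbr p₀ hp₀ w hw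
    exact ⟨i, hi, p₀, hp₀, hw⟩
  obtain ⟨r, hrn, ⟨p, hp, hpr⟩, hrmax⟩ : ∃ r ≤ n, R r ∧ ∀ m ≤ n, R m → m ≤ r := by
    obtain ⟨r, hr, hRr⟩ := hR
    exact ⟨Nat.findGreatest R n, Nat.findGreatest_le n, Nat.findGreatest_spec hr hRr,
      fun m hm hRm => Nat.le_findGreatest hm hRm⟩
  have hnbr' : ∀ q, IsSeqPath K q n → ∀ w, K.Adj (q 0) w → ∃ i ≤ r, q i = w := by
    intro q hq w hw
    obtain ⟨i, hi, rfl⟩ := hnbr q hq w hw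
    exact ⟨i, hrmax i hi ⟨q, hq, hw⟩, rfl⟩
  have hr0 : r ≠ 0 := by
    rintro rfl
    exact hpr.ne rfl
  -- the starting vertices of the rotations
  set I : Finset V := (range (r + 1)).image p with hI
  have hIcard : #I = r + 1 := by
    rw [hI, card_image_of_injOn, card_range]
    intro a ha b hb hab
    simp only [coe_range, Set.mem_Iio] at ha hb
    exact hp.inj a (by omega) b (by omega) hab
  let U : V → Prop := fun v => ∃ q, IsRotation K r p q ∧ q 0 = v
  let T : V → Prop := fun v => U v ∨ ∃ i < r, (U (p i) ∧ v = p (i + 1)) ∨ (U (p (i + 1)) ∧ v = p i)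
  have hT : ∀ q, IsRotation K r p q → T (q 0) ∧
      ∀ i < r, (q 0 = p i → T (p (i + 1))) ∧ (q 0 = p (i + 1) → T (p i)) := by
    intro q hq
    have hU : U (q 0) := ⟨q, hq, rfl⟩
    refine ⟨Or.inl hU, fun i hi => ⟨fun h => ?_, fun h => ?_⟩⟩
    · exact Or.inr ⟨i, hi, Or.inl ⟨h ▸ hU, rfl⟩⟩
    · exact Or.inr ⟨i, hi, Or.inr ⟨h ▸ hU, rfl⟩⟩
  have hUI : ∀ v, U v → ∃ i ≤ r, v = p i := by
    rintro v ⟨q, hq, rfl⟩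
    exact hq.mem_image 0 (by omega)
  set S : Finset V := I.filter T with hS
  set UF : Finset V := I.filter U with hUF
  have hUS : UF ⊆ S := by
    intro v hv
    simp only [hUF, hS, mem_filter] at hv ⊢
    exact ⟨hv.1, Or.inl hv.2⟩
  have hUne : UF.Nonempty := by
    refine ⟨p 0, ?_⟩
    simp only [hUF, mem_filter]
    exact ⟨mem_image_of_mem _ (by simp), p, IsRotation.refl, rfl⟩
  have hScard : #S ≤ 3 * #UF := by
    set J : Finset ℕ := (range (r + 1)).filter fun i => U (p i) with hJ
    have hJU : #J ≤ #UF := by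
      refine card_le_card_of_injOn p ?_ ?_
      · intro i hi
        simp only [hJ, coe_filter, mem_range, Set.mem_ofPred_eq] at hi
        simp only [hUF, coe_filter, Set.mem_ofPred_eq]
        exact ⟨mem_image_of_mem _ (by simpa using hi.1), hi.2⟩
      · intro a ha b hb hab
        simp only [hJ, coe_filter, mem_range, Set.mem_ofPred_eq] at ha hb
        exact hp.inj a (by omega) b (by omega) hab
    have hsub : S ⊆ (J ∪ (J.image (· + 1) ∪ J.image (· - 1))).image p := by
      intro v hv
      simp only [hS, hI, mem_filter, mem_image, mem_range] at hv
      obtain ⟨⟨m, hm, rfl⟩, hv⟩ := hv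
      have hmem : ∀ i, U (p i) → i ≤ n → i ∈ J := by
        intro i hi hin
        obtain ⟨i', hi', he⟩ := hUI _ hi
        have := hp.inj i hin i' (by omega) he
        simp only [hJ, mem_filter, mem_range]
        exact ⟨by omega, hi⟩
      refine mem_image_of_mem _ ?_
      simp only [mem_union, mem_image]
      rcases hv with hv | ⟨i, hi, ⟨hv, he⟩ | ⟨hv, he⟩⟩
      · exact Or.inl (hmem m hv (by omega))
      · refine Or.inr (Or.inl ⟨i, hmem i hv (by omega), ?_⟩)
        exact (hp.inj m (by omega) (i + 1) (by omega) he).symm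
      · refine Or.inr (Or.inr ⟨i + 1, hmem (i + 1) hv (by omega), ?_⟩)
        exact (hp.inj m (by omega) i (by omega) he).symm
    have h1 := card_le_card hsub
    have h2 : #((J ∪ (J.image (· + 1) ∪ J.image (· - 1))).image p) ≤ #J + (#J + #J) :=
      card_image_le.trans ((card_union_le _ _).trans (Nat.add_le_add_left
        ((card_union_le _ _).trans (Nat.add_le_add card_image_le card_image_le)) _))
    omega
  have hsum : 2 * (4 * k) * #S ≤ ∑ v ∈ S, #{w ∈ S | K.Adj v w} := by
    calc 2 * (4 * k) * #S ≤ 2 * (4 * k) * (3 * #UF) := Nat.mul_le_mul_left _ hScard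
      _ = ∑ v ∈ UF, 24 * k := by
        rw [sum_const, smul_eq_mul]
        ring
      _ ≤ ∑ v ∈ UF, #{w ∈ S | K.Adj v w} := by
        refine sum_le_sum fun v hv => ?_
        simp only [hUF, mem_filter] at hv
        obtain ⟨q, hq, rfl⟩ := hv.2
        have hqp := hq.isSeqPath hrn hp
        have hqZ : q 0 ∈ Z := (hqp.adj 0 (by omega)).2.1
        refine (hKdeg _ hqZ).trans (card_le_card ?_)
        intro w hw
        simp only [mem_filter, mem_univ, true_and] at hw
        obtain ⟨i, hi, rfl⟩ := hnbr' q hqp w hw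
        simp only [hS, mem_filter]
        refine ⟨⟨?_, hq.neighbor hT hi hw⟩, hw⟩
        obtain ⟨j, hj, he⟩ := hq.mem_image i hi
        rw [he]
        exact mem_image_of_mem _ (by simp; omega)
      _ ≤ _ := sum_le_sum_of_subset hUS
  obtain ⟨Z', hZ'S, hZ'ne, hZ'deg⟩ := K.exists_subset_le_degree (hUne.mono hUS) hsum
  have hmoore := pow_le_card_of_le_degree (q := 4 * k - 1) (d := d) hZ'ne
    (fun v hv => by have := hZ'deg v hv; omega) hKcyc
  have hbig : 2 * k ^ d < r + 1 := by
    have h1 : #Z' ≤ r + 1 := hIcard ▸ card_le_card (hZ'S.trans (filter_subset _ _))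
    have h2 : (3 * k) ^ d ≤ (4 * k - 1) ^ d := Nat.pow_le_pow_left (by omega) d
    have h3 : 3 ≤ 3 ^ d := by
      calc 3 = 3 ^ 1 := rfl
        _ ≤ 3 ^ d := Nat.pow_le_pow_right (by omega) hd
    have h4 : 1 ≤ k ^ d := Nat.one_le_pow _ _ (by omega)
    rw [mul_pow] at h2
    have h5 := Nat.mul_le_mul_right (k ^ d) h3
    omega
  have hpZ : ∀ i ≤ n, p i ∈ Z := by
    intro i hi
    rcases hi.lt_or_eq with h | h
    · exact (hp.adj i h).2.1
    · rcases Nat.eq_zero_or_pos n with h0 | h0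
      · obtain rfl : r = 0 := by omega
        exact absurd rfl hpr.ne
      · have := (hp.adj (n - 1) (by omega)).2.2
        rwa [show n - 1 + 1 = i by omega] at this
  -- a chord
  obtain ⟨s, hs2, hsr, hs⟩ : ∃ s, 2 ≤ s ∧ s + 1 ≤ r ∧ K.Adj (p 0) (p s) := by
    have h24 := hKdeg (p 0) (hpZ 0 (by omega))
    by_contra! hcon
    have hsub : (univ.filter fun w => K.Adj (p 0) w) ⊆ {p 1, p r} := by
      intro w hw
      simp only [mem_filter, mem_univ, true_and] at hw
      obtain ⟨i, hi, rfl⟩ := hnbr' p hp w hw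
      have h0 : i ≠ 0 := by
        rintro rfl
        exact hw.ne rfl
      have := hcon i
      rcases Nat.lt_or_ge i 2 with h | h
      · obtain rfl : i = 1 := by omega
        simp
      · rcases hi.lt_or_eq with h' | h'
        · exact absurd hw (hcon i h (by omega))
        · simp [h']
    have := (card_le_card hsub).trans card_le_two
    omega
  have hcs : IsCyclicSeq K _ _ := IsSeqPath.isCyclicSeq
    (⟨fun t ht => hp.adj t (by omega), fun s hs t ht => hp.inj s (by omega) t (by omega)⟩ :
      IsSeqPath K p r) hpr.symm
  refine ⟨_, _, s, ⟨hcs.eq_of_dvd, hcs.dvd_of_eq, fun z => (hcs.adj z).1⟩, by omega, by omega,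
    ?_, by exact_mod_cast hbig, fun z => (hcs.adj z).2.1⟩
  rw [Int.emod_eq_of_lt (by omega) (by omega : (s : ℤ) < r + 1)]
  exact hs.1

/-! ### A shortest odd cycle through a root -/

lemma _root_.TwoConnected.connected [Fintype V] (h : TwoConnected G) : G.Connected := by
  classical
  have hcard := h.1
  have : Nonempty V := Fintype.card_pos_iff.1 (by omega)
  refine ⟨fun a b => ?_⟩
  obtain ⟨p, hp⟩ : ∃ p, p ∉ ({a, b} : Finset V) := by
    by_contra! hcon
    have h1 := Finset.card_le_card (fun x _ => hcon x : (Finset.univ : Finset V) ⊆ {a, b})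
    have h2 : ({a, b} : Finset V).card ≤ 2 := Finset.card_le_two
    rw [Finset.card_univ] at h1
    omega
  simp only [Finset.mem_insert, Finset.mem_singleton, not_or] at hp
  have h1 : (G.induce ({p}ᶜ : Set V)).Reachable ⟨a, Ne.symm hp.1⟩ ⟨b, Ne.symm hp.2⟩ :=
    (h.2 p).preconnected _ _
  exact h1.map (Embedding.induce _).toHom

lemma Connected.dist_le_dist_add_one (hG : G.Connected) {a b : V} (h : G.Adj a b) (u : V) :
    G.dist u b ≤ G.dist u a + 1 := by
  have h1 := hG.dist_triangle (u := u) (v := a) (w := b)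
  rwa [dist_eq_one_iff_adj.2 h] at h1

lemma Connected.exists_adj_dist_eq (hG : G.Connected) (hc : ¬ G.Colorable 2) (u : V) :
    ∃ v w, G.Adj v w ∧ G.dist u v = G.dist u w := by
  by_contra! hcon
  refine hc ?_
  let C : G.Coloring Bool := Coloring.mk (fun v => decide (Even (G.dist u v))) (by
    intro a b hab he
    have h0 := hcon a b hab
    have h1 := hG.dist_le_dist_add_one hab u
    have h2 := hG.dist_le_dist_add_one hab.symm u
    have h3 : Even (G.dist u a) ↔ Even (G.dist u b) := by simpa using he
    rw [Nat.even_iff, Nat.even_iff] at h3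
    omega)
  simpa using C.colorable

/-- Some vertex `u` lies on an odd cycle formed by an edge and the tree paths of its ends,
whichever way the tree is chosen. -/
lemma Connected.exists_root (hG : G.Connected) (hc : ¬ G.Colorable 2) :
    ∃ u v w, G.Adj v w ∧ G.dist u v = G.dist u w ∧ 1 ≤ G.dist u v ∧
      ∀ par, IsLevelled G (G.dist u) par → ∀ s < G.dist u v, par^[s] v ≠ par^[s] w := by
  classical
  let P : ℕ → Prop := fun l => ∃ u v w, G.Adj v w ∧ G.dist u v = l ∧ G.dist u w = l
  have hP : ∃ l, P l := by
    obtain ⟨u⟩ := hG.nonempty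
    obtain ⟨v, w, h, he⟩ := hG.exists_adj_dist_eq hc u
    exact ⟨_, u, v, w, h, rfl, he.symm⟩
  obtain ⟨u, v, w, h, hv, hw⟩ := Nat.find_spec hP
  refine ⟨u, v, w, h, hv.trans hw.symm, ?_, ?_⟩
  · by_contra! h0
    have h1 : u = v := hG.dist_eq_zero_iff.1 (by omega)
    have h2 : u = w := hG.dist_eq_zero_iff.1 (by omega)
    exact h.ne (h1.symm.trans h2)
  · intro par hpar s hs he
    have key : ∀ z, G.dist u z = Nat.find hP → G.dist (par^[s] z) z = s := by
      intro z hz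
      have h1 := hpar.lev_iterate (v := z) (s := s) (by omega)
      obtain ⟨p, -, hpl, -⟩ := hpar.exists_path (v := z) (s := s) (by omega)
      have h2 := dist_le p.reverse
      rw [Walk.length_reverse, hpl] at h2
      have h3 := hG.dist_triangle (u := u) (v := par^[s] z) (w := z)
      omega
    exact Nat.find_min hP (by omega : s < Nat.find hP)
      ⟨par^[s] v, v, w, h, key v hv, by rw [he]; exact key w hw⟩

variable {K : SimpleGraph V} {lev : V → ℕ} {par : V → V}

/-! ### Cycles in one or two levels -/

lemma exists_least_iterate_const (par : V → V) (A : Set V) {m : ℕ}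
    (h : ∀ a ∈ A, ∀ b ∈ A, par^[m] a = par^[m] b) :
    ∃ j ≤ m, (∀ a ∈ A, ∀ b ∈ A, par^[j] a = par^[j] b) ∧
      ∀ s < j, ∃ a ∈ A, ∃ b ∈ A, par^[s] a ≠ par^[s] b := by
  classical
  let P : ℕ → Prop := fun j => ∀ a ∈ A, ∀ b ∈ A, par^[j] a = par^[j] b
  have hP : ∃ j, P j := ⟨m, h⟩
  refine ⟨Nat.find hP, Nat.find_min' hP h, Nat.find_spec hP, fun s hs => ?_⟩
  have := Nat.find_min hP hs
  simp only [P] at this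
  push Not at this
  exact this

/-- Cycles through a level. -/
lemma IsLevelled.hasConsecutiveOddCycles_of_level (h : IsLevelled G lev par) {u : V}
    (hroot : ∀ v, par^[lev v] v = u) {F : ℤ → V} {n r : ℤ} (hF : IsCyclicSeq G F n) (hr : 2 ≤ r)
    (hrn : r ≤ n - 2) (hch : G.Adj (F 0) (F r)) {N : ℕ} (hN : 2 * (N : ℤ) < n) {i : ℕ}
    (hi : ∀ z, lev (F z) = i) : HasConsecutiveOddCycles G N := by
  obtain ⟨j, hji, hj, hmin⟩ := exists_least_iterate_const par (Set.range F) (m := i) (by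
    rintro _ ⟨a, rfl⟩ _ ⟨b, rfl⟩
    have h1 := hroot (F a)
    have h2 := hroot (F b)
    rw [hi] at h1 h2
    rw [h1, h2])
  have hj0 : j ≠ 0 := by
    rintro rfl
    exact (hF.adj 0).ne (hj _ ⟨0, rfl⟩ _ ⟨_, rfl⟩)
  obtain ⟨_, ⟨a, rfl⟩, _, ⟨b, rfl⟩, hab⟩ := hmin (j - 1) (by omega)
  refine ⟨1 + 2 * j, by simp [parity_simps], fun m hm => ?_⟩
  obtain ⟨a', b', Q, hQ, hQl, ha', hb', hQs⟩ | ⟨he, -⟩ := hF.exists_path hr hrn hch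
    (fun z => par^[j - 1] z = par^[j - 1] (F a)) ⟨a, b, rfl, hab.symm⟩ (ℓ := 2 * m + 1)
    (by omega) (by push_cast; omega)
  · have hne : ∀ r < j, par^[r] (F a') ≠ par^[r] (F b') := by
      intro r hr he
      exact hb' ((iterate_eq_of_le (by omega) he).symm.trans ha')
    have := h.hasCycleOfLength (by rw [hi, hi]) (by rw [hi]; exact hji)
      (hj _ ⟨a', rfl⟩ _ ⟨b', rfl⟩) hne (hne 0 (by omega)) Q hQ (by
        intro z hz
        obtain ⟨t, rfl⟩ := hQs z hz
        rw [hi, hi])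
    rw [hQl] at this
    convert this using 1
    ring
  · exact absurd he (by simp [parity_simps])

/-- An ear of the right parity, starting at the lowest vertex `x` of `S`. -/
lemma IsLevelled.exists_odd_ear (h : IsLevelled G lev par) {u : V}
    (hroot : ∀ v, par^[lev v] v = u) (hG : ∀ p, (G.induce ({p}ᶜ : Set V)).Connected)
    {v w : V} (hvw : G.Adj v w) (hlev : lev v = lev w) (hv : 1 ≤ lev v)
    (hne : ∀ s < lev v, par^[s] v ≠ par^[s] w) {S : Set V} {x : V}
    (hxS : ∃ y ∈ S, y ≠ x) (hw : ∀ s < lev v, par^[s] w ∉ S)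
    (hanc : ∀ s ≤ lev v, par^[s] v ∈ S → ∃ t ≤ lev (par^[s] v), x = par^[t] (par^[s] v))
    (hlow : ∀ y ∈ S, lev x ≤ lev y) :
    ∃ y ∈ S, y ≠ x ∧ ∃ E : G.Walk x y, E.IsPath ∧ (∀ z ∈ E.support, z ∈ S → z = x ∨ z = y) ∧
      Odd (E.length + lev x + lev y) := by
  classical
  have hlevu : ∀ z, lev z = 0 → z = u := by
    intro z hz
    have := hroot z
    rwa [hz] at this
  obtain ⟨P, hP, hPl, hPs⟩ := h.exists_path (v := x) le_rfl
  have hPS : ∀ z ∈ P.support, z ∈ S → z = x := by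
    intro z hz hzS
    obtain ⟨r, hr, rfl⟩ := hPs z hz
    have h1 := h.lev_iterate hr
    have h2 := hlow _ hzS
    obtain rfl : r = 0 := by omega
    rfl
  obtain ⟨W, hW, hWl, hWs⟩ := h.exists_path (v := w) le_rfl
  have hwu : par^[lev v] w = u := by rw [hlev, hroot]
  by_cases hmeet : ∃ s ≤ lev v, par^[s] v ∈ S ∧ par^[s] v ≠ x
  · obtain ⟨s, ⟨hsl, hsS, hsx⟩, hsmin⟩ : ∃ s, (s ≤ lev v ∧ par^[s] v ∈ S ∧ par^[s] v ≠ x) ∧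
        ∀ r < s, ¬ (r ≤ lev v ∧ par^[r] v ∈ S ∧ par^[r] v ≠ x) :=
      ⟨Nat.find hmeet, Nat.find_spec hmeet, fun r hr => Nat.find_min hmeet hr⟩
    obtain ⟨t, ht, htx⟩ := hanc s hsl hsS
    have hls := h.lev_iterate hsl
    have hlx := h.lev_iterate ht
    rw [← htx] at hlx
    have ht0 : t ≠ 0 := by
      rintro rfl
      exact hsx htx.symm
    obtain ⟨Q, hQ, hQl, hQs⟩ := h.exists_path hsl
    have hxv : ∀ r, par^[r] x = par^[r + t + s] v := by
      intro r
      rw [Function.iterate_add_apply, Function.iterate_add_apply, ← htx]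
    have hWP : ∀ z ∈ P.support, z ∈ W.support → z = u := by
      intro z hz hz'
      obtain ⟨r, hr, rfl⟩ := hPs z hz
      obtain ⟨r', hr', he⟩ := hWs _ hz'
      have h1 := h.lev_iterate hr
      have h2 := h.lev_iterate hr'
      rw [← he] at h2
      rw [hxv] at he
      by_cases hlt : r' < lev v
      · exact absurd (by rw [← he]; congr 1; omega) (hne r' hlt)
      · exact hlevu _ (by omega)
    have hQW : ∀ z ∈ Q.support, z ∉ W.support := by
      intro z hz hz'
      obtain ⟨r, hr, rfl⟩ := hQs z hz
      obtain ⟨r', hr', he⟩ := hWs _ hz'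
      have h1 := h.lev_iterate (hr.trans hsl)
      have h2 := h.lev_iterate hr'
      rw [← he] at h2
      obtain rfl : r = r' := by omega
      exact hne r (by omega) he
    have hQP : ∀ z ∈ Q.support, z ∉ P.support := by
      intro z hz hz'
      obtain ⟨r, hr, rfl⟩ := hQs z hz
      obtain ⟨r', hr', he⟩ := hPs _ hz'
      have h1 := h.lev_iterate (hr.trans hsl)
      have h2 := h.lev_iterate hr'
      rw [← he] at h2
      omega
    have hEP : ((P.copy rfl (hroot x)).append (W.copy rfl (hroot w)).reverse).IsPath := by
      refine Walk.IsPath.append_of_inter (by simpa using hP)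
        ((by simpa using hW : (W.copy rfl (hroot w)).IsPath).reverse) ?_
      intro z hz hz'
      exact hWP z (by simpa using hz) (by simpa using hz')
    have hQc : (Walk.cons hvw.symm Q).IsPath := by
      refine hQ.cons fun hm => hQW w hm (Walk.start_mem_support _)
    refine ⟨_, hsS, hsx, _, hEP.append_of_inter hQc ?_, ?_, ?_⟩
    · intro z hz hz'
      rw [Walk.support_cons, List.mem_cons] at hz'
      rcases hz' with rfl | hz'
      · rfl
      · rw [Walk.mem_support_append_iff] at hz
        rcases hz with hz | hz
        · exact absurd (by simpa using hz) (hQP z hz')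
        · exact absurd (by simpa using hz) (hQW z hz')
    · intro z hz hzS
      have hzW : z ∈ W.support → z = x ∨ z = par^[s] v := by
        intro hz
        obtain ⟨r', hr', rfl⟩ := hWs _ hz
        have h2 := h.lev_iterate hr'
        by_cases hlt : r' < lev v
        · exact absurd hzS (hw r' hlt)
        · have h3 := hlow _ hzS
          left
          rw [hlevu x (by omega), hlevu (par^[r'] w) (by omega)]
      rw [Walk.mem_support_append_iff, Walk.mem_support_append_iff, Walk.support_cons,
        List.mem_cons] at hz
      rcases hz with (hz | hz) | rfl | hz
      · exact Or.inl (hPS z (by simpa using hz) hzS)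
      · exact hzW (by simpa using hz)
      · exact hzW (Walk.start_mem_support _)
      · obtain ⟨r, hr, rfl⟩ := hQs z hz
        rcases hr.lt_or_eq with hr | rfl
        · left
          by_contra hx
          exact hsmin r hr ⟨by omega, hzS, hx⟩
        · exact Or.inr rfl
    · simp only [Walk.length_append, Walk.length_reverse, Walk.length_copy, Walk.length_cons, hPl,
        hQl, hWl]
      exact ⟨lev x + lev v, by omega⟩
  · push Not at hmeet
    obtain ⟨p, hp, hpl, hps⟩ := h.exists_path_of_meet hlev le_rfl
      ((hroot v).trans (hlev ▸ hroot w).symm) hne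
    have hD : (Walk.cons hvw.symm p).IsCycle := by
      refine Walk.IsPath.isCycle_append_of_inter (p := Walk.cons hvw.symm Walk.nil)
        (by simp [hvw.ne']) hp ?_ ?_
      · intro z hz _
        simpa using hz
      · right
        omega
    have hDY : ∀ z ∈ (Walk.cons hvw.symm p).support, z ∉ S \ {x} := by
      intro z hz hzY
      have hz' : z ∈ p.support := by
        rw [Walk.support_cons, List.mem_cons] at hz
        rcases hz with rfl | hz
        · exact Walk.end_mem_support _
        · exact hz
      obtain ⟨r, hr, rfl | rfl⟩ := hps z hz'
      · exact hzY.2 (hmeet r hr hzY.1)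
      · rcases hr.lt_or_eq with hr | rfl
        · exact hw r hr hzY.1
        · rw [hwu, ← hroot v] at hzY
          exact hzY.2 (hmeet _ le_rfl hzY.1)
    have hPY : ∀ z ∈ ((P.copy rfl (hroot x)).append (W.copy rfl (hroot w)).reverse).support,
        z ∉ S \ {x} := by
      intro z hz hzY
      rw [Walk.mem_support_append_iff] at hz
      rcases hz with hz | hz
      · exact hzY.2 (hPS z (by simpa using hz) hzY.1)
      · obtain ⟨r, hr, rfl⟩ := hWs z (by simpa using hz)
        rw [← hlev] at hr
        rcases hr.lt_or_eq with hr | rfl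
        · exact hw r hr hzY.1
        · rw [hwu, ← hroot v] at hzY
          exact hzY.2 (hmeet _ le_rfl hzY.1)
    obtain ⟨y, hy, E, hE, hEY, hodd⟩ := exists_odd_parity_path hG (x := x) (Y := S \ {x}) hxS lev
      (Walk.cons hvw.symm p) ((P.copy rfl (hroot x)).append (W.copy rfl (hroot w)).reverse) hD
      (by simp [hpl, parity_simps]) hDY hPY
    refine ⟨y, hy.1, hy.2, E, hE, fun z hz hzS => ?_, hodd⟩
    by_cases hzx : z = x
    · exact Or.inl hzx
    · exact Or.inr (hEY z hz ⟨hzS, hzx⟩)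

lemma Walk.even_length_add_of_adj_odd (hK : ∀ a b, K.Adj a b → Odd (lev a + lev b)) {a b : V}
    (p : K.Walk a b) : Even (p.length + lev a + lev b) := by
  induction p with
  | nil => simp [parity_simps]
  | cons hab p ih =>
    have := hK _ _ hab
    rw [Walk.length_cons]
    rw [Nat.even_iff] at ih ⊢
    rw [Nat.odd_iff] at this
    omega

/-- Cycles through two consecutive levels. -/
lemma IsLevelled.hasConsecutiveOddCycles_of_two_levels (h : IsLevelled G lev par) {u : V}
    (hroot : ∀ v, par^[lev v] v = u) (hG : ∀ p, (G.induce ({p}ᶜ : Set V)).Connected)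
    {v w : V} (hvw : G.Adj v w) (hlev : lev v = lev w) (hv : 1 ≤ lev v)
    (hne : ∀ s < lev v, par^[s] v ≠ par^[s] w)
    (hKG : K ≤ G) (hK : ∀ a b, K.Adj a b → Odd (lev a + lev b))
    {F : ℤ → V} {n r : ℤ} (hF : IsCyclicSeq K F n) (hr : 2 ≤ r)
    (hrn : r ≤ n - 2) (hch : K.Adj (F 0) (F r)) {N : ℕ} (hN : 2 * (N : ℤ) < n) {i : ℕ}
    (hi : ∀ z, lev (F z) = i ∨ lev (F z) = i + 1)
    (hA : ∀ z, lev (F z) = i → par^[i - 1] (F z) ≠ par^[lev v - 1] w)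
    (hB : ∀ z, lev (F z) = i + 1 → ∀ s ≤ lev v, F z ≠ par^[s] v ∧ F z ≠ par^[s] w) :
    HasConsecutiveOddCycles G N := by
  have halt : ∀ z, lev (F z) = i ↔ lev (F (z + 1)) ≠ i := by
    intro z
    have h1 := hK _ _ (hF.adj z)
    rw [Nat.odd_iff] at h1
    rcases hi z with h2 | h2 <;> rcases hi (z + 1) with h3 | h3 <;> omega
  obtain ⟨a₀, ha₀⟩ : ∃ z, lev (F z) = i := by
    by_cases h0 : lev (F 0) = i
    · exact ⟨0, h0⟩
    · by_contra! hcon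
      exact h0 ((halt 0).2 (hcon _))
  have ha₂ : lev (F (a₀ + 1 + 1)) = i := by
    by_contra hcon
    exact (halt a₀).1 ha₀ ((halt (a₀ + 1)).2 hcon)
  obtain ⟨j, hji, hj, hmin⟩ := exists_least_iterate_const par {y | ∃ z, y = F z ∧ lev y = i}
    (m := i) (by
      rintro _ ⟨a, rfl, ha⟩ _ ⟨b, rfl, hb⟩
      have h1 := hroot (F a)
      have h2 := hroot (F b)
      rw [ha] at h1
      rw [hb] at h2
      rw [h1, h2])
  have hj0 : j ≠ 0 := by
    rintro rfl
    have := hF.dvd_of_eq _ _ (hj _ ⟨_, rfl, ha₂⟩ _ ⟨_, rfl, ha₀⟩)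
    have := Int.le_of_dvd (by omega) this
    omega
  obtain ⟨x, hx⟩ : ∃ x, x = par^[j] (F a₀) := ⟨_, rfl⟩
  have hxj : ∀ z, lev (F z) = i → par^[j] (F z) = x := fun z hz =>
    (hj _ ⟨z, rfl, hz⟩ _ ⟨a₀, rfl, ha₀⟩).trans hx.symm
  have hxlev : lev x + j = i := by
    rw [hx, ← ha₀]
    exact h.lev_iterate (by omega)
  let S : Set V := {y | (∃ z, y = F z) ∨ ∃ z, lev (F z) = i ∧ ∃ s ≤ j, y = par^[s] (F z)}
  -- the tree path from a lower vertex of the cycle to `x`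
  have htree : ∀ z, lev (F z) = i → ∀ s ≤ j, ∃ p : G.Walk (F z) (par^[s] (F z)),
      p.IsPath ∧ p.length = s ∧ (∀ y ∈ p.support, y ∈ S ∧ ∃ r ≤ s, y = par^[r] (F z)) := by
    intro z hz s hs
    obtain ⟨p, hp, hpl, hps⟩ := h.exists_path (v := F z) (s := s) (by omega)
    refine ⟨p, hp, hpl, fun y hy => ⟨?_, hps y hy⟩⟩
    obtain ⟨r, hr, rfl⟩ := hps y hy
    exact Or.inr ⟨z, hz, r, by omega, rfl⟩
  have hScase : ∀ y ∈ S, (∃ z, lev (F z) = i + 1 ∧ y = F z) ∨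
      ∃ z, lev (F z) = i ∧ ∃ s ≤ j, y = par^[s] (F z) ∧ lev y + s = i := by
    rintro y (⟨z, rfl⟩ | ⟨z, hz, s, hs, rfl⟩)
    · rcases hi z with hz | hz
      · exact Or.inr ⟨z, hz, 0, by omega, rfl, hz⟩
      · exact Or.inl ⟨z, hz, rfl⟩
    · exact Or.inr ⟨z, hz, s, hs, rfl, hz ▸ h.lev_iterate (by omega)⟩
  have hne1 : ∃ y ∈ S, y ≠ x := by
    refine ⟨F a₀, Or.inl ⟨_, rfl⟩, fun he => ?_⟩
    rw [he] at ha₀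
    omega
  have hw : ∀ s < lev v, par^[s] w ∉ S := by
    intro s hs hmem
    have h1 := h.lev_iterate (show s ≤ lev w by omega)
    rcases hScase _ hmem with ⟨z, hz, he⟩ | ⟨z, hz, t, ht, he, hlt⟩
    · exact (hB z hz s hs.le).2 he.symm
    · refine hA z hz ?_
      rw [show lev v - 1 = lev v - 1 - s + s by omega, Function.iterate_add_apply, he,
        ← Function.iterate_add_apply]
      congr 1
      omega
  have hanc : ∀ s ≤ lev v, par^[s] v ∈ S →
      ∃ t ≤ lev (par^[s] v), x = par^[t] (par^[s] v) := by
    intro s hs hmem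
    rcases hScase _ hmem with ⟨z, hz, he⟩ | ⟨z, hz, t, ht, he, hlt⟩
    · exact absurd he.symm (hB z hz s hs).1
    · refine ⟨j - t, by omega, ?_⟩
      rw [he, ← Function.iterate_add_apply, show j - t + t = j by omega, hxj z hz]
  have hlow : ∀ y ∈ S, lev x ≤ lev y := by
    intro y hy
    rcases hScase _ hy with ⟨z, hz, rfl⟩ | ⟨z, hz, t, ht, he, hlt⟩ <;> omega
  obtain ⟨y, hyS, hyx, E, hE, hES, hodd⟩ := h.exists_odd_ear hroot hG hvw hlev hv hne hne1 hw
    hanc hlow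
  have hclose : ∀ R : G.Walk y x, R.IsPath → (∀ z ∈ R.support, z ∈ S) → 1 < R.length →
      HasCycleOfLength G (E.length + R.length) := by
    intro R hR hRS hRl
    exact ⟨x, E.append R, hE.isCycle_append_of_inter hR
      (fun z hz hz' => hES z hz (hRS z hz')) (Or.inr hRl), by simp⟩
  rcases hScase y hyS with ⟨b, hb, rfl⟩ | ⟨a, ha, s, hsj, rfl, hsl⟩
  · refine ⟨E.length + 1 + j, ?_, fun m hm => ?_⟩
    · rw [Nat.odd_iff] at hodd ⊢
      omega
    obtain ⟨a', b', Q, hQ, hQl, ha', hb', hQs⟩ | ⟨he, -⟩ := hF.exists_path hr hrn hch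
      (fun z => z = F b) ⟨b, a₀, rfl, fun he => by rw [he] at ha₀; omega⟩ (ℓ := 2 * m + 1)
      (by omega) (by push_cast; omega)
    · have hpar := Q.even_length_add_of_adj_odd hK
      have hbi : lev (F b') = i := by
        have hla : lev (F a') = i + 1 := by rw [ha', hb]
        rw [hQl, Nat.even_iff] at hpar
        rcases hi b' with h1 | h1 <;> omega
      obtain ⟨p, hp, hpl, hps⟩ := htree b' hbi j le_rfl
      have hR : ((Q.mapLe hKG).append p).IsPath := by
        refine (hQ.mapLe hKG).append_of_inter hp ?_
        intro z hz hz'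
        obtain ⟨t, rfl⟩ := hQs z (by simpa using hz)
        obtain ⟨r, hr, he⟩ := (hps _ hz').2
        have h1 := h.lev_iterate (v := F b') (s := r) (by omega)
        rw [← he] at h1
        obtain rfl : r = 0 := by rcases hi t with h2 | h2 <;> omega
        exact he
      have := hclose (((Q.mapLe hKG).append p).copy ha' (hxj b' hbi)) (by simpa using hR) ?_ ?_
      · simp only [Walk.length_copy, Walk.length_append, Walk.length_mapLe, hQl, hpl] at this
        convert this using 1
        ring
      · intro z hz
        rw [Walk.support_copy, Walk.mem_support_append_iff] at hz
        rcases hz with hz | hz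
        · exact Or.inl (hQs z (by simpa using hz))
        · exact (hps z hz).1
      · simp [hQl, hpl]
        omega
    · exact absurd he (by simp [parity_simps])
  · have hsj' : s < j := by
      rcases hsj.lt_or_eq with h1 | rfl
      · exact h1
      · exact absurd (hxj a ha) hyx
    obtain ⟨a₁, ha₁, hne₁⟩ : ∃ z, lev (F z) = i ∧ par^[s] (F z) ≠ par^[s] (F a) := by
      obtain ⟨_, ⟨c, rfl, hc⟩, _, ⟨c', rfl, hc'⟩, hcc⟩ := hmin s hsj'
      by_cases h1 : par^[s] (F c) = par^[s] (F a)
      · exact ⟨c', hc', fun h2 => hcc (h1.trans h2.symm)⟩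
      · exact ⟨c, hc, h1⟩
    refine ⟨E.length + 2 + s + j, ?_, fun m hm => ?_⟩
    · rw [Nat.odd_iff] at hodd ⊢
      omega
    obtain ⟨a', b', Q, hQ, hQl, ha', hb', hQs⟩ | ⟨-, hal⟩ := hF.exists_path hr hrn hch
      (fun z => lev z = i ∧ par^[s] z = par^[s] (F a)) ⟨a, a₁, ⟨ha, rfl⟩, fun he => hne₁ he.2⟩
      (ℓ := 2 * m + 2) (by omega) (by push_cast; omega)
    · have hpar := Q.even_length_add_of_adj_odd hK
      have hbi : lev (F b') = i := by
        rw [ha'.1, hQl, Nat.even_iff] at hpar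
        rcases hi b' with h1 | h1 <;> omega
      have hbs : par^[s] (F b') ≠ par^[s] (F a) := fun he => hb' ⟨hbi, he⟩
      obtain ⟨p, hp, hpl, hps⟩ := htree b' hbi j le_rfl
      obtain ⟨q, hq, hql, hqs⟩ := htree a' ha'.1 s hsj
      have hqQ : (q.reverse.append (Q.mapLe hKG)).IsPath := by
        refine hq.reverse.append_of_inter (hQ.mapLe hKG) ?_
        intro z hz' hz
        obtain ⟨t, rfl⟩ := hQs z (by simpa using hz)
        obtain ⟨r, hr, he⟩ := (hqs _ (by simpa using hz')).2
        have h1 := h.lev_iterate (v := F a') (s := r) (by omega)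
        rw [← he] at h1
        obtain rfl : r = 0 := by rcases hi t with h2 | h2 <;> omega
        exact he
      have hR : ((q.reverse.append (Q.mapLe hKG)).append p).IsPath := by
        refine hqQ.append_of_inter hp ?_
        intro z hz hz'
        obtain ⟨r, hr, he⟩ := (hps _ hz').2
        have h1 := h.lev_iterate (v := F b') (s := r) (by omega)
        rw [← he] at h1
        rw [Walk.mem_support_append_iff] at hz
        rcases hz with hz | hz
        · obtain ⟨r', hr', he'⟩ := (hqs _ (by simpa using hz)).2
          have h2 := h.lev_iterate (v := F a') (s := r') (by omega)
          rw [← he'] at h2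
          obtain rfl : r = r' := by omega
          exact absurd ((iterate_eq_of_le hr' (he.symm.trans he')).trans ha'.2) hbs
        · obtain ⟨t, rfl⟩ := hQs z (by simpa using hz)
          obtain rfl : r = 0 := by rcases hi t with h2 | h2 <;> omega
          exact he
      have := hclose (((q.reverse.append (Q.mapLe hKG)).append p).copy ha'.2 (hxj b' hbi))
        (by simpa using hR) ?_ ?_
      · simp only [Walk.length_copy, Walk.length_append, Walk.length_mapLe, Walk.length_reverse,
          hQl, hpl, hql] at this
        convert this using 1
        ring
      · intro z hz
        rw [Walk.support_copy, Walk.mem_support_append_iff, Walk.mem_support_append_iff] at hz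
        rcases hz with (hz | hz) | hz
        · exact (hqs z (by simpa using hz)).1
        · exact Or.inl (hQs z (by simpa using hz))
        · exact (hps z hz).1
      · simp [hQl, hpl, hql]
        omega
    · by_contra
      have h1 : lev (F (a₁ + 1)) = i := by
        by_contra hcon
        exact hne₁ ((hal a₁).2 fun h2 => hcon h2.1).2
      exact (halt a₁).1 ha₁ h1

/-! ### Classes of edges -/

lemma IsCyclicSeq.mono {F : ℤ → V} {n : ℤ} (hKG : K ≤ G) (h : IsCyclicSeq K F n) :
    IsCyclicSeq G F n :=
  ⟨h.eq_of_dvd, h.dvd_of_eq, fun z => hKG (h.adj z)⟩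

lemma _root_.Int.apply_eq_apply_zero_of_forall_add_one {α : Type*} {f : ℤ → α}
    (h : ∀ z, f z = f (z + 1)) (z : ℤ) : f z = f 0 := by
  induction z using Int.induction_on with
  | zero => rfl
  | succ i ih => rw [← h, ih]
  | pred i ih =>
    rw [h]
    simpa using ih

/-- The edges within a level. -/
def levelEdges (G : SimpleGraph V) (lev : V → ℕ) : SimpleGraph V where
  Adj a b := G.Adj a b ∧ lev a = lev b
  symm := ⟨fun _ _ h => ⟨h.1.symm, h.2.symm⟩⟩
  loopless := ⟨fun _ h => h.1.ne rfl⟩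

/-- The edges between two consecutive levels, from a vertex satisfying `A` up to a vertex
satisfying `B`. -/
def upEdges (G : SimpleGraph V) (lev : V → ℕ) (A B : V → Prop) : SimpleGraph V where
  Adj a b := G.Adj a b ∧
    (lev b = lev a + 1 ∧ A a ∧ B b ∨ lev a = lev b + 1 ∧ A b ∧ B a)
  symm := ⟨fun _ _ h => ⟨h.1.symm, h.2.symm⟩⟩
  loopless := ⟨fun _ h => h.1.ne rfl⟩

lemma levelEdges_le : G.levelEdges lev ≤ G := fun _ _ h => h.1

lemma upEdges_le {A B : V → Prop} : G.upEdges lev A B ≤ G := fun _ _ h => h.1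

/-- The vertices of the tree paths of `v` and `w`. -/
def IsAncestor (par : V → V) (l : ℕ) (v w z : V) : Prop :=
  ∃ s ≤ l, z = par^[s] v ∨ z = par^[s] w

open Finset Classical in
/-- Few edges lead to a vertex of two given tree paths. -/
lemma IsLevelled.not_le_degree_upEdges (h : IsLevelled G lev par) {v w : V} (hlev : lev v = lev w)
    {A B : V → Prop} {e : ℕ} (hA : ∀ a, A a → lev a % 2 = e)
    (hB : ∀ b, B b → IsAncestor par (lev v) v w b) {Z : Finset V} (hZ : Z.Nonempty) :
    ¬ ∀ z ∈ Z, 3 ≤ #{y ∈ Z | (G.upEdges lev A B).Adj z y} := by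
  intro hdeg
  obtain ⟨a, haZ, haA⟩ : ∃ a ∈ Z, A a := by
    obtain ⟨z, hz⟩ := hZ
    have h3 := hdeg z hz
    obtain ⟨y, hy⟩ : (Z.filter fun y => (G.upEdges lev A B).Adj z y).Nonempty := by
      rw [← card_pos]
      omega
    rw [mem_filter] at hy
    rcases hy.2.2 with h1 | h1
    · exact ⟨z, hz, h1.2.1⟩
    · exact ⟨y, hy.1, h1.2.1⟩
  have hsub : (Z.filter fun y => (G.upEdges lev A B).Adj a y) ⊆
      {par^[lev v - (lev a + 1)] v, par^[lev v - (lev a + 1)] w} := by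
    intro y hy
    rw [mem_filter] at hy
    rcases hy.2.2 with h1 | h1
    · obtain ⟨s, hs, rfl | rfl⟩ := hB y h1.2.2
      · have := h.lev_iterate hs
        rw [show lev v - (lev a + 1) = s by omega]
        simp
      · have := h.lev_iterate (hlev ▸ hs)
        rw [show lev v - (lev a + 1) = s by omega]
        simp
    · have h2 := hA _ haA
      have h3 := hA _ h1.2.1
      omega
  have h1 := (card_le_card hsub).trans card_le_two
  have h2 := hdeg a haZ
  omega

lemma upEdges_exists_levels {A B : V → Prop} {e : ℕ} (hA : ∀ a, A a → lev a % 2 = e)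
    {F : ℤ → V} {n : ℤ} (hF : IsCyclicSeq (G.upEdges lev A B) F n) :
    ∃ i, (∀ z, lev (F z) = i ∨ lev (F z) = i + 1) ∧ (∀ z, lev (F z) = i → A (F z)) ∧
      ∀ z, lev (F z) = i + 1 → B (F z) := by
  let f : ℤ → ℕ := fun z => if lev (F z) % 2 = e then lev (F z) else lev (F z) - 1
  have hf : ∀ z, f z = f (z + 1) := by
    intro z
    simp only [f]
    rcases (hF.adj z).2 with ⟨h1, h2, -⟩ | ⟨h1, h2, -⟩
    · have := hA _ h2
      rw [if_pos this, if_neg (by omega)]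
      omega
    · have := hA _ h2
      rw [if_neg (by omega), if_pos this]
      omega
  have hf0 := Int.apply_eq_apply_zero_of_forall_add_one hf
  have hlev : ∀ z, lev (F z) = f 0 ∨ lev (F z) = f 0 + 1 := by
    intro z
    rw [← hf0 z]
    simp only [f]
    split_ifs <;> omega
  refine ⟨f 0, hlev, fun z hz => ?_, fun z hz => ?_⟩
  · rcases (hF.adj z).2 with ⟨h1, h2, -⟩ | ⟨h1, h2, h3⟩
    · exact h2
    · rcases hlev (z + 1) with h4 | h4 <;> omega
  · rcases (hF.adj z).2 with ⟨h1, h2, -⟩ | ⟨h1, h2, h3⟩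
    · rcases hlev (z + 1) with h4 | h4 <;> omega
    · exact h3

open Finset Classical in
lemma hasConsecutiveOddCycles_of_card_edgeSet [Fintype V] (hc : ¬ G.Colorable 2)
    (hG : TwoConnected G) {k d : ℕ} (hk : 1 ≤ k) (hd : 1 ≤ d)
    (he : 24 * k * 9 * Fintype.card V ≤ Nat.card G.edgeSet)
    (hcyc : ∀ m, HasCycleOfLength G m → 2 * d < m) : HasConsecutiveOddCycles G (k ^ d) := by
  have hconn := hG.connected
  have := hconn.nonempty
  obtain ⟨u, v, w, hvw, hlev, hv, hpne⟩ := hconn.exists_root hc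
  obtain ⟨par, h⟩ := G.exists_isLevelled_dist u
  have hne := hpne par h
  have hroot : ∀ z, par^[G.dist u z] z = u := fun z =>
    (hconn.preconnected u z).iterate_par_eq h
  let A : Bool → Bool → V → Prop := fun e f a => G.dist u a % 2 = cond e 1 0 ∧
    (par^[G.dist u a - 1] a = par^[G.dist u v - 1] w ↔ f = true)
  let B : Bool → V → Prop := fun b z => IsAncestor par (G.dist u v) v w z ↔ b = true
  have hAe : ∀ e f a, A e f a → G.dist u a % 2 = cond e 1 0 := fun e f a ha => ha.1
  let cls : Option (Bool × Bool × Bool) → SimpleGraph V := fun c =>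
    c.elim (G.levelEdges (G.dist u)) fun c => G.upEdges (G.dist u) (A c.1 c.2.1) (B c.2.2)
  have hcls : ∀ c, cls c ≤ G := by
    rintro (_ | c)
    · exact levelEdges_le
    · exact upEdges_le
  have hcover : ∀ a b, G.Adj a b → ∃ c, (cls c).Adj a b := by
    have key : ∀ a b, ∃ c : Bool × Bool × Bool, A c.1 c.2.1 a ∧ B c.2.2 b := by
      intro a b
      refine ⟨(decide (G.dist u a % 2 = 1),
        decide (par^[G.dist u a - 1] a = par^[G.dist u v - 1] w),
        decide (IsAncestor par (G.dist u v) v w b)), ⟨?_, by simp⟩, by simp [B]⟩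
      by_cases h1 : G.dist u a % 2 = 1
      · simp [h1]
      · simp only [h1, decide_false, cond_false]
        omega
    intro a b hab
    have h1 := hconn.dist_le_dist_add_one hab u
    have h2 := hconn.dist_le_dist_add_one hab.symm u
    rcases lt_trichotomy (G.dist u a) (G.dist u b) with hlt | heq | hgt
    · obtain ⟨c, hc1, hc2⟩ := key a b
      exact ⟨some c, hab, Or.inl ⟨by omega, hc1, hc2⟩⟩
    · exact ⟨none, hab, heq⟩
    · obtain ⟨c, hc1, hc2⟩ := key b a
      exact ⟨some c, hab, Or.inr ⟨by omega, hc1, hc2⟩⟩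
  obtain ⟨c, Z, hZ, hdeg⟩ := exists_subset_le_degree_of_cover cls hcover (t := 24 * k) (by
    simpa using he)
  obtain ⟨F, n, r, hF, hr, hrn, hch, hN, -⟩ := (cls c).exists_isCyclicSeq hZ hk hd hdeg
    fun m hm => hcyc m (hm.mono (hcls c))
  have hN' : 2 * ((k ^ d : ℕ) : ℤ) < n := by exact_mod_cast hN
  rcases c with _ | ⟨e, f, b⟩
  · refine h.hasConsecutiveOddCycles_of_level hroot (hF.mono (hcls _)) hr hrn (hcls _ hch) hN'
      (i := G.dist u (F 0)) ?_
    exact Int.apply_eq_apply_zero_of_forall_add_one (f := fun z => G.dist u (F z))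
      fun z => (hF.adj z).2
  · cases b
    · obtain ⟨i, hi, hiA, hiB⟩ := upEdges_exists_levels (hAe e f) hF
      have hodd : ∀ a b, (cls (some (e, f, false))).Adj a b → Odd (G.dist u a + G.dist u b) := by
        rintro a b ⟨-, h1 | h1⟩
        · exact ⟨G.dist u a, by omega⟩
        · exact ⟨G.dist u b, by omega⟩
      have hB : ∀ z, G.dist u (F z) = i + 1 → ∀ s ≤ G.dist u v,
          F z ≠ par^[s] v ∧ F z ≠ par^[s] w := by
        intro z hz s hs
        have := hiB z hz
        simp only [B, Bool.false_eq_true, iff_false] at this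
        exact ⟨fun h1 => this ⟨s, hs, Or.inl h1⟩, fun h1 => this ⟨s, hs, Or.inr h1⟩⟩
      cases f
      · refine h.hasConsecutiveOddCycles_of_two_levels hroot hG.2 hvw hlev hv hne (hcls _) hodd hF
          hr hrn hch hN' hi (fun z hz => ?_) hB
        have := (hiA z hz).2
        rw [hz] at this
        simpa using this
      · refine h.hasConsecutiveOddCycles_of_two_levels hroot hG.2 hvw.symm hlev.symm (hlev ▸ hv)
          (fun s hs => (hne s (hlev ▸ hs)).symm) (hcls _) hodd hF hr hrn hch hN' hi
          (fun z hz => ?_) (fun z hz s hs => (hB z hz s (hlev ▸ hs)).symm)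
        have := (hiA z hz).2
        rw [hz] at this
        rw [this.2 rfl, ← hlev]
        exact (hne _ (by omega)).symm
    · refine absurd (fun z hz => ?_) (h.not_le_degree_upEdges hlev (hAe e f)
        (B := B true) (fun b hb => hb.2 rfl) hZ)
      exact le_trans (by omega) (hdeg z hz)

end SimpleGraph

lemma HasConsecutiveOddCycles.mono {V : Type*} {G : SimpleGraph V} {m n : ℕ} (hmn : m ≤ n)
    (h : HasConsecutiveOddCycles G n) : HasConsecutiveOddCycles G m := by
  obtain ⟨l, hl, hi⟩ := h
  exact ⟨l, hl, fun i him => hi i (him.trans_le hmn)⟩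

theorem cycles_of_consecutive_odd_lengths :
    ∃ c : ℝ, 0 < c ∧ ∀ k : ℕ, 1 ≤ k →
      ∀ (V : Type) [Fintype V] (G : SimpleGraph V),
        ¬ G.Colorable 2 →                       -- `G` is not bipartite
        TwoConnected G →
        c * k * (Fintype.card V) ≤ 2 * (Nat.card G.edgeSet) →  -- average degree ≥ c * k
        ∀ g : ℕ, G.girth = g →
          HasConsecutiveOddCycles G (k ^ ((g - 1) / 2)) := by
  refine ⟨432, by norm_num, ?_⟩
  intro k hk V _ G hc hG hdens g hg
  have he : 24 * k * 9 * Fintype.card V ≤ Nat.card G.edgeSet := by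
    have : (24 * k * 9 * Fintype.card V : ℝ) ≤ Nat.card G.edgeSet := by linarith
    exact_mod_cast this
  have hcyc : ∀ m, HasCycleOfLength G m → 2 * max ((g - 1) / 2) 1 < m := by
    rintro _ ⟨v, c, hc, rfl⟩
    have h1 := hc.girth_le_length
    have h2 := hc.three_le_length
    omega
  refine (SimpleGraph.hasConsecutiveOddCycles_of_card_edgeSet hc hG hk (le_max_right _ _) he
    hcyc).mono ?_
  exact Nat.pow_le_pow_right hk (le_max_left _ _)
end

section
/- There exists an absolute constant c > 0 such that for every natural number k ≥ 1, every non-bipartite 2-connected finite simple graph G with average degree at least c·k contains at least k cycles of consecutive odd lengths. -/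
open SimpleGraph

/-- `G` has a path of length `n` from `x` to `y` all of whose vertices lie in `A`. -/
def HasPathIn {V : Type*} (G : SimpleGraph V) (A : Set V) (x y : V) (n : ℕ) : Prop :=
  ∃ p : G.Walk x y, p.IsPath ∧ p.length = n ∧ ∀ v ∈ p.support, v ∈ A

namespace HasPathIn

variable {V : Type*} {G : SimpleGraph V} {A B : Set V} {x y z : V} {n m : ℕ}

theorem nil (h : x ∈ A) : HasPathIn G A x x 0 :=
  ⟨.nil, by simp, rfl, by simpa⟩

theorem mono (h : HasPathIn G A x y n) (hAB : A ⊆ B) : HasPathIn G B x y n := by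
  obtain ⟨p, hp, hn, hA⟩ := h
  exact ⟨p, hp, hn, fun v hv => hAB (hA v hv)⟩

theorem symm (h : HasPathIn G A x y n) : HasPathIn G A y x n := by
  obtain ⟨p, hp, hn, hA⟩ := h
  exact ⟨p.reverse, hp.reverse, by simpa, by simpa using hA⟩

theorem left_mem (h : HasPathIn G A x y n) : x ∈ A := by
  obtain ⟨p, hp, hn, hA⟩ := h
  exact hA x p.start_mem_support

theorem right_mem (h : HasPathIn G A x y n) : y ∈ A := h.symm.left_mem

theorem edge (h : G.Adj x y) : HasPathIn G {x, y} x y 1 :=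
  ⟨.cons h .nil, by simp [h.ne], by simp, by simp⟩

/-- Paths whose vertex sets meet only in the common end can be concatenated. -/
theorem append (h₁ : HasPathIn G A x y n) (h₂ : HasPathIn G B y z m)
    (hAB : ∀ v ∈ A, v ∈ B → v = y) : HasPathIn G (A ∪ B) x z (n + m) := by
  obtain ⟨p, hp, hn, hA⟩ := h₁
  obtain ⟨q, hq, hm, hB⟩ := h₂
  refine ⟨p.append q, ?_, by simp [hn, hm], fun v hv => ?_⟩
  · rw [Walk.isPath_def, Walk.support_append, List.nodup_append']
    refine ⟨hp.support_nodup, hq.support_nodup.tail, fun v hv hv' => ?_⟩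
    have hy := hAB v (hA v hv) (hB v (List.mem_of_mem_tail hv'))
    have := hq.support_nodup
    rw [← Walk.cons_tail_support, List.nodup_cons] at this
    exact this.1 (hy ▸ hv')
  · rcases (Walk.mem_support_append_iff _ _).1 hv with h | h
    · exact Or.inl (hA v h)
    · exact Or.inr (hB v h)

theorem cons (h : G.Adj x y) (h₂ : HasPathIn G B y z m) (hx : x ∉ B) :
    HasPathIn G (insert x B) x z (m + 1) := by
  obtain ⟨q, hq, hm, hB⟩ := h₂
  refine ⟨.cons h q, (Walk.cons_isPath_iff _ _).2 ⟨hq, fun h => hx (hB _ h)⟩, by simp [hm], ?_⟩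
  simpa using fun v hv => Or.inr (hB v hv)

/-- Disjoint paths joined by an edge form a path. -/
theorem append_adj {y' : V} (h₁ : HasPathIn G A x y n) (hy : G.Adj y y')
    (h₂ : HasPathIn G B y' z m) (hAB : Disjoint A B) :
    HasPathIn G (A ∪ B) x z (n + 1 + m) := by
  have hyA := h₁.right_mem
  have hd := Set.disjoint_left.1 hAB
  have := h₁.append (cons hy h₂ (hd hyA)) (by
    rintro v hv (rfl | hv')
    · rfl
    · exact absurd hv' (hd hv))
  rw [show n + 1 + m = n + (m + 1) by omega]
  refine this.mono ?_
  rintro v (h | rfl | h)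
  exacts [Or.inl h, Or.inl hyA, Or.inr h]

/-- An injective sequence of consecutively adjacent vertices traverses a path. -/
theorem of_seq (e : ℕ → V) (n : ℕ) (hadj : ∀ i < n, G.Adj (e i) (e (i + 1)))
    (hinj : Set.InjOn e (Set.Iic n)) : HasPathIn G (e '' Set.Iic n) (e 0) (e n) n := by
  induction n with
  | zero => exact nil ⟨0, by simp⟩
  | succ n ih =>
    have h₁ := ih (fun i hi => hadj i (by omega))
      (hinj.mono (fun i hi => by simp only [Set.mem_Iic] at *; omega))
    have h₂ : HasPathIn G {e (n + 1)} (e (n + 1)) (e (n + 1)) 0 := nil rfl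
    refine (h₁.append_adj (hadj n (by omega)) h₂ ?_).mono ?_
    · rw [Set.disjoint_singleton_right]
      rintro ⟨i, hi, he⟩
      simp only [Set.mem_Iic] at hi
      have := hinj (by simp; omega) (by simp) he
      omega
    · rintro v (⟨i, hi, rfl⟩ | rfl)
      · exact ⟨i, by simp only [Set.mem_Iic] at *; omega, rfl⟩
      · exact ⟨n + 1, by simp, rfl⟩

/-- Every path is traversed by an injective sequence of consecutively adjacent vertices. -/
theorem exists_seq (h : HasPathIn G A x y n) : ∃ e : ℕ → V, e 0 = x ∧ e n = y ∧
    (∀ i < n, G.Adj (e i) (e (i + 1))) ∧ Set.InjOn e (Set.Iic n) ∧ ∀ i, e i ∈ A := by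
  obtain ⟨p, hp, rfl, hA⟩ := h
  exact ⟨p.getVert, by simp, by simp, fun i hi => p.adj_getVert_succ hi,
    hp.getVert_injOn, fun i => hA _ (p.getVert_mem_support i)⟩

/-- The segment between two positions of an injective sequence. -/
theorem segment {e : ℕ → V} {N : ℕ} (hadj : ∀ i < N, G.Adj (e i) (e (i + 1)))
    (hinj : Set.InjOn e (Set.Iic N)) {s t : ℕ} (hst : s ≤ t) (ht : t ≤ N) :
    HasPathIn G (e '' Set.Icc s t) (e s) (e t) (t - s) := by
  have := of_seq (G := G) (fun i => e (s + i)) (t - s)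
    (fun i hi => hadj (s + i) (by omega)) (fun i hi j hj hij => by
      simp only [Set.mem_Iic] at hi hj
      have := hinj (by simp only [Set.mem_Iic]; omega) (by simp only [Set.mem_Iic]; omega) hij
      omega)
  simp only [add_zero, Nat.add_sub_cancel' hst] at this
  refine this.mono ?_
  rintro v ⟨i, hi, rfl⟩
  simp only [Set.mem_Iic] at hi
  exact ⟨s + i, by simp only [Set.mem_Icc]; omega, rfl⟩

/-- The initial part of a path up to its first vertex in `T`. -/
theorem exists_first {T : Set V} (h : HasPathIn G A x y n) (hy : y ∈ T) :
    ∃ z ∈ T, ∃ B ⊆ A, ∃ m, HasPathIn G B x z m ∧ ∀ v ∈ B, v ∈ T → v = z := by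
  classical
  obtain ⟨e, rfl, rfl, hadj, hinj, hA⟩ := h.exists_seq
  have hex : ∃ t, t ≤ n ∧ e t ∈ T := ⟨n, le_rfl, hy⟩
  obtain ⟨ht, htT⟩ := Nat.find_spec hex
  refine ⟨_, htT, e '' Set.Icc 0 (Nat.find hex), ?_, _,
    segment hadj hinj (Nat.zero_le _) ht, ?_⟩
  · rintro _ ⟨i, -, rfl⟩
    exact hA i
  · rintro _ ⟨i, hi, rfl⟩ hiT
    by_contra hne
    have hlt : i < Nat.find hex := lt_of_le_of_ne hi.2 (fun h => hne (by rw [h]))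
    exact Nat.find_min hex hlt ⟨by omega, hiT⟩

theorem ne_zero (h : HasPathIn G A x y n) (hxy : x ≠ y) : n ≠ 0 := by
  rintro rfl
  obtain ⟨p, hp, hn, -⟩ := h
  exact hxy (Walk.eq_of_length_eq_zero hn)

theorem map {W : Type*} {H : SimpleGraph W} (h : HasPathIn G A x y n) (f : G →g H)
    (hf : Function.Injective f) : HasPathIn H (f '' A) (f x) (f y) n := by
  obtain ⟨p, hp, rfl, hA⟩ := h
  refine ⟨p.map f, Walk.IsPath.map hf hp, by simp, fun v hv => ?_⟩
  rw [Walk.support_map, List.mem_map] at hv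
  obtain ⟨u, hu, rfl⟩ := hv
  exact ⟨u, hA u hu, rfl⟩

/-- Two paths meeting only in their ends close up to a cycle. -/
theorem hasCycleOfLength (h₁ : HasPathIn G A x y n) (h₂ : HasPathIn G B y x m)
    (hAB : ∀ v ∈ A, v ∈ B → v = x ∨ v = y) (hnm : 1 < n ∨ 1 < m) :
    HasCycleOfLength G (n + m) := by
  obtain ⟨p, hp, rfl, hA⟩ := h₁
  obtain ⟨q, hq, rfl, hB⟩ := h₂
  refine ⟨x, p.append q, hp.isCycle_append hq ?_ hnm, by simp⟩
  intro v hv hv'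
  have hp' := hp.support_nodup
  have hq' := hq.support_nodup
  rw [← Walk.cons_tail_support, List.nodup_cons] at hp' hq'
  rcases hAB v (hA v (List.mem_of_mem_tail hv)) (hB v (List.mem_of_mem_tail hv')) with rfl | rfl
  · exact hp'.1 hv
  · exact hq'.1 hv'

end HasPathIn

/-- After the deletion of any vertex, any two remaining vertices are joined by a path. -/
def ConnectedAvoiding {V : Type*} (G : SimpleGraph V) : Prop :=
  ∀ v a b : V, a ≠ v → b ≠ v → ∃ n, HasPathIn G {v}ᶜ a b n

/-- Any two distinct vertices of `S` are joined inside `S` by `k` paths whose lengths are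
consecutive integers of the parity prescribed by the colouring `χ`. -/
def ParityLinked {V : Type*} (G : SimpleGraph V) (k : ℕ) (S : Set V) (χ : V → Bool) : Prop :=
  ∀ x ∈ S, ∀ y ∈ S, x ≠ y →
    ∃ n, (Even n ↔ χ x = χ y) ∧ ∀ i < k, HasPathIn G S x y (n + 2 * i)

theorem hasPathIn_of_walk {V : Type*} {G : SimpleGraph V} {A : Set V} {x y : V}
    (p : G.Walk x y) (hA : ∀ v ∈ p.support, v ∈ A) : ∃ n, HasPathIn G A x y n := by
  classical
  exact ⟨_, p.bypass, p.bypass_isPath, rfl, fun v hv => hA v (p.support_bypass_subset_support hv)⟩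

theorem TwoConnected.connectedAvoiding {V : Type*} [Fintype V] {G : SimpleGraph V}
    (h : TwoConnected G) : ConnectedAvoiding G := by
  intro v a b ha hb
  obtain ⟨p⟩ := (h.2 v).preconnected ⟨a, ha⟩ ⟨b, hb⟩
  obtain ⟨n, hn⟩ := hasPathIn_of_walk p (A := Set.univ) (by simp)
  refine ⟨n, (HasPathIn.map hn (Embedding.induce ({v}ᶜ : Set V)).toHom
    Subtype.val_injective).mono ?_⟩
  rintro _ ⟨⟨w, hw⟩, -, rfl⟩
  exact hw

/-- In a graph without cut vertices, every proper vertex set with at least two vertices has an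
ear with an interior vertex. -/
theorem ConnectedAvoiding.exists_ear {V : Type*} {G : SimpleGraph V} (hG : ConnectedAvoiding G)
    {S : Set V} (hS : S.Nontrivial) {v : V} (hv : v ∉ S) :
    ∃ a ∈ S, ∃ b ∈ S, a ≠ b ∧ ∃ B m, HasPathIn G B a b m ∧ (∀ u ∈ B, u ∈ S → u = a ∨ u = b) ∧
      2 ≤ m := by
  obtain ⟨s, hs, s', hs', hne⟩ := hS
  obtain ⟨n, p, -, -, -⟩ := hG s' s v hne (by rintro rfl; exact hv hs')
  obtain ⟨⟨⟨a, v'⟩, hadj⟩, -, ha, hv'⟩ := p.exists_boundary_dart S hs hv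
  simp only at ha hv' hadj
  obtain ⟨b₀, hb₀, hb₀a⟩ : ∃ b₀ ∈ S, b₀ ≠ a := by
    by_cases h : s = a
    · exact ⟨s', hs', fun h' => hne (h.trans h'.symm)⟩
    · exact ⟨s, hs, h⟩
  obtain ⟨n, hn⟩ := hG a v' b₀ hadj.ne' hb₀a
  obtain ⟨b, hb, B, hBA, m, hm, hfirst⟩ := hn.exists_first hb₀
  refine ⟨a, ha, b, hb, fun h => hBA hm.right_mem h.symm, _, _,
    .cons hadj hm (fun h => hBA h rfl), ?_, ?_⟩
  · rintro u (rfl | hu) huS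
    · exact Or.inl rfl
    · exact Or.inr (hfirst u hu huS)
  · have := hm.ne_zero (by rintro rfl; exact hv' hb)
    omega

/-- An ear whose length has the parity prescribed by the colouring can be added. -/
theorem ParityLinked.exists_union_ear {V : Type*} {G : SimpleGraph V} {k : ℕ} {S : Set V}
    {χ : V → Bool} (hS : ParityLinked G k S χ) {e : ℕ → V} {m : ℕ}
    (hadj : ∀ i < m, G.Adj (e i) (e (i + 1))) (hinj : Set.InjOn e (Set.Iic m))
    (ha : e 0 ∈ S) (hb : e m ∈ S) (hab : e 0 ≠ e m) (hint : ∀ i ≤ m, e i ∈ S → i = 0 ∨ i = m)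
    (hpar : Even m ↔ χ (e 0) = χ (e m)) :
    ∃ χ', ParityLinked G k (S ∪ e '' Set.Iic m) χ' := by
  classical
  let χ' : V → Bool := fun v => if v ∈ S then χ v else
    if ∃ t ≤ m, e t = v ∧ Even t then χ (e 0) else !χ (e 0)
  have hχS : ∀ v ∈ S, χ' v = χ v := fun v hv => by simp [χ', hv]
  have hχe : ∀ t ≤ m, (Even t ↔ χ' (e t) = χ (e 0)) := by
    intro t ht
    by_cases htS : e t ∈ S
    · rw [hχS _ htS]
      rcases hint t ht htS with rfl | rfl
      · simp
      · rw [hpar, eq_comm]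
    · have : (∃ t' ≤ m, e t' = e t ∧ Even t') ↔ Even t := by
        constructor
        · rintro ⟨t', ht', he, hev⟩
          rwa [← hinj ht' ht he]
        · exact fun h => ⟨t, ht, rfl, h⟩
      by_cases hev : Even t <;> simp [χ', htS, this, hev]
  have hsub : ∀ s t, t ≤ m → e '' Set.Icc s t ⊆ S ∪ e '' Set.Iic m := by
    rintro s t ht _ ⟨i, hi, rfl⟩
    exact Or.inr ⟨i, hi.2.trans ht, rfl⟩
  have key₁ : ∀ t ≤ m, e t ∉ S → ∀ y ∈ S, ∃ n, (Even n ↔ χ' (e t) = χ' y) ∧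
      ∀ i < k, HasPathIn G (S ∪ e '' Set.Iic m) (e t) y (n + 2 * i) := by
    intro t ht htS y hy
    have ht0 : t ≠ 0 := by rintro rfl; exact htS ha
    have htm : t ≠ m := by rintro rfl; exact htS hb
    have het := hχe t ht
    rw [hχS y hy]
    by_cases hya : y = e 0
    · subst hya
      obtain ⟨n, hn, hpath⟩ := hS _ hb _ ha (Ne.symm hab)
      refine ⟨(m - t) + n, ?_, fun i hi => ?_⟩
      · have hmt : Even m ↔ (Even (m - t) ↔ Even t) := by
          rw [← Nat.even_add, Nat.sub_add_cancel ht]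
        rw [Nat.even_add, hn, ← het]
        rw [eq_comm] at hpar
        grind
      · have h₁ := HasPathIn.segment hadj hinj ht le_rfl
        have := h₁.append (hpath i hi) (by
          rintro _ ⟨j, hj, rfl⟩ hjS
          rcases hint j hj.2 hjS with rfl | rfl
          · exact absurd hj.1 (by omega)
          · rfl)
        rw [add_assoc]
        exact this.mono (Set.union_subset (hsub _ _ le_rfl) Set.subset_union_left)
    · obtain ⟨n, hn, hpath⟩ := hS _ ha _ hy (Ne.symm hya)
      refine ⟨t + n, ?_, fun i hi => ?_⟩
      · rw [Nat.even_add, hn, het]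
        cases χ' (e t) <;> cases χ (e 0) <;> cases χ y <;> simp
      · have h₁ := (HasPathIn.segment hadj hinj (Nat.zero_le t) ht).symm
        have := h₁.append (hpath i hi) (by
          rintro _ ⟨j, hj, rfl⟩ hjS
          rcases hint j (hj.2.trans ht) hjS with rfl | rfl
          · rfl
          · exact absurd hj.2 (by omega))
        rw [add_assoc]
        exact this.mono (Set.union_subset (hsub _ _ ht) Set.subset_union_left)
  have key₂ : ∀ t t', t < t' → t' ≤ m → e t ∉ S → e t' ∉ S → ∃ n,
      (Even n ↔ χ' (e t) = χ' (e t')) ∧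
      ∀ i < k, HasPathIn G (S ∪ e '' Set.Iic m) (e t) (e t') (n + 2 * i) := by
    intro t t' htt' ht' htS htS'
    have htm : t' ≠ m := by rintro rfl; exact htS' hb
    obtain ⟨n, hn, hpath⟩ := hS _ ha _ hb hab
    refine ⟨t + n + (m - t'), ?_, fun i hi => ?_⟩
    · have hmt : Even m ↔ (Even (m - t') ↔ Even t') := by
        rw [← Nat.even_add, Nat.sub_add_cancel ht']
      have h₁ := hχe t (by omega)
      have h₂ := hχe t' ht'
      have h₃ : (χ' (e t) = χ' (e t')) ↔ (Even t ↔ Even t') := by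
        rw [h₁, h₂]
        cases χ' (e t) <;> cases χ (e 0) <;> cases χ' (e t') <;> simp
      rw [Nat.even_add, Nat.even_add, hn, h₃]
      grind
    · have h₁ := (HasPathIn.segment hadj hinj (Nat.zero_le t) (by omega)).symm
      have h₂ := (HasPathIn.segment hadj hinj ht' le_rfl).symm
      have h₃ := h₁.append (hpath i hi) (by
        rintro _ ⟨j, hj, rfl⟩ hjS
        rcases hint j (by have := hj.2; omega) hjS with rfl | rfl
        · rfl
        · exact absurd hj.2 (by omega))
      have := h₃.append h₂ (by
        rintro _ h ⟨j, hj, rfl⟩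
        obtain ⟨hj₁, hj₂⟩ := hj
        rcases h with ⟨i', ⟨-, hi'⟩, he⟩ | h
        · have := hinj (by simp only [Set.mem_Iic]; omega) hj₂ he
          omega
        · rcases hint j hj₂ h with rfl | rfl
          · omega
          · rfl)
      rw [show t + n + (m - t') + 2 * i = t - 0 + (n + 2 * i) + (m - t') by omega]
      exact this.mono (Set.union_subset (Set.union_subset (hsub _ _ (by omega))
        Set.subset_union_left) (hsub _ _ le_rfl))
  have swap : ∀ x y, (∃ n, (Even n ↔ χ' x = χ' y) ∧
      ∀ i < k, HasPathIn G (S ∪ e '' Set.Iic m) x y (n + 2 * i)) → ∃ n,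
      (Even n ↔ χ' y = χ' x) ∧
      ∀ i < k, HasPathIn G (S ∪ e '' Set.Iic m) y x (n + 2 * i) := by
    rintro x y ⟨n, hn, h⟩
    exact ⟨n, by rw [hn, eq_comm], fun i hi => (h i hi).symm⟩
  refine ⟨χ', fun x hx y hy hxy => ?_⟩
  by_cases hxS : x ∈ S <;> by_cases hyS : y ∈ S
  · obtain ⟨n, hn, h⟩ := hS x hxS y hyS hxy
    exact ⟨n, by rw [hχS x hxS, hχS y hyS, hn], fun i hi =>
      (h i hi).mono Set.subset_union_left⟩
  · obtain ⟨t, ht, rfl⟩ := hy.resolve_left hyS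
    exact swap _ _ (key₁ t ht hyS x hxS)
  · obtain ⟨t, ht, rfl⟩ := hx.resolve_left hxS
    exact key₁ t ht hxS y hyS
  · obtain ⟨t, ht, rfl⟩ := hx.resolve_left hxS
    obtain ⟨t', ht', rfl⟩ := hy.resolve_left hyS
    rcases lt_trichotomy t t' with h | rfl | h
    · exact key₂ t t' h ht' hxS hyS
    · exact absurd rfl hxy
    · exact swap _ _ (key₂ t' t h ht hyS hxS)

/-- An ear of the wrong parity closes up to cycles of consecutive odd lengths. -/
theorem ParityLinked.hasConsecutiveOddCycles_of_ear {V : Type*} {G : SimpleGraph V} {k : ℕ}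
    {S B : Set V} {χ : V → Bool} (hS : ParityLinked G k S χ) {a b : V} {m : ℕ}
    (ha : a ∈ S) (hb : b ∈ S) (hab : a ≠ b) (hm : HasPathIn G B a b m)
    (hint : ∀ u ∈ B, u ∈ S → u = a ∨ u = b) (hpar : ¬(Even m ↔ χ a = χ b)) :
    HasConsecutiveOddCycles G k := by
  obtain ⟨n, hn, hpath⟩ := hS a ha b hb hab
  rw [← hn] at hpar
  have hodd : Odd (n + m) := by
    rw [← Nat.not_even_iff_odd, Nat.even_add]
    tauto
  have hm0 := hm.ne_zero hab
  refine ⟨n + m, hodd, fun i hi => ?_⟩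
  have hn0 := (hpath i hi).ne_zero hab
  rw [show n + m + 2 * i = n + 2 * i + m by omega]
  refine (hpath i hi).hasCycleOfLength hm.symm (fun v hv hv' => hint v hv' hv) ?_
  obtain ⟨r, hr⟩ := hodd
  omega

theorem ParityLinked.hasConsecutiveOddCycles {V : Type*} [Finite V] {G : SimpleGraph V} {k : ℕ}
    (hG : ConnectedAvoiding G) (hbip : ¬ G.Colorable 2) {S : Set V} {χ : V → Bool}
    (hS : ParityLinked G k S χ) (hnt : S.Nontrivial) : HasConsecutiveOddCycles G k := by
  obtain ⟨M, hSM, ⟨χM, hM⟩, hmax⟩ :=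
    (Set.toFinite {T : Set V | ∃ χ, ParityLinked G k T χ}).exists_le_maximal (a := S) ⟨χ, hS⟩
  have hMnt : M.Nontrivial := hnt.mono hSM
  by_cases hMuniv : ∃ v, v ∉ M
  · obtain ⟨v, hv⟩ := hMuniv
    obtain ⟨a, ha, b, hb, hab, B, m, hB, hint, hm⟩ := hG.exists_ear hMnt hv
    by_cases hpar : Even m ↔ χM a = χM b
    · obtain ⟨e, rfl, rfl, hadj, hinj, he⟩ := hB.exists_seq
      have hint' : ∀ i ≤ m, e i ∈ M → i = 0 ∨ i = m := fun i hi hiM =>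
        (hint _ (he i) hiM).imp (fun h => hinj hi (Nat.zero_le m) h)
          (fun h => hinj hi (Set.mem_Iic.2 le_rfl) h)
      have hmem := hmax (hM.exists_union_ear hadj hinj ha hb hab hint' hpar)
        Set.subset_union_left (Or.inr ⟨1, by simp only [Set.mem_Iic]; omega, rfl⟩ : e 1 ∈ _)
      have := hint' 1 (by omega) hmem
      omega
    · exact hM.hasConsecutiveOddCycles_of_ear ha hb hab hB hint hpar
  · push Not at hMuniv
    obtain ⟨u, v, huv, hχ⟩ : ∃ u v, G.Adj u v ∧ χM u = χM v := by
      by_contra! h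
      refine hbip ?_
      have := (Coloring.mk χM (fun {u v} huv => h u v huv)).colorable
      simpa using this
    refine hM.hasConsecutiveOddCycles_of_ear (hMuniv u) (hMuniv v) huv.ne (.edge huv) ?_ ?_
    · rintro w (rfl | rfl) - <;> simp
    · simp [hχ]

section Density

open Classical in
/-- The degree sum of the subgraph induced on `S`. -/
noncomputable def degSum {V : Type*} (G : SimpleGraph V) (S : Finset V) : ℕ :=
  ∑ v ∈ S, ∑ u ∈ S, if G.Adj v u then 1 else 0

open Classical in
/-- The degree of `v` into `S`. -/
noncomputable def degInto {V : Type*} (G : SimpleGraph V) (S : Finset V) (v : V) : ℕ :=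
  ∑ u ∈ S, if G.Adj v u then 1 else 0

variable {V : Type*} {G : SimpleGraph V}

theorem degSum_eq_sum_degInto (S : Finset V) : degSum G S = ∑ v ∈ S, degInto G S v := rfl

open Classical in
theorem degInto_eq_card (S : Finset V) (v : V) :
    degInto G S v = (S.filter fun u => G.Adj v u).card := by
  simp [degInto]

open Classical in
theorem degSum_insert {S : Finset V} {v : V} (hv : v ∉ S) :
    degSum G (insert v S) = degSum G S + 2 * degInto G (insert v S) v := by
  simp only [degSum, degInto, Finset.sum_insert hv, Finset.sum_add_distrib, if_false,
    SimpleGraph.irrefl, G.adj_comm _ v]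
  ring

open Classical in
theorem degSum_separation {C C' : Finset V} {v : V} (hv : v ∉ C) (hv' : v ∉ C')
    (hd : Disjoint C C') (hsep : ∀ x ∈ C, ∀ y ∈ C', ¬ G.Adj x y) :
    degSum G (insert v (C ∪ C')) = degSum G (insert v C) + degSum G (insert v C') := by
  have h₁ : ∑ x ∈ C, ∑ y ∈ C', (if G.Adj x y then 1 else 0) = 0 :=
    Finset.sum_eq_zero fun x hx => Finset.sum_eq_zero fun y hy => if_neg (hsep x hx y hy)
  have h₂ : ∑ x ∈ C', ∑ y ∈ C, (if G.Adj x y then 1 else 0) = 0 :=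
    Finset.sum_eq_zero fun x hx => Finset.sum_eq_zero fun y hy =>
      if_neg fun h => hsep y hy x hx h.symm
  have hvu : v ∉ C ∪ C' := by simp [hv, hv']
  simp only [degSum, Finset.sum_insert hv, Finset.sum_insert hv', Finset.sum_insert hvu,
    Finset.sum_union hd, Finset.sum_add_distrib, h₁, h₂, SimpleGraph.irrefl, if_false]
  ring

/-- A dense graph contains a vertex set inducing a subgraph of large minimum degree and without
cut vertices. -/
theorem exists_connectedAvoiding_subset [Fintype V] [Nonempty V] {D : ℕ} (hD : 0 < D)
    (h : D * Fintype.card V ≤ degSum G Finset.univ) :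
    ∃ S : Finset V, S.Nonempty ∧ (∀ v ∈ S, D < 2 * degInto G S v) ∧
      ∀ v ∈ S, ∀ a ∈ S, ∀ b ∈ S, a ≠ v → b ≠ v → ∃ n, HasPathIn G (↑S \ {v}) a b n := by
  classical
  let P : Finset V → Prop := fun S => S.Nonempty ∧ D * S.card < degSum G S + D
  have hP : P Finset.univ := ⟨Finset.univ_nonempty, by rw [Finset.card_univ]; omega⟩
  obtain ⟨S, -, ⟨hne, hS⟩, hmin⟩ := exists_minimal_le_of_wellFoundedLT P Finset.univ hP
  have hsmall : ∀ T : Finset V, T.Nonempty → T ⊂ S → degSum G T + D ≤ D * T.card := by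
    intro T hT hTS
    by_contra! hlt
    exact hTS.2 (hmin ⟨hT, hlt⟩ hTS.1)
  refine ⟨S, hne, fun v hv => ?_, fun v hv a ha b hb hav hbv => ?_⟩
  · have hins := Finset.insert_erase hv
    have hcard := Finset.card_erase_add_one hv
    have hdeg := degSum_insert (G := G) (Finset.notMem_erase v S)
    rw [hins] at hdeg
    rcases (S.erase v).eq_empty_or_nonempty with he | he
    · rw [he] at hins hcard
      rw [← hcard, ← hins] at hS
      obtain ⟨x, hx⟩ : {x ∈ ({v} : Finset V) | G.Adj v x}.Nonempty := by simpa [degSum] using hS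
      obtain ⟨hx, hadj⟩ := Finset.mem_filter.1 hx
      exact absurd (Finset.mem_singleton.1 hx).symm hadj.ne
    · have := hsmall _ he (Finset.erase_ssubset hv)
      rw [← hcard, mul_add] at hS
      omega
  · let C := S.filter fun u => u ≠ v ∧ ∃ n, HasPathIn G (↑S \ {v}) a u n
    let C' := S.filter fun u => u ≠ v ∧ ¬ ∃ n, HasPathIn G (↑S \ {v}) a u n
    by_contra hab
    have haC : a ∈ C := Finset.mem_filter.2 ⟨ha, hav, 0, .nil ⟨ha, hav⟩⟩
    have hbC : b ∈ C' := Finset.mem_filter.2 ⟨hb, hbv, hab⟩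
    have hvC : v ∉ C := by simp [C]
    have hvC' : v ∉ C' := by simp [C']
    have hd : Disjoint C C' := by
      rw [Finset.disjoint_left]
      intro u hu hu'
      exact (Finset.mem_filter.1 hu').2.2 (Finset.mem_filter.1 hu).2.2
    have hunion : insert v (C ∪ C') = S := by
      ext u
      simp only [C, C', Finset.mem_insert, Finset.mem_union, Finset.mem_filter]
      by_cases huv : u = v
      · simp [huv, hv]
      · tauto
    have hsep : ∀ x ∈ C, ∀ y ∈ C', ¬ G.Adj x y := by
      intro x hx y hy hxy
      obtain ⟨-, -, n, p, hp, -, hpS⟩ := Finset.mem_filter.1 hx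
      obtain ⟨hyS, hyv, hy⟩ := Finset.mem_filter.1 hy
      refine hy (hasPathIn_of_walk (p.concat hxy) ?_)
      intro u hu
      rw [Walk.support_concat, List.mem_append, List.mem_singleton] at hu
      rcases hu with hu | rfl
      · exact hpS u hu
      · exact ⟨hyS, hyv⟩
    have hcard : S.card = C.card + C'.card + 1 := by
      rw [← hunion, Finset.card_insert_of_notMem (by simp [hvC, hvC']),
        Finset.card_union_of_disjoint hd]
    have h₁ := hsmall (insert v C) (Finset.insert_nonempty _ _) (by
      refine Finset.ssubset_iff_subset_ne.2 ⟨?_, fun he => ?_⟩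
      · rw [← hunion]
        exact Finset.insert_subset_insert _ Finset.subset_union_left
      · rw [← he] at hb
        exact (Finset.disjoint_left.1 hd ((Finset.mem_insert.1 hb).resolve_left hbv)) hbC)
    have h₂ := hsmall (insert v C') (Finset.insert_nonempty _ _) (by
      refine Finset.ssubset_iff_subset_ne.2 ⟨?_, fun he => ?_⟩
      · rw [← hunion]
        exact Finset.insert_subset_insert _ Finset.subset_union_right
      · rw [← he] at ha
        exact (Finset.disjoint_left.1 hd haC) ((Finset.mem_insert.1 ha).resolve_left hav))
    have h₃ := degSum_separation hvC hvC' hd hsep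
    rw [hunion] at h₃
    rw [Finset.card_insert_of_notMem hvC] at h₁
    rw [Finset.card_insert_of_notMem hvC'] at h₂
    rw [hcard] at hS
    simp only [mul_add] at *
    omega

/-- The edges of `G` whose ends receive different colours. -/
def bichromatic {V : Type*} (G : SimpleGraph V) (χ : V → Bool) : SimpleGraph V where
  Adj u v := G.Adj u v ∧ χ u ≠ χ v
  symm := ⟨fun _ _ h => ⟨h.1.symm, h.2.symm⟩⟩
  loopless := ⟨fun _ h => h.2 rfl⟩

/-- Some bipartite subgraph has at least half of the edges. -/
theorem exists_bichromatic [Fintype V] (G : SimpleGraph V) :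
    ∃ χ : V → Bool, degSum G Finset.univ ≤ 2 * degSum (bichromatic G χ) Finset.univ := by
  classical
  by_contra! h
  have hflip : ∀ u v : V, G.Adj u v →
      2 * ∑ χ : V → Bool, (if χ u ≠ χ v then 1 else 0) = ∑ χ : V → Bool, 1 := by
    intro u v huv
    have he : ∑ χ : V → Bool, (if χ u ≠ χ v then 1 else 0) =
        ∑ χ : V → Bool, (if χ u = χ v then 1 else 0) := by
      let i : (V → Bool) → (V → Bool) := fun χ => Function.update χ u (!χ u)
      have hi : Function.Involutive i := by
        intro χ
        simp [i]
      refine Finset.sum_bijective i hi.bijective (by simp) ?_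
      intro χ _
      simp only [i, Function.update_self, Function.update_of_ne huv.ne']
      cases χ u <;> cases χ v <;> simp
    rw [two_mul]
    nth_rewrite 1 [he]
    rw [← Finset.sum_add_distrib]
    refine Finset.sum_congr rfl fun χ _ => ?_
    by_cases hc : χ u = χ v <;> simp [hc]
  have hsum : 2 * ∑ χ : V → Bool, degSum (bichromatic G χ) Finset.univ =
      ∑ χ : V → Bool, degSum G Finset.univ := by
    simp only [degSum]
    rw [Finset.sum_comm, Finset.sum_comm (s := (Finset.univ : Finset (V → Bool))),
      Finset.mul_sum]
    refine Finset.sum_congr rfl fun u _ => ?_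
    rw [Finset.sum_comm, Finset.sum_comm (s := (Finset.univ : Finset (V → Bool))),
      Finset.mul_sum]
    refine Finset.sum_congr rfl fun v _ => ?_
    by_cases huv : G.Adj u v
    · simpa [bichromatic, huv] using hflip u v huv
    · simp [bichromatic, huv]
  rw [Finset.mul_sum] at hsum
  exact absurd hsum (Finset.sum_lt_sum_of_nonempty Finset.univ_nonempty
    fun χ _ => h χ).ne

end Density

section Theta

variable {W : Type*} {F : SimpleGraph W} {c : ℤ → W} {N : ℤ}

theorem HasPathIn.arc (hc : ∀ i i', c i = c i' → N ∣ i - i')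
    (hadj : ∀ i, F.Adj (c i) (c (i + 1))) {i i' : ℤ} (hii : i ≤ i') (hN : i' - i < N) :
    HasPathIn F (c '' Set.Icc i i') (c i) (c i') (i' - i).toNat := by
  obtain ⟨m, rfl⟩ : ∃ m : ℕ, i' = i + m := ⟨(i' - i).toNat, by omega⟩
  have := HasPathIn.of_seq (G := F) (fun t : ℕ => c (i + t)) m
    (fun t _ => by
      have := hadj (i + t)
      rwa [add_assoc] at this) (fun s hs t ht hst => by
      simp only [Set.mem_Iic] at hs ht
      obtain ⟨z, hz⟩ := hc _ _ hst
      have hz0 : z = 0 := by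
        by_contra h0
        rcases lt_or_gt_of_ne h0 with h | h
        · have : N * z ≤ N * (-1) := by
            apply mul_le_mul_of_nonneg_left <;> omega
          omega
        · have : N * 1 ≤ N * z := by
            apply mul_le_mul_of_nonneg_left <;> omega
          omega
      rw [hz0] at hz
      omega)
  simp only [Nat.cast_zero, add_zero] at this
  rw [show (i + m - i).toNat = m by omega]
  refine this.mono ?_
  rintro v ⟨t, ht, rfl⟩
  simp only [Set.mem_Iic] at ht
  exact ⟨i + t, by simp only [Set.mem_Icc]; omega, rfl⟩

theorem disjoint_arcs (hc : ∀ i i', c i = c i' → N ∣ i - i') {a b a' b' : ℤ} (hb : b < a')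
    (hN : b' < a + N) : Disjoint (c '' Set.Icc a b) (c '' Set.Icc a' b') := by
  rw [Set.disjoint_left]
  rintro _ ⟨i, hi, rfl⟩ ⟨i', hi', hii⟩
  simp only [Set.mem_Icc] at hi hi'
  have := Int.le_of_dvd (by omega) (hc _ _ hii)
  omega

/-- An even cycle with a chord contains paths of all short even lengths leaving a given set that
separates the positions of one parity. -/
theorem exists_crossing_path (hc : ∀ i i', c i = c i' → N ∣ i - i')
    (hadj : ∀ i, F.Adj (c i) (c (i + 1))) {j : ℤ} (hj : j % 2 = 1)
    (hchord : F.Adj (c 0) (c j)) {t : ℕ} (ht : 1 ≤ t) (htj : 2 * t ≤ j) (hjN : j + 2 * t ≤ N)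
    {e : ℤ} {A : Set W} {i₀ i₁ : ℤ} (h₀ : (i₀ - e) % 2 = 0) (h₁ : (i₁ - e) % 2 = 0)
    (h₀A : c i₀ ∈ A) (h₁A : c i₁ ∉ A) :
    ∃ i i', (i - e) % 2 = 0 ∧ (i' - e) % 2 = 0 ∧ c i ∈ A ∧ c i' ∉ A ∧
      HasPathIn F (Set.range c) (c i) (c i') (2 * t) := by
  by_contra! hno
  have himg : ∀ s : Set ℤ, c '' s ⊆ Set.range c := fun s => Set.image_subset_range _ _
  have key : ∀ i i', (i - e) % 2 = 0 → (i' - e) % 2 = 0 →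
      HasPathIn F (Set.range c) (c i) (c i') (2 * t) → (c i ∈ A ↔ c i' ∈ A) := by
    intro i i' hi hi' hp
    by_cases h : c i ∈ A <;> by_cases h' : c i' ∈ A
    · simp [h, h']
    · exact absurd hp (hno i i' hi hi' h h')
    · exact absurd hp.symm (hno i' i hi' hi h' h)
    · simp [h, h']
  have step : ∀ i, (i - e) % 2 = 0 → (c i ∈ A ↔ c (i + 2 * t) ∈ A) := by
    intro i hi
    refine key _ _ hi (by omega) ?_
    have := HasPathIn.arc hc hadj (i := i) (i' := i + 2 * t) (by omega) (by omega)
    rw [show (i + 2 * t - i).toNat = 2 * t by omega] at this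
    exact this.mono (himg _)
  have steps : ∀ (n : ℕ) (i : ℤ), (i - e) % 2 = 0 → (c i ∈ A ↔ c (i + 2 * t * n) ∈ A) := by
    intro n
    induction n with
    | zero => simp
    | succ n ih =>
      intro i hi
      rw [ih i hi, step _ (by rw [mul_assoc]; omega)]
      push_cast
      ring_nf
  have period : ∀ i i' : ℤ, (i - e) % 2 = 0 → i' ≤ i → (2 * t : ℤ) ∣ i - i' →
      (c i ∈ A ↔ c i' ∈ A) := by
    rintro i i' hi hii ⟨z, hz⟩
    have hz0 : 0 ≤ z := by
      by_contra! hneg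
      have : (2 * t : ℤ) * z < 0 := mul_neg_of_pos_of_neg (by omega) hneg
      omega
    lift z to ℕ using hz0
    have := steps z i' (by rw [mul_assoc] at hz; omega)
    rw [this, ← hz]
    simp
  have period' : ∀ i i' : ℤ, (i - e) % 2 = 0 → (2 * t : ℤ) ∣ i - i' →
      (c i ∈ A ↔ c i' ∈ A) := by
    intro i i' hi hd
    rcases le_total i' i with h | h
    · exact period i i' hi h hd
    · refine (period i' i ?_ h ((dvd_sub_comm).1 hd)).symm
      obtain ⟨z, hz⟩ := hd
      rw [mul_assoc] at hz
      omega
  have back : ∀ i, (i - e) % 2 = 0 → -(2 * t : ℤ) < i → i ≤ 0 →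
      (c i ∈ A ↔ c (i + j - 1) ∈ A) := by
    intro i hi hi₁ hi₂
    rw [step (i + j - 1) (by omega)]
    refine key _ _ hi (by omega) ?_
    have h₁ := HasPathIn.arc hc hadj (i := i) (i' := 0) (by omega) (by omega)
    have h₂ := HasPathIn.arc hc hadj (i := j) (i' := i + j - 1 + 2 * t) (by omega) (by omega)
    have := h₁.append_adj hchord h₂ (disjoint_arcs hc (by omega) (by omega))
    rw [show (0 - i).toNat + 1 + (i + j - 1 + 2 * t - j).toNat = 2 * t by omega] at this
    exact this.mono (Set.union_subset (himg _) (himg _))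
  have forth : ∀ i, (i - e) % 2 = 0 → 0 ≤ i → i < 2 * t →
      (c i ∈ A ↔ c (i + j + 1) ∈ A) := by
    intro i hi hi₁ hi₂
    rw [show i + j + 1 = i + j + 1 - 2 * t + 2 * t by ring, ← step (i + j + 1 - 2 * t) (by omega)]
    refine key _ _ hi (by omega) ?_
    have h₁ := (HasPathIn.arc hc hadj (i := 0) (i' := i) (by omega) (by omega)).symm
    have h₂ := (HasPathIn.arc hc hadj (i := i + j + 1 - 2 * t) (i' := j)
      (by omega) (by omega)).symm
    have := h₁.append_adj hchord h₂ (disjoint_arcs hc (by omega) (by omega))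
    rw [show (i - 0).toNat + 1 + (j - (i + j + 1 - 2 * t)).toNat = 2 * t by omega] at this
    exact this.mono (Set.union_subset (himg _) (himg _))
  have ht0 : (0 : ℤ) < 2 * t := by omega
  have forth' : ∀ i, (i - e) % 2 = 0 → (c i ∈ A ↔ c (i + j + 1) ∈ A) := by
    intro i hi
    have hd := Int.emod_add_mul_ediv i (2 * t)
    have hm := Int.emod_nonneg i ht0.ne'
    have hm' := Int.emod_lt_of_pos i ht0
    have hpar : (i % (2 * t) - e) % 2 = 0 := by rw [mul_assoc] at hd; omega
    rw [period' i (i % (2 * t)) hi ⟨i / (2 * t), by linarith⟩, forth _ hpar hm hm']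
    exact period' _ _ (by omega) ⟨-(i / (2 * t)), by linarith⟩
  have back' : ∀ i, (i - e) % 2 = 0 → (c i ∈ A ↔ c (i + j - 1) ∈ A) := by
    intro i hi
    have hd := Int.emod_add_mul_ediv (-i) (2 * t)
    have hm := Int.emod_nonneg (-i) ht0.ne'
    have hm' := Int.emod_lt_of_pos (-i) ht0
    have hpar : (-(-i % (2 * t)) - e) % 2 = 0 := by rw [mul_assoc] at hd; omega
    rw [period' i (-(-i % (2 * t))) hi ⟨-(-i / (2 * t)), by linarith⟩,
      back _ hpar (by omega) (by omega)]
    exact period' _ _ (by omega) ⟨(-i / (2 * t)), by linarith⟩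
  have two : ∀ i, (i - e) % 2 = 0 → (c i ∈ A ↔ c (i + 2) ∈ A) := by
    intro i hi
    rw [forth' i hi, back' (i + 2) (by omega)]
    ring_nf
  have twos : ∀ (n : ℕ) (i : ℤ), (i - e) % 2 = 0 → (c i ∈ A ↔ c (i + 2 * n) ∈ A) := by
    intro n
    induction n with
    | zero => simp
    | succ n ih =>
      intro i hi
      rw [ih i hi, two _ (by omega)]
      push_cast
      ring_nf
  rcases le_total i₀ i₁ with h | h
  · have := twos ((i₁ - i₀) / 2).toNat i₀ h₀
    rw [show i₀ + 2 * (((i₁ - i₀) / 2).toNat : ℤ) = i₁ by omega] at this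
    exact h₁A (this.1 h₀A)
  · have := twos ((i₀ - i₁) / 2).toNat i₁ h₁
    rw [show i₁ + 2 * (((i₀ - i₁) / 2).toNat : ℤ) = i₀ by omega] at this
    exact h₁A (this.2 h₀A)

end Theta

section Linkage

variable {W : Type*} {F : SimpleGraph W}

/-- A path restricted to its own vertices, all of which are reached by initial segments. -/
theorem HasPathIn.exists_tight {A : Set W} {x y : W} {n : ℕ} (h : HasPathIn F A x y n) :
    ∃ B ⊆ A, HasPathIn F B x y n ∧
      ∀ v ∈ B, ∃ C ⊆ B, ∃ m, HasPathIn F C x v m ∧ (v ≠ y → y ∉ C) := by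
  obtain ⟨e, rfl, rfl, hadj, hinj, hA⟩ := h.exists_seq
  refine ⟨e '' Set.Iic n, ?_, .of_seq e n hadj hinj, ?_⟩
  · rintro _ ⟨i, -, rfl⟩
    exact hA i
  · rintro _ ⟨i, hi, rfl⟩
    simp only [Set.mem_Iic] at hi
    refine ⟨e '' Set.Iic i, Set.image_mono (Set.Iic_subset_Iic.2 hi), i,
      .of_seq e i (fun s hs => hadj s (by omega)) (hinj.mono (Set.Iic_subset_Iic.2 hi)), ?_⟩
    rintro hne ⟨s, hs, hse⟩
    simp only [Set.mem_Iic] at hs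
    have := hinj (by simp only [Set.mem_Iic]; omega) (by simp) hse
    exact hne (by rw [show i = n by omega])

/-- Disjoint paths joining, in some order, the two vertices `x` and `y` to `w` and to the
set `T`. -/
def Linked (F : SimpleGraph W) (x y w : W) (T : Set W) : Prop :=
  ∃ a b, (a = x ∧ b = y ∨ a = y ∧ b = x) ∧ ∃ q ∈ T, ∃ A B n m, HasPathIn F A a w n ∧
    HasPathIn F B b q m ∧ Disjoint A B ∧ (∀ v ∈ A, v ∉ T) ∧ ∀ v ∈ B, v ∈ T → v = q

theorem ConnectedAvoiding.linked_aux (hF : ConnectedAvoiding F) {r : ℕ → W} {m : ℕ}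
    (hr : ∀ i < m, F.Adj (r i) (r (i + 1))) (hinj : Set.InjOn r (Set.Iic m)) {T : Set W}
    (hT : T.Nonempty) (hrT : ∀ i ≤ m, r i ∉ T) {x y : W} (d : ℕ) :
    ∀ (s : ℕ) (p q z : W) (P Q : Set W) (n n' : ℕ), s ≤ m → (p = x ∧ q = y ∨ p = y ∧ q = x) →
      HasPathIn F P p (r s) n → HasPathIn F Q q z n' → Disjoint P Q → (∀ v ∈ P, v ∉ T) →
      (∀ u, s < u → u ≤ m → r u ∉ P) → (∀ v ∈ Q, v ∈ T → v = z) →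
      (∀ u, s ≤ u → u ≤ m → r u ∈ Q → r u = z) →
      (z ∈ T ∨ ∃ u, s < u ∧ u ≤ m ∧ z = r u ∧ m < u + d) → Linked F x y (r m) T := by
  induction d with
  | zero =>
    intro s p q z P Q n n' hs hpq hP hQ hPQ hPT hPr hQT hQr hz
    rcases hz with hz | ⟨u, -, h₁, -, h₂⟩
    · refine ⟨p, q, hpq, z, hz, P ∪ r '' Set.Icc s m, Q, _, _,
        hP.append (.segment hr hinj hs le_rfl) ?_, hQ, ?_, ?_, hQT⟩
      · rintro _ hv ⟨u, hu, rfl⟩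
        simp only [Set.mem_Icc] at hu
        by_contra hne
        exact hPr u (lt_of_le_of_ne hu.1 fun h => hne (by rw [h])) hu.2 hv
      · rw [Set.disjoint_union_left]
        refine ⟨hPQ, Set.disjoint_left.2 ?_⟩
        rintro _ ⟨u, hu, rfl⟩ hv
        exact hrT u hu.2 (hQr u hu.1 hu.2 hv ▸ hz)
      · rintro _ (hv | ⟨u, hu, rfl⟩)
        · exact hPT _ hv
        · exact hrT u hu.2
    · omega
  | succ d ih =>
    intro s p q z P Q n n' hs hpq hP hQ hPQ hPT hPr hQT hQr hz
    rcases hz with hz | ⟨u, hsu, hum, rfl, hd⟩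
    · exact ih s p q z P Q n n' hs hpq hP hQ hPQ hPT hPr hQT hQr (Or.inl hz)
    have hinj' : ∀ i j, i ≤ m → j ≤ m → r i = r j → i = j := fun i j hi hj h => hinj hi hj h
    have hP₁ := hP.append (.segment hr hinj (s := s) (t := u - 1) (by omega) (by omega)) (by
      rintro _ hv ⟨i, hi, rfl⟩
      simp only [Set.mem_Icc] at hi
      by_contra hne
      exact hPr i (lt_of_le_of_ne hi.1 fun h => hne (by rw [h])) (by omega) hv)
    have hPQ₁ : Disjoint (P ∪ r '' Set.Icc s (u - 1)) Q := by
      rw [Set.disjoint_union_left]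
      refine ⟨hPQ, Set.disjoint_left.2 ?_⟩
      rintro _ ⟨i, hi, rfl⟩ hv
      simp only [Set.mem_Icc] at hi
      have := hinj' _ _ (by omega) hum (hQr i hi.1 (by omega) hv)
      omega
    have hPT₁ : ∀ v ∈ P ∪ r '' Set.Icc s (u - 1), v ∉ T := by
      rintro _ (hv | ⟨i, hi, rfl⟩)
      · exact hPT _ hv
      · simp only [Set.mem_Icc] at hi
        exact hrT i (by omega)
    have hPr₁ : ∀ i, u ≤ i → i ≤ m → r i ∉ P ∪ r '' Set.Icc s (u - 1) := by
      rintro i hi him (hv | ⟨j, hj, hji⟩)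
      · exact hPr i (by omega) him hv
      · simp only [Set.mem_Icc] at hj
        have := hinj' _ _ (by omega) him hji
        omega
    have hQr₁ : ∀ i, u < i → i ≤ m → r i ∉ Q := by
      intro i hi him hv
      have := hinj' _ _ him hum (hQr i (by omega) him hv)
      omega
    have hQT₁ : ∀ v ∈ Q, v ∉ T := fun v hv hvT => hrT u hum (hQT v hv hvT ▸ hvT)
    obtain ⟨A, hAsub, hA, hAtight⟩ := hP₁.exists_tight
    obtain ⟨B, hBsub, hB, hBtight⟩ := hQ.exists_tight
    have hAB : ∀ v ∈ A, v ∉ B := fun v hv hv' =>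
      Set.disjoint_left.1 hPQ₁ (hAsub hv) (hBsub hv')
    obtain ⟨τ, hτ⟩ := hT
    have hne : r (u - 1) ≠ r u := by
      intro h
      have := hinj' _ _ (by omega) hum h
      omega
    obtain ⟨_, hE⟩ := hF (r u) (r (u - 1)) τ hne (fun h => hrT u hum (h ▸ hτ))
    obtain ⟨z, hz, E, hEsub, _, hE, hEz⟩ :=
      hE.exists_first (T := T ∪ r '' Set.Ioc u m) (Or.inl hτ)
    obtain ⟨σ, hσ, C, hCsub, _, hC, hCσ⟩ :=
      hE.symm.exists_first (T := A ∪ B) (Or.inl hA.right_mem)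
    have hCu : r u ∉ C := fun h => hEsub (hCsub h) rfl
    have hCT : ∀ v ∈ C, v ∈ T → v = z := fun v hv hvT => hEz v (hCsub hv) (Or.inl hvT)
    have hCr : ∀ i, u ≤ i → i ≤ m → r i ∈ C → r i = z := by
      intro i hi him hv
      rcases hi.eq_or_lt with rfl | hlt
      · exact absurd hv hCu
      · exact hEz _ (hCsub hv) (Or.inr ⟨i, ⟨hlt, him⟩, rfl⟩)
    have hz' : z ∈ T ∨ ∃ i, u < i ∧ i ≤ m ∧ z = r i ∧ m < i + d := by
      rcases hz with hz | ⟨i, hi, rfl⟩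
      · exact Or.inl hz
      · exact Or.inr ⟨i, hi.1, hi.2, rfl, by have := hi.1; omega⟩
    rcases hσ with hσ | hσ
    · obtain ⟨A₁, hA₁sub, _, hA₁, -⟩ := hAtight σ hσ
      have hQ' := hA₁.append hC.symm fun v hv hv' => hCσ v hv' (Or.inl (hA₁sub hv))
      refine ih u q p z B (A₁ ∪ C) _ _ hum (by tauto) hB hQ' ?_ ?_ ?_ ?_ ?_ hz'
      · rw [Set.disjoint_left]
        rintro v hv (hv' | hv')
        · exact hAB v (hA₁sub hv') hv
        · exact hAB σ hσ (hCσ v hv' (Or.inr hv) ▸ hv)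
      · exact fun v hv => hQT₁ v (hBsub hv)
      · exact fun i hi him hv => hQr₁ i hi him (hBsub hv)
      · rintro v (hv | hv) hvT
        · exact absurd hvT (hPT₁ v (hAsub (hA₁sub hv)))
        · exact hCT v hv hvT
      · rintro i hi him (hv | hv)
        · exact absurd (hAsub (hA₁sub hv)) (hPr₁ i hi him)
        · exact hCr i hi him hv
    · have hσu : σ ≠ r u := fun h => hCu (h ▸ hC.right_mem)
      obtain ⟨B₁, hB₁sub, _, hB₁, hB₁u⟩ := hBtight σ hσ
      have hQ' := hB₁.append hC.symm fun v hv hv' => hCσ v hv' (Or.inr (hB₁sub hv))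
      have hdis : Disjoint A (B₁ ∪ C) := by
        rw [Set.disjoint_left]
        rintro v hv (hv' | hv')
        · exact hAB v hv (hB₁sub hv')
        · exact hAB v hv (hCσ v hv' (Or.inl hv) ▸ hσ)
      refine ih (u - 1) p q z A (B₁ ∪ C) _ _ (by omega) hpq hA hQ' hdis ?_ ?_ ?_ ?_ ?_
      · exact fun v hv => hPT₁ v (hAsub hv)
      · exact fun i hi him hv => hPr₁ i (by omega) him (hAsub hv)
      · rintro v (hv | hv) hvT
        · exact absurd hvT (hQT₁ v (hBsub (hB₁sub hv)))
        · exact hCT v hv hvT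
      · intro i hi him hv
        rcases hi.eq_or_lt with rfl | hlt
        · exact absurd hv (Set.disjoint_left.1 hdis hA.right_mem)
        · rcases hv with hv | hv
          · rcases (show u ≤ i by omega).eq_or_lt with rfl | hlt'
            · exact absurd hv (hB₁u hσu)
            · exact absurd (hBsub (hB₁sub hv)) (hQr₁ i hlt' him)
          · exact hCr i (by omega) him hv
      · rcases hz' with hz' | ⟨i, hi, hi'⟩
        · exact Or.inl hz'
        · exact Or.inr ⟨i, by omega, hi'⟩

/-- In a graph without cut vertices, a path from `x` to `w` avoiding `T` can be rerouted
into two disjoint paths from `x` and `y` to `w` and `T`. -/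
theorem ConnectedAvoiding.linked (hF : ConnectedAvoiding F) {r : ℕ → W} {m : ℕ}
    (hr : ∀ i < m, F.Adj (r i) (r (i + 1))) (hinj : Set.InjOn r (Set.Iic m)) {T : Set W}
    (hT : T.Nonempty) (hrT : ∀ i ≤ m, r i ∉ T) {y : W} (hy : r 0 ≠ y) :
    Linked F (r 0) y (r m) T := by
  obtain ⟨τ, hτ⟩ := hT
  obtain ⟨_, hE⟩ := hF (r 0) y τ hy.symm (fun h => hrT 0 (Nat.zero_le _) (h ▸ hτ))
  obtain ⟨z, hz, E, hEsub, _, hE, hEz⟩ :=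
    hE.exists_first (T := T ∪ r '' Set.Ioc 0 m) (Or.inl hτ)
  refine hF.linked_aux hr hinj ⟨τ, hτ⟩ hrT (m + 1) 0 (r 0) y z {r 0} E 0 _ (Nat.zero_le _)
    (Or.inl ⟨rfl, rfl⟩) (.nil rfl) hE ?_ ?_ ?_ ?_ ?_ ?_
  · exact Set.disjoint_singleton_left.2 fun h => hEsub h rfl
  · rintro _ rfl
    exact hrT 0 (Nat.zero_le _)
  · intro u hu hum h
    have := hinj hum (Nat.zero_le m) h
    omega
  · exact fun v hv hvT => hEz v hv (Or.inl hvT)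
  · intro u _ hum hv
    rcases Nat.eq_zero_or_pos u with rfl | hu
    · exact absurd rfl (hEsub hv)
    · exact hEz _ hv (Or.inr ⟨u, ⟨hu, hum⟩, rfl⟩)
  · rcases hz with hz | ⟨u, hu, rfl⟩
    · exact Or.inl hz
    · exact Or.inr ⟨u, hu.1, hu.2, rfl, by omega⟩

end Linkage

section CycleWithChord

variable {W : Type*} {J : SimpleGraph W}

theorem HasPathIn.length_lt_card [Fintype W] {A : Set W} {x y : W} {n : ℕ}
    (h : HasPathIn J A x y n) : n < Fintype.card W := by
  obtain ⟨p, hp, rfl, -⟩ := h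
  exact hp.length_lt

theorem exists_longest_path [Fintype W] {S : Set W} (hS : S.Nonempty) :
    ∃ u v L, HasPathIn J S u v L ∧ ∀ u' v', ¬ HasPathIn J S u' v' (L + 1) := by
  by_contra! h
  obtain ⟨s, hs⟩ := hS
  have : ∀ n : ℕ, ∃ u v, HasPathIn J S u v n := by
    intro n
    induction n with
    | zero => exact ⟨s, s, .nil hs⟩
    | succ n ih =>
      obtain ⟨u, v, h'⟩ := ih
      exact h u v n h'
  obtain ⟨u, v, h'⟩ := this (Fintype.card W)
  exact h'.length_lt_card.ne rfl

theorem exists_seq_initial_neighbors [Fintype W] {S : Finset W} (hS : S.Nonempty) :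
    ∃ (e : ℕ → W) (L : ℕ), (∀ i < L, J.Adj (e i) (e (i + 1))) ∧ Set.InjOn e (Set.Iic L) ∧
      e 0 ∈ S ∧ ∀ v ∈ S, J.Adj (e 0) v → ∃ i ≤ L, e i = v := by
  obtain ⟨u, v, L, hL, hmax⟩ := exists_longest_path (J := J) (S := (S : Set W)) hS
  obtain ⟨e, rfl, rfl, hadj, hinj, he⟩ := hL.exists_seq
  refine ⟨e, L, hadj, hinj, he 0, fun v hv hev => ?_⟩
  by_contra! hne
  refine hmax v (e L) (((HasPathIn.of_seq e L hadj hinj).cons hev.symm ?_).mono ?_)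
  · rintro ⟨i, hi, h⟩
    exact hne i hi h
  · rintro _ (rfl | ⟨i, -, rfl⟩)
    exacts [hv, he i]

/-- Large minimum degree in a bipartite graph forces a long even cycle, indexed periodically by
the integers, with a chord whose ends are far apart on the cycle. -/
theorem exists_cycle_with_chord [Fintype W] {col : W → Bool}
    (hcol : ∀ u v, J.Adj u v → col u ≠ col v) {k : ℕ} (hk : 1 ≤ k) {S : Finset W}
    (hS : S.Nonempty) (hdeg : ∀ v ∈ S, 4 * k < degInto J S v) :
    ∃ (c : ℤ → W) (N j : ℤ), (∀ i i', c i = c i' → N ∣ i - i') ∧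
      (∀ i, J.Adj (c i) (c (i + 1))) ∧ j % 2 = 1 ∧ J.Adj (c 0) (c j) ∧ 2 * k ≤ j ∧
      j + 2 * k ≤ N := by
  classical
  obtain ⟨e, L, hadj, hinj, he, hnb⟩ := exists_seq_initial_neighbors (J := J) hS
  have hpar : ∀ i ≤ L, (col (e i) = col (e 0) ↔ Even i) := by
    intro i
    induction i with
    | zero => simp
    | succ i ih =>
      intro hi
      have h₁ := ih (by omega)
      have h₂ := hcol _ _ (hadj i (by omega))
      rw [Nat.even_add_one, ← h₁]
      cases h₃ : col (e i) <;> cases h₄ : col (e (i + 1)) <;> cases h₅ : col (e 0) <;> simp_all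
  let I := (Finset.range (L + 1)).filter fun i => J.Adj (e 0) (e i)
  have hI : ∀ i ∈ I, i ≤ L ∧ J.Adj (e 0) (e i) ∧ i % 2 = 1 := by
    intro i hi
    obtain ⟨hi, hiadj⟩ := Finset.mem_filter.1 hi
    have hi := Finset.mem_range.1 hi
    refine ⟨by omega, hiadj, ?_⟩
    have := hpar i (by omega)
    by_contra hne
    exact hcol _ _ hiadj (this.2 (Nat.even_iff.2 (by omega))).symm
  have hcard : 4 * k < I.card := by
    refine (hdeg _ he).trans_le ?_
    rw [degInto_eq_card]
    refine (Finset.card_le_card (t := I.image e) fun v hv => ?_).trans Finset.card_image_le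
    obtain ⟨hv, hev⟩ := Finset.mem_filter.1 hv
    obtain ⟨i, hi, rfl⟩ := hnb v hv hev
    exact Finset.mem_image_of_mem _
      (Finset.mem_filter.2 ⟨Finset.mem_range.2 (by omega), by convert hev⟩)
  have hIne : I.Nonempty := Finset.card_pos.1 (by omega)
  obtain ⟨M, hM⟩ : ∃ M, M = I.max' hIne := ⟨_, rfl⟩
  have hMI : M ∈ I := hM ▸ Finset.max'_mem _ _
  have hle : ∀ i ∈ I, i ≤ M := fun i hi => hM ▸ Finset.le_max' _ _ hi
  obtain ⟨j, hj, hj₁, hj₂⟩ : ∃ j ∈ I, 2 * k ≤ j ∧ j + 2 * k ≤ M + 1 := by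
    by_contra! hno
    have hsub : I ⊆ Finset.range (2 * k) ∪ Finset.Ioc (M + 1 - 2 * k) M := by
      intro i hi
      rw [Finset.mem_union, Finset.mem_range, Finset.mem_Ioc]
      have := hno i hi
      have := hle i hi
      omega
    have h₁ := (Finset.card_le_card hsub).trans (Finset.card_union_le _ _)
    rw [Finset.card_range, Nat.card_Ioc] at h₁
    omega
  obtain ⟨hML, hMadj, hM2⟩ := hI M hMI
  obtain ⟨hjL, hjadj, hj2⟩ := hI j hj
  have hN : (0 : ℤ) < M + 1 := by omega
  have hmod : ∀ i : ℤ, 0 ≤ i % (M + 1 : ℤ) ∧ i % (M + 1 : ℤ) < M + 1 := fun i =>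
    ⟨Int.emod_nonneg _ hN.ne', Int.emod_lt_of_pos _ hN⟩
  refine ⟨fun i => e (i % (M + 1 : ℤ)).toNat, M + 1, j, ?_, ?_, by omega, ?_, by omega, by omega⟩
  · intro i i' h
    have h₁ := hmod i
    have h₂ := hmod i'
    have := hinj (by simp only [Set.mem_Iic]; omega) (by simp only [Set.mem_Iic]; omega) h
    exact Int.dvd_of_emod_eq_zero
      (Int.emod_eq_emod_iff_emod_sub_eq_zero.1 (by omega : i % (M + 1 : ℤ) = i' % (M + 1 : ℤ)))
  · intro i
    have h₁ := hmod i
    rcases (show i % (M + 1 : ℤ) < M ∨ i % (M + 1 : ℤ) = M by omega) with h | h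
    · have : (i + 1) % (M + 1 : ℤ) = i % (M + 1 : ℤ) + 1 := by
        rw [Int.add_emod, Int.emod_eq_of_lt (a := 1) (by omega) (by omega)]
        exact Int.emod_eq_of_lt (by omega) (by omega)
      simp only [this]
      rw [show (i % (M + 1 : ℤ) + 1).toNat = (i % (M + 1 : ℤ)).toNat + 1 by omega]
      exact hadj _ (by omega)
    · have : (i + 1) % (M + 1 : ℤ) = 0 := by
        rw [Int.add_emod, h, Int.emod_eq_of_lt (a := 1) (by omega) (by omega)]
        exact Int.emod_self
      simp only [this, h]
      simpa using hMadj.symm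
  · simp only [Int.zero_emod]
    rw [Int.emod_eq_of_lt (by omega) (by omega)]
    simpa using hjadj

end CycleWithChord

section Hub

variable {W : Type*} {F : SimpleGraph W} {lev : W → ℕ} {par : W → W}

theorem lev_iterate (hlev : ∀ v, lev v ≠ 0 → lev (par v) + 1 = lev v) (v : W) {s : ℕ}
    (hs : s ≤ lev v) : lev (par^[s] v) + s = lev v := by
  induction s with
  | zero => rfl
  | succ s ih =>
    have h₁ := ih (by omega)
    rw [Function.iterate_succ_apply']
    have h₂ := hlev (par^[s] v) (by omega)
    omega

theorem injOn_iterate (hlev : ∀ v, lev v ≠ 0 → lev (par v) + 1 = lev v) (v : W) {s : ℕ}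
    (hs : s ≤ lev v) : Set.InjOn (fun u => par^[u] v) (Set.Iic s) := by
  intro a ha b hb hab
  simp only [Set.mem_Iic] at ha hb
  have h₁ := lev_iterate hlev v (ha.trans hs)
  have h₂ := lev_iterate hlev v (hb.trans hs)
  simp only at hab
  rw [hab] at h₁
  omega

theorem adj_iterate (hpar : ∀ v, lev v ≠ 0 → F.Adj v (par v))
    (hlev : ∀ v, lev v ≠ 0 → lev (par v) + 1 = lev v) (v : W) {s : ℕ}
    (hs : s < lev v) : F.Adj (par^[s] v) (par^[s + 1] v) := by
  rw [Function.iterate_succ_apply']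
  have := lev_iterate hlev v hs.le
  exact hpar _ (by omega)

theorem hasPathIn_iterate (hpar : ∀ v, lev v ≠ 0 → F.Adj v (par v))
    (hlev : ∀ v, lev v ≠ 0 → lev (par v) + 1 = lev v) (v : W) {s : ℕ} (hs : s ≤ lev v) :
    HasPathIn F ((fun u => par^[u] v) '' Set.Iic s) v (par^[s] v) s :=
  .of_seq (fun u => par^[u] v) s (fun _ hu => adj_iterate hpar hlev v (hu.trans_le hs))
    (injOn_iterate hlev v hs)

theorem iterate_eq_of_le {a b : W} {u s : ℕ} (hus : u ≤ s) (h : par^[u] a = par^[u] b) :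
    par^[s] a = par^[s] b := by
  rw [← Nat.sub_add_cancel hus, Function.iterate_add_apply, Function.iterate_add_apply, h]

/-- A long cycle with a chord between two consecutive levels of a rooted tree extends to a set
`T` each vertex of which is joined to a common vertex `w` of lower level by paths of many
lengths of the same parity. -/
theorem exists_hub {x : W} (hpar : ∀ v, lev v ≠ 0 → F.Adj v (par v))
    (hlev : ∀ v, lev v ≠ 0 → lev (par v) + 1 = lev v) (hlev0 : ∀ v, lev v = 0 → v = x)
    {c : ℤ → W} {N j : ℤ} {k ℓ : ℕ} (hk : 1 ≤ k) (hc : ∀ i i', c i = c i' → N ∣ i - i')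
    (hadj : ∀ i, F.Adj (c i) (c (i + 1))) (hj : j % 2 = 1) (hchord : F.Adj (c 0) (c j))
    (hjk : 2 * k ≤ j) (hjN : j + 2 * k ≤ N) (hcl : ∀ i, lev (c i) = ℓ ∨ lev (c i) = ℓ + 1)
    (halt : ∀ i, lev (c i) ≠ lev (c (i + 1))) :
    ∃ (w : W) (T : Set W), T.Nonempty ∧ (∀ v ∈ T, lev w < lev v) ∧
      ∀ q ∈ T, ∃ n, ∀ i < k, HasPathIn F (insert w T) w q (n + 2 * i) := by
  classical
  obtain ⟨e, he⟩ : ∃ e : ℤ, ∀ i, lev (c i) = ℓ ↔ (i - e) % 2 = 0 := by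
    have step : ∀ i, lev (c (i + 1)) = ℓ ↔ ¬ lev (c i) = ℓ := by
      intro i
      have h₁ := hcl i
      have h₂ := hcl (i + 1)
      have h₃ := halt i
      omega
    have shift : ∀ (e : ℤ), lev (c e) = ℓ → ∀ i, lev (c i) = ℓ ↔ (i - e) % 2 = 0 := by
      intro e h₀ i
      induction i using Int.inductionOn' (b := e) with
      | zero => simpa using h₀
      | succ i _ ih =>
        rw [step, ih]
        omega
      | pred i _ ih =>
        have := step (i - 1)
        rw [sub_add_cancel] at this
        rw [this] at ih
        omega
    rcases hcl 0 with h | h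
    · exact ⟨0, shift 0 h⟩
    · exact ⟨1, shift 1 (by have := step 0; rw [zero_add] at this; rw [this]; omega)⟩
  have hlevc : ∀ i, ℓ ≤ lev (c i) := fun i => by rcases hcl i with h | h <;> omega
  have hex : ∃ r, ∃ w, ∀ i, (i - e) % 2 = 0 → par^[r] (c i) = w := by
    refine ⟨ℓ, x, fun i hi => hlev0 _ ?_⟩
    have h := (he i).2 hi
    have := lev_iterate hlev (c i) h.ge
    omega
  obtain ⟨r, hr⟩ : ∃ r, r = Nat.find hex := ⟨_, rfl⟩
  obtain ⟨w, hw⟩ := Nat.find_spec hex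
  rw [← hr] at hw
  have hmin : ∀ s < r, ∀ q, ∃ i, (i - e) % 2 = 0 ∧ par^[s] (c i) ≠ q := by
    intro s hs q
    have := Nat.find_min hex (hr ▸ hs)
    by_contra! hno
    exact this ⟨q, hno⟩
  have hrl : r ≤ ℓ := by
    rw [hr]
    refine Nat.find_min' hex ⟨x, fun i hi => hlev0 _ ?_⟩
    have h := (he i).2 hi
    have := lev_iterate hlev (c i) h.ge
    omega
  have hr1 : 1 ≤ r := by
    by_contra! h0
    obtain rfl : r = 0 := by omega
    have h := (hw e (by simp)).trans (hw (e + 2) (by simp)).symm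
    have := Int.le_of_dvd (by omega) ((dvd_sub_comm).1 (hc _ _ h))
    omega
  have hlw : lev w + r = ℓ := by
    have h := (he e).2 (by simp)
    have := lev_iterate hlev (c e) (hrl.trans h.ge)
    rw [hw e (by simp), h] at this
    exact this
  have hup : ∀ i, (i - e) % 2 = 0 → ∀ s ≤ r, lev (par^[s] (c i)) + s = ℓ := by
    intro i hi s hs
    have h := (he i).2 hi
    rw [lev_iterate hlev (c i) (by omega), h]
  let T : Set W := Set.range c ∪ {v | ∃ i, (i - e) % 2 = 0 ∧ ∃ s < r, par^[s] (c i) = v}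
  have hcT : Set.range c ⊆ insert w T := fun v hv => Or.inr (Or.inl hv)
  have hupT : ∀ i, (i - e) % 2 = 0 → ∀ s ≤ r,
      (fun u => par^[u] (c i)) '' Set.Iic s ⊆ insert w T := by
    rintro i hi s hs _ ⟨u, hu, rfl⟩
    simp only [Set.mem_Iic] at hu
    rcases (hu.trans hs).eq_or_lt with rfl | hlt
    · exact Or.inl (hw i hi)
    · exact Or.inr (Or.inr ⟨i, hi, u, hlt, rfl⟩)
  have hcup : ∀ i, (i - e) % 2 = 0 → ∀ s ≤ r,
      ∀ v ∈ (fun u => par^[u] (c i)) '' Set.Iic s, v ∈ Set.range c → v = c i := by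
    rintro i hi s hs _ ⟨u, hu, rfl⟩ ⟨i', hi'⟩
    simp only [Set.mem_Iic] at hu
    have h₁ := hup i hi u (hu.trans hs)
    simp only at hi'
    rw [← hi'] at h₁
    have := hlevc i'
    obtain rfl : u = 0 := by omega
    rfl
  have hpath : ∀ i, (i - e) % 2 = 0 → ∀ s ≤ r, HasPathIn F
      ((fun u => par^[u] (c i)) '' Set.Iic s) (c i) (par^[s] (c i)) s := fun i hi s hs =>
    hasPathIn_iterate hpar hlev _ (by rw [(he i).2 hi]; omega)
  have hlow : ∀ i₀, (i₀ - e) % 2 = 0 → ∀ s < r,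
      ∃ n, ∀ i < k, HasPathIn F (insert w T) w (par^[s] (c i₀)) (n + 2 * i) := by
    intro i₀ hi₀ s hs
    obtain ⟨i₁, hi₁, hne⟩ := hmin s hs (par^[s] (c i₀))
    refine ⟨r + 2 + s, fun i hi => ?_⟩
    obtain ⟨a, b, ha, hb, haA, hbA, hab⟩ := exists_crossing_path (t := i + 1)
      (A := {v | par^[s] v = par^[s] (c i₀)}) hc hadj hj hchord (by omega) (by push_cast; omega)
      (by push_cast; omega) hi₀ hi₁ rfl hne
    have h₁ := (hpath b hb r le_rfl).symm
    rw [hw b hb] at h₁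
    have h₂ := h₁.append hab.symm (hcup b hb r le_rfl)
    have h₃ := hpath a ha s hs.le
    rw [show par^[s] (c a) = par^[s] (c i₀) from haA] at h₃
    have h₄ := h₂.append h₃ (by
      rintro v (hv | hv) hv'
      · obtain ⟨u, hu, rfl⟩ := hv
        obtain ⟨u', hu', huu⟩ := hv'
        simp only [Set.mem_Iic] at hu hu' huu
        have hlb := hup b hb u hu
        have hla := hup a ha u' (hu'.trans hs.le)
        rw [huu] at hla
        obtain rfl : u' = u := by omega
        exact absurd ((iterate_eq_of_le hu' huu.symm).trans haA) hbA
      · exact hcup a ha s hs.le v hv' hv)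
    rw [show r + 2 * (i + 1) + s = r + 2 + s + 2 * i by ring] at h₄
    exact h₄.mono (Set.union_subset (Set.union_subset (hupT b hb r le_rfl) hcT)
      (hupT a ha s hs.le))
  refine ⟨w, T, ⟨c 0, Or.inl ⟨0, rfl⟩⟩, ?_, ?_⟩
  · rintro _ (⟨i, rfl⟩ | ⟨i, hi, s, hs, rfl⟩)
    · have := hlevc i
      omega
    · have := hup i hi s hs.le
      omega
  · rintro _ (⟨i₀, rfl⟩ | ⟨i₀, hi₀, s, hs, rfl⟩)
    · by_cases hi₀ : (i₀ - e) % 2 = 0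
      · exact hlow i₀ hi₀ 0 hr1
      · refine ⟨r + 1, fun i hi => ?_⟩
        have hpar' : (i₀ + (1 + 2 * i) - e) % 2 = 0 := by omega
        have h₁ := HasPathIn.arc hc hadj (i := i₀) (i' := i₀ + (1 + 2 * i)) (by omega) (by omega)
        have h₂ := (hpath _ hpar' r le_rfl).symm
        rw [hw _ hpar'] at h₂
        have h₃ := h₂.append (h₁.symm.mono (Set.image_subset_range _ _))
          (hcup _ hpar' r le_rfl)
        rw [show r + (i₀ + (1 + 2 * i) - i₀).toNat = r + 1 + 2 * i by omega] at h₃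
        exact h₃.mono (Set.union_subset (hupT _ hpar' r le_rfl) hcT)
    · exact hlow i₀ hi₀ s hs

end Hub

section Core

variable {W : Type*} {F : SimpleGraph W}

/-- The edges of `F` whose ends lie in the same block of two levels, where the blocks are formed
with offset `ε`. -/
def layered (F : SimpleGraph W) (lev : W → ℕ) (ε : ℕ) : SimpleGraph W where
  Adj u v := F.Adj u v ∧ (lev u + ε) / 2 = (lev v + ε) / 2
  symm := ⟨fun _ _ h => ⟨h.1.symm, h.2.symm⟩⟩
  loopless := ⟨fun _ h => h.1.ne rfl⟩

theorem degSum_layered {lev : W → ℕ}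
    (hlev : ∀ u v, F.Adj u v → lev u = lev v + 1 ∨ lev v = lev u + 1) (S : Finset W) :
    degSum F S = degSum (layered F lev 0) S + degSum (layered F lev 1) S := by
  simp only [degSum, ← Finset.sum_add_distrib]
  refine Finset.sum_congr rfl fun u _ => Finset.sum_congr rfl fun v _ => ?_
  by_cases h : F.Adj u v
  · have := hlev u v h
    have h₁ : (lev u + 0) / 2 = (lev v + 0) / 2 ↔ ¬ (lev u + 1) / 2 = (lev v + 1) / 2 := by
      omega
    by_cases h₂ : (lev u + 1) / 2 = (lev v + 1) / 2 <;> simp only [layered, h, h₁, h₂] <;> simp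
  · simp [layered, h]

theorem degSum_univ_le [Fintype W] : degSum F Finset.univ ≤ Fintype.card W * Fintype.card W := by
  classical
  calc degSum F Finset.univ ≤ ∑ _v : W, ∑ _u : W, 1 :=
        Finset.sum_le_sum fun _ _ => Finset.sum_le_sum fun _ _ => by split_ifs <;> simp
    _ = _ := by simp

theorem ConnectedAvoiding.reachable [Fintype W] (hF : ConnectedAvoiding F)
    (hW : 3 ≤ Fintype.card W) (a b : W) : F.Reachable a b := by
  classical
  obtain ⟨v, -, hv⟩ := Finset.exists_mem_notMem_of_card_lt_card (s := {a, b})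
    (t := (Finset.univ : Finset W)) (Finset.card_le_two.trans_lt (by rw [Finset.card_univ]; omega))
  simp only [Finset.mem_insert, Finset.mem_singleton, not_or] at hv
  obtain ⟨n, p, -⟩ := hF v a b (Ne.symm hv.1) (Ne.symm hv.2)
  exact ⟨p⟩

theorem exists_parent (hF : ∀ a b, F.Reachable a b) (x : W) :
    ∃ par : W → W, ∀ v, F.dist x v ≠ 0 → F.Adj v (par v) ∧ F.dist x (par v) + 1 = F.dist x v := by
  have : ∀ v, ∃ u, F.dist x v ≠ 0 → F.Adj v u ∧ F.dist x u + 1 = F.dist x v := by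
    intro v
    obtain ⟨p, hp⟩ := (hF v x).exists_walk_length_eq_dist
    rw [SimpleGraph.dist_comm] at hp
    cases p with
    | nil => exact ⟨x, fun h => absurd hp.symm h⟩
    | @cons _ u _ h q =>
      refine ⟨u, fun _ => ⟨h, ?_⟩⟩
      have h₁ := SimpleGraph.dist_le q
      rw [SimpleGraph.dist_comm] at h₁
      have h₂ := (h.diff_dist_adj (u := x))
      rw [Walk.length_cons] at hp
      omega
  choose par hpar using this
  exact ⟨par, hpar⟩

/-- In a dense bipartite graph without cut vertices, any two vertices are joined by paths of
many lengths of the same parity. -/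
theorem ConnectedAvoiding.exists_paths [Fintype W] (hF : ConnectedAvoiding F) {col : W → Bool}
    (hcol : ∀ u v, F.Adj u v → col u ≠ col v) {k : ℕ} (hk : 1 ≤ k)
    (hdeg : 16 * k * Fintype.card W ≤ degSum F Finset.univ) {x y : W} (hxy : x ≠ y) :
    ∃ n, ∀ i < k, HasPathIn F Set.univ x y (n + 2 * i) := by
  have : Nonempty W := ⟨x⟩
  have hW : 3 ≤ Fintype.card W := by
    have h₁ := hdeg.trans degSum_univ_le
    have := Nat.le_of_mul_le_mul_right h₁ Fintype.card_pos
    omega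
  have hconn := hF.reachable hW
  obtain ⟨par, hpar⟩ := exists_parent hconn x
  have hdist : ∀ u v, F.Adj u v → F.dist x u = F.dist x v + 1 ∨ F.dist x v = F.dist x u + 1 := by
    intro u v huv
    have hdiff := huv.diff_dist_adj (u := x)
    have hpar' : ∀ v, Even (F.dist x v) ↔ (col x ↔ col v) := by
      intro v
      obtain ⟨p, hp⟩ := (hconn x v).exists_walk_length_eq_dist
      rw [← hp]
      exact (Coloring.mk col fun h => hcol _ _ h).even_length_iff_congr p
    have hne : F.dist x u ≠ F.dist x v := by
      intro h
      have h₁ := hpar' u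
      rw [h, hpar' v] at h₁
      have h₂ := hcol u v huv
      cases h₃ : col u <;> cases h₄ : col v <;> cases h₅ : col x <;> simp_all
    omega
  obtain ⟨ε, hε⟩ : ∃ ε, 8 * k * Fintype.card W ≤ degSum (layered F (F.dist x) ε) Finset.univ := by
    by_contra! hno
    have h₀ := hno 0
    have h₁ := hno 1
    rw [degSum_layered hdist, show 16 * k = 8 * k + 8 * k by ring, add_mul] at hdeg
    omega
  obtain ⟨S, hS, hSdeg, -⟩ := exists_connectedAvoiding_subset (by omega) hε
  obtain ⟨c, N, j, hc, hadj, hj, hchord, hjk, hjN⟩ :=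
    exists_cycle_with_chord (J := layered F (F.dist x) ε) (col := col)
      (fun u v h => hcol u v h.1) hk hS (fun v hv => by have := hSdeg v hv; omega)
  have hblock : ∀ i, (F.dist x (c i) + ε) / 2 = (F.dist x (c 0) + ε) / 2 := by
    intro i
    induction i using Int.inductionOn' (b := 0) with
    | zero => rfl
    | succ i _ ih => rw [← ih, (hadj i).2]
    | pred i _ ih =>
      have := (hadj (i - 1)).2
      rw [sub_add_cancel] at this
      rw [this, ih]
  obtain ⟨ℓ, hℓ⟩ : ∃ ℓ, ∀ i, F.dist x (c i) = ℓ ∨ F.dist x (c i) = ℓ + 1 := by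
    rcases hdist _ _ (hadj 0).1 with h | h
    · refine ⟨F.dist x (c (0 + 1)), fun i => ?_⟩
      have h₁ := (hadj 0).2
      have h₂ := hblock i
      omega
    · refine ⟨F.dist x (c 0), fun i => ?_⟩
      have h₁ := (hadj 0).2
      have h₂ := hblock i
      omega
  have hlev : ∀ v, F.dist x v ≠ 0 → F.dist x (par v) + 1 = F.dist x v := fun v hv => (hpar v hv).2
  obtain ⟨w, T, hT, hTlev, hTpath⟩ := exists_hub (lev := F.dist x) (x := x)
    (fun v hv => (hpar v hv).1) hlev
    (fun v hv => ((hconn x v).dist_eq_zero_iff.1 hv).symm) hk hc (fun i => (hadj i).1) hj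
    hchord.1 hjk hjN hℓ (fun i => by have := hdist _ _ (hadj i).1; omega)
  obtain ⟨m, hm⟩ : ∃ m, m = F.dist x w := ⟨_, rfl⟩
  have hx : par^[m] w = x := by
    have := lev_iterate hlev w hm.le
    exact ((hconn x _).dist_eq_zero_iff.1 (by omega)).symm
  have hlink := hF.linked (r := fun i => par^[m - i] w) (m := m) (T := T) (y := y) (fun i hi => by
      have := adj_iterate (s := m - i - 1) (fun v hv => (hpar v hv).1) hlev w (by omega)
      rw [show m - i - 1 + 1 = m - i by omega] at this
      exact this.symm) (fun a ha b hb hab => by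
      simp only [Set.mem_Iic] at ha hb
      have := injOn_iterate hlev w hm.le (by simp) (by simp) hab
      omega) hT (fun i _ h => by
      have h₁ := hTlev _ h
      have h₂ := lev_iterate hlev w (s := m - i) (by omega)
      omega) (by simpa [hx] using hxy)
  simp only [Nat.sub_zero, hx, Nat.sub_self, Function.iterate_zero, id] at hlink
  obtain ⟨a, b, hab, q, hq, A, B, n₁, n₂, hA, hB, hAB, hAT, hBT⟩ := hlink
  obtain ⟨n, hn⟩ := hTpath q hq
  have hpaths : ∀ i < k, HasPathIn F Set.univ a b (n₁ + n + n₂ + 2 * i) := by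
    intro i hi
    have h₁ := hA.append (hn i hi) (by
      rintro v hv (rfl | hv')
      · rfl
      · exact absurd hv' (hAT v hv))
    have h₂ := h₁.append hB.symm (by
      rintro v (hv | rfl | hv) hv'
      · exact absurd hv' (Set.disjoint_left.1 hAB hv)
      · exact absurd hv' (Set.disjoint_left.1 hAB hA.right_mem)
      · exact hBT v hv' hv)
    rw [show n₁ + (n + 2 * i) + n₂ = n₁ + n + n₂ + 2 * i by ring] at h₂
    exact h₂.mono (Set.subset_univ _)
  refine ⟨n₁ + n + n₂, fun i hi => ?_⟩
  rcases hab with ⟨rfl, rfl⟩ | ⟨rfl, rfl⟩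
  · exact hpaths i hi
  · exact (hpaths i hi).symm

end Core

section Main

variable {V : Type*} {G : SimpleGraph V}

theorem HasPathIn.induce {A S : Set V} {x y : V} {n : ℕ} (h : HasPathIn G A x y n)
    (hA : A ⊆ S) (hx : x ∈ S) (hy : y ∈ S) :
    HasPathIn (G.induce S) (Subtype.val ⁻¹' A) ⟨x, hx⟩ ⟨y, hy⟩ n := by
  obtain ⟨e, rfl, rfl, hadj, hinj, he⟩ := h.exists_seq
  refine (HasPathIn.of_seq (G := G.induce S) (fun i => ⟨e i, hA (he i)⟩) n hadj
    fun i hi j hj hij => hinj hi hj (congrArg Subtype.val hij)).mono ?_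
  rintro _ ⟨i, -, rfl⟩
  exact he i

theorem degSum_induce {S : Finset V} :
    degSum (G.induce (S : Set V)) Finset.univ = degSum G S := by
  classical
  simp only [degSum, comap_adj, Function.Embedding.subtype_apply]
  rw [← Finset.sum_coe_sort S]
  refine Finset.sum_congr rfl fun v _ => ?_
  rw [← Finset.sum_coe_sort S]
  rfl

theorem degSum_univ_eq [Fintype V] : degSum G Finset.univ = 2 * Nat.card G.edgeSet := by
  classical
  rw [Nat.card_eq_fintype_card, ← edgeFinset_card, ← sum_degrees_eq_twice_card_edges]
  refine Finset.sum_congr rfl fun v _ => ?_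
  rw [← card_neighborFinset_eq_degree, neighborFinset_eq_filter]
  simp

/-- A dense graph contains a nontrivial parity-linked vertex set. -/
theorem exists_parityLinked [Fintype V] [Nonempty V] {k : ℕ} (hk : 1 ≤ k)
    (h : 64 * k * Fintype.card V ≤ 2 * Nat.card G.edgeSet) :
    ∃ (S : Set V) (χ : V → Bool), S.Nontrivial ∧ ParityLinked G k S χ := by
  classical
  rw [← degSum_univ_eq] at h
  obtain ⟨χ, hχ⟩ := exists_bichromatic G
  have hB : 32 * k * Fintype.card V ≤ degSum (bichromatic G χ) Finset.univ := by
    have : 64 * k * Fintype.card V = 2 * (32 * k * Fintype.card V) := by ring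
    omega
  obtain ⟨S, hS, hSdeg, hSconn⟩ := exists_connectedAvoiding_subset (by omega) hB
  have hF : ConnectedAvoiding ((bichromatic G χ).induce (S : Set V)) := by
    rintro ⟨v, hv⟩ ⟨a, ha⟩ ⟨b, hb⟩ hav hbv
    obtain ⟨n, hn⟩ := hSconn v hv a ha b hb (fun h => hav (Subtype.ext h))
      (fun h => hbv (Subtype.ext h))
    refine ⟨n, (hn.induce Set.sdiff_subset ha hb).mono ?_⟩
    exact fun u hu hne => hu.2 (congrArg Subtype.val hne)
  have hdeg : 16 * k * Fintype.card (S : Set V) ≤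
      degSum ((bichromatic G χ).induce (S : Set V)) Finset.univ := by
    rw [degSum_induce, degSum_eq_sum_degInto]
    have hc : Fintype.card (S : Set V) = S.card := by simp
    rw [hc, mul_comm]
    exact Finset.card_nsmul_le_sum S _ _ fun v hv => by have := hSdeg v hv; omega
  refine ⟨S, χ, ?_, ?_⟩
  · obtain ⟨v, hv⟩ := hS
    have hpos : 0 < degInto (bichromatic G χ) S v := by have := hSdeg v hv; omega
    rw [degInto_eq_card] at hpos
    obtain ⟨u, hu⟩ := Finset.card_pos.1 hpos
    obtain ⟨hu, huv⟩ := Finset.mem_filter.1 hu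
    exact ⟨v, hv, u, hu, huv.ne⟩
  · intro x hx y hy hxy
    obtain ⟨n, hn⟩ := hF.exists_paths (col := fun v => χ v) (fun u v h => h.2) hk hdeg
      (x := ⟨x, hx⟩) (y := ⟨y, hy⟩) (fun h => hxy (congrArg Subtype.val h))
    refine ⟨n, ?_, fun i hi => ?_⟩
    · obtain ⟨p, -, hp, -⟩ := hn 0 (by omega)
      have := (Coloring.mk (fun v => χ v) fun h => h.2 :
        ((bichromatic G χ).induce (S : Set V)).Coloring Bool).even_length_iff_congr p
      rw [hp] at this
      rw [show n = n + 2 * 0 from rfl, this]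
      exact Bool.eq_iff_iff.symm
    · let f : (bichromatic G χ).induce (S : Set V) →g G := ⟨Subtype.val, fun h => h.1⟩
      refine ((hn i hi).map f Subtype.val_injective).mono ?_
      rintro _ ⟨⟨u, hu⟩, -, rfl⟩
      exact hu

end Main

theorem k_cycles_of_consecutive_odd_lengths :
    ∃ c : ℝ, 0 < c ∧ ∀ k : ℕ, 1 ≤ k →
      ∀ (V : Type) [Fintype V] (G : SimpleGraph V),
        ¬ G.Colorable 2 →                       -- `G` is not bipartite
        TwoConnected G →
        c * k * (Fintype.card V) ≤ 2 * (Nat.card G.edgeSet) →  -- average degree ≥ c * k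
        HasConsecutiveOddCycles G k := by
  refine ⟨64, by norm_num, fun k hk V _ G hbip htwo hdeg => ?_⟩
  have : Nonempty V := Fintype.card_pos_iff.1 (by have := htwo.1; omega)
  obtain ⟨S, χ, hnt, hS⟩ := exists_parityLinked hk (G := G) (by exact_mod_cast hdeg)
  exact hS.hasConsecutiveOddCycles htwo.connectedAvoiding hbip hnt
end
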